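/- For every d ≥ 3 and every ε > 0, assuming h̃(d) > −∞: limsup_{N→∞} inf{ P[ℰ(N, h, h−ε)] : h ∈ R, h ≤ h̃(d) − 2ε } = 1. -/

import Mathlib

open MeasureTheory ProbabilityTheory Filter Set

namespace GFFperc

noncomputable section

/-- The lattice `ℤ^d`. -/
abbrev V (d : ℕ) := Fin d → ℤ

/-- Nearest-neighbour adjacency on `ℤ^d`. -/
def adj {d : ℕ} (x y : V d) : Prop := (∑ i, (x i - y i).natAbs) = 1

/-- `ℓ∞` distance between two points. -/
def dinf {d : ℕ} (x y : V d) : ℕ := Finset.univ.sup fun i => (x i - y i).natAbs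

/-- `A` and `B` are joined by a nearest-neighbour path contained in `S`. -/
def ConnIn {d : ℕ} (S A B : Set (V d)) : Prop :=
  ∃ (n : ℕ) (γ : ℕ → V d), γ 0 ∈ A ∧ γ n ∈ B ∧ (∀ k, k ≤ n → γ k ∈ S) ∧
    ∀ k, k < n → adj (γ k) (γ (k + 1))

/-- A set is connected: any two of its points are joined inside it. -/
def IsConnSet {d : ℕ} (S : Set (V d)) : Prop := ∀ x ∈ S, ∀ y ∈ S, ConnIn S {x} {y}

/-- The connected component of `x` in `S`. -/
def comp {d : ℕ} (S : Set (V d)) (x : V d) : Set (V d) := {y | ConnIn S {x} {y}}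

/-- Box of (real) radius `r` centered at `x`. -/
def boxAt {d : ℕ} (x : V d) (r : ℝ) : Set (V d) := {y | ∀ i, |(y i : ℝ) - (x i : ℝ)| ≤ r}

def box (d : ℕ) (r : ℝ) : Set (V d) := boxAt (0 : V d) r

/-- Inner vertex boundary of the box of radius `r` centered at `x`. -/
def bdryAt {d : ℕ} (x : V d) (r : ℝ) : Set (V d) :=
  {y | y ∈ boxAt x r ∧ ∃ z, z ∉ boxAt x r ∧ adj y z}

def bdry (d : ℕ) (r : ℝ) : Set (V d) := bdryAt (0 : V d) r

/-- `A` is connected to infinity within `S`. -/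
def ConnToInf {d : ℕ} (S A : Set (V d)) : Prop := ∀ R : ℕ, 1 ≤ R → ConnIn S A (bdry d R)

/-- The `ℓ∞`-diameter of `S` is at least `r`. -/
def diamGE {d : ℕ} (S : Set (V d)) (r : ℝ) : Prop := ∃ x ∈ S, ∃ y ∈ S, r ≤ (dinf x y : ℝ)

def unitV (d : ℕ) (i : Fin d) : V d := fun j => if j = i then 1 else 0

/-- `k`-step transition probabilities of simple random walk on `ℤ^d`. -/
def srwP (d : ℕ) : ℕ → V d → V d → ℝ
  | 0, x, y => if x = y then 1 else 0
  | (k + 1), x, y =>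
      (1 / (2 * d)) * ∑ i : Fin d, (srwP d k (x + unitV d i) y + srwP d k (x - unitV d i) y)

/-- Green function of simple random walk on `ℤ^d`. -/
def green (d : ℕ) (x y : V d) : ℝ := ∑' k : ℕ, srwP d k x y

/-- `ℓ`-step transition kernel of the lazy simple random walk on `ℤ^d`. -/
def lazyP (d : ℕ) : ℕ → V d → V d → ℝ
  | 0, x, y => if x = y then 1 else 0
  | (k + 1), x, y =>
      (1 / 2) * lazyP d k x y +
        (1 / (4 * d)) * ∑ i : Fin d, (lazyP d k (x + unitV d i) y + lazyP d k (x - unitV d i) y)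

/-- `φ` is a centered Gaussian field with covariance function `C`: every finite linear
combination is a centered Gaussian variable with the corresponding variance. -/
def IsCGF {Ω : Type*} [MeasurableSpace Ω] {d : ℕ} (P : Measure Ω)
    (φ : V d → Ω → ℝ) (C : V d → V d → ℝ) : Prop :=
  (∀ x, Measurable (φ x)) ∧
    ∀ (s : Finset (V d)) (a : V d → ℝ),
      Measure.map (fun ω => ∑ x ∈ s, a x * φ x ω) P =
        gaussianReal 0 (Real.toNNReal (∑ x ∈ s, ∑ y ∈ s, a x * a y * C x y))

/-- `φ` is a Gaussian free field on `ℤ^d`. -/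
def IsGFF {Ω : Type*} [MeasurableSpace Ω] {d : ℕ} (P : Measure Ω) (φ : V d → Ω → ℝ) : Prop :=
  IsCGF P φ (green d)

/-- The level set `{φ ≥ h}`. -/
def lvl {d : ℕ} {Ω : Type*} (φ : V d → Ω → ℝ) (h : ℝ) (ω : Ω) : Set (V d) := {x | h ≤ φ x ω}

/-- The whole field, as one random variable with values in `V d → ℝ`. -/
def proc {Ω : Type*} {d : ℕ} (φ : V d → Ω → ℝ) : Ω → V d → ℝ := fun ω x => φ x ω

/-- The critical parameter `h_*`. -/
def hStar (d : ℕ) {Ω : Type*} [MeasurableSpace Ω] (P : Measure Ω) (φ : V d → Ω → ℝ) : ℝ :=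
  sInf {h : ℝ | P {ω | ConnToInf (lvl φ h ω) {(0 : V d)}} = 0}

/-- The critical parameter `h_{**}`. -/
def hStarStar (d : ℕ) {Ω : Type*} [MeasurableSpace Ω] (P : Measure Ω) (φ : V d → Ω → ℝ) : ℝ :=
  sInf {h : ℝ |
    (⨅ R : ℕ, P {ω | ConnIn (lvl φ h ω) (box d ((R : ℝ) + 1)) (bdry d (2 * ((R : ℝ) + 1)))}) = 0}

/-- `u(R) = exp((log R)^{1/3})`. -/
def ufn (R : ℝ) : ℝ := Real.exp (Real.log R ^ ((1 : ℝ) / 3))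

def tildeSet (d : ℕ) {Ω : Type*} [MeasurableSpace Ω] (P : Measure Ω) (φ : V d → Ω → ℝ) :
    Set ℝ :=
  {h : ℝ |
    (⨅ R : ℕ, ENNReal.ofReal (((R : ℝ) + 1) ^ d) *
        P {ω | ¬ ConnIn (lvl φ h ω) (box d (ufn ((R : ℝ) + 1))) (bdry d ((R : ℝ) + 1))}) = 0}

/-- The critical parameter `h̃`. -/
def hTilde (d : ℕ) {Ω : Type*} [MeasurableSpace Ω] (P : Measure Ω) (φ : V d → Ω → ℝ) : ℝ :=
  sSup (tildeSet d P φ)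

/-- The event `Exist(R,α)`. -/
def ExistEv (d : ℕ) {Ω : Type*} (φ : V d → Ω → ℝ) (R : ℕ) (α : ℝ) : Set Ω :=
  {ω | ∃ x ∈ lvl φ α ω ∩ box d (R : ℝ),
    diamGE (comp (lvl φ α ω ∩ box d (R : ℝ)) x) ((R : ℝ) / 5)}

/-- The event `Unique(R,α)`. -/
def UniqueEv (d : ℕ) {Ω : Type*} (φ : V d → Ω → ℝ) (R : ℕ) (α : ℝ) : Set Ω :=
  {ω | ∀ x ∈ lvl φ α ω ∩ box d (R : ℝ), ∀ y ∈ lvl φ α ω ∩ box d (R : ℝ),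
    diamGE (comp (lvl φ α ω ∩ box d (R : ℝ)) x) ((R : ℝ) / 10) →
    diamGE (comp (lvl φ α ω ∩ box d (R : ℝ)) y) ((R : ℝ) / 10) →
    ConnIn (lvl φ α ω ∩ box d (2 * (R : ℝ))) {x} {y}}

/-- `φ` strongly percolates up to level `h`. -/
def StronglyPerc (d : ℕ) {Ω : Type*} [MeasurableSpace Ω] (P : Measure Ω)
    (φ : V d → Ω → ℝ) (h : ℝ) : Prop :=
  ∃ c : ℝ, 0 < c ∧ ∃ ρ : ℝ, ρ ∈ Set.Ioc (0 : ℝ) 1 ∧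
    ∀ α : ℝ, α ≤ h → ∀ R : ℕ, 1 ≤ R →
      ENNReal.ofReal (1 - Real.exp (-c * (R : ℝ) ^ ρ)) ≤ P (ExistEv d φ R α) ∧
      ENNReal.ofReal (1 - Real.exp (-c * (R : ℝ) ^ ρ)) ≤ P (UniqueEv d φ R α)

/-- The critical parameter `h̄`. -/
def hBar (d : ℕ) {Ω : Type*} [MeasurableSpace Ω] (P : Measure Ω) (φ : V d → Ω → ℝ) : ℝ :=
  sSup {h : ℝ | StronglyPerc d P φ h}


/-- The event `ℰ(N,α,β)` of (4.1), recentred at `x₀`: `B_N(x₀) ↔ ∂B_{6N}(x₀)` in `{φ ≥ α}`,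
and any two connected components of `{φ ≥ α} ∩ B_{4N}(x₀)` that each intersect both
`B_{2N}(x₀)` and `∂B_{4N}(x₀)` are joined in `{φ ≥ β} ∩ B_{4N}(x₀)`. -/
def EEvAt (d : ℕ) {Ω : Type*} (φ : V d → Ω → ℝ) (x₀ : V d) (N : ℕ) (α β : ℝ) : Set Ω :=
  {ω | ConnIn (lvl φ α ω) (boxAt x₀ (N : ℝ)) (bdryAt x₀ (6 * (N : ℝ))) ∧
    ∀ x ∈ lvl φ α ω ∩ boxAt x₀ (4 * (N : ℝ)), ∀ y ∈ lvl φ α ω ∩ boxAt x₀ (4 * (N : ℝ)),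
      (comp (lvl φ α ω ∩ boxAt x₀ (4 * (N : ℝ))) x ∩ boxAt x₀ (2 * (N : ℝ))).Nonempty →
      (comp (lvl φ α ω ∩ boxAt x₀ (4 * (N : ℝ))) x ∩ bdryAt x₀ (4 * (N : ℝ))).Nonempty →
      (comp (lvl φ α ω ∩ boxAt x₀ (4 * (N : ℝ))) y ∩ boxAt x₀ (2 * (N : ℝ))).Nonempty →
      (comp (lvl φ α ω ∩ boxAt x₀ (4 * (N : ℝ))) y ∩ bdryAt x₀ (4 * (N : ℝ))).Nonempty →
      ConnIn (lvl φ β ω ∩ boxAt x₀ (4 * (N : ℝ))) {x} {y}}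

/-- The event `ℰ(N,α,β)`, centered at the origin. -/
def EEv (d : ℕ) {Ω : Type*} (φ : V d → Ω → ℝ) (N : ℕ) (α β : ℝ) : Set Ω :=
  EEvAt d φ (0 : V d) N α β

/-! ### One-dimensional Brunn–Minkowski and Prékopa–Leindler -/

lemma bm_one (A B C : Set ℝ) (hA : MeasurableSet A) (hB : MeasurableSet B)
    (hAn : A.Nonempty) (hBn : B.Nonempty) (h : ∀ a ∈ A, ∀ b ∈ B, (a + b) / 2 ∈ C) :
    volume A + volume B ≤ 2 * volume C := by
  have key : ∀ K L : Set ℝ, IsCompact K → IsCompact L → K ⊆ A → L ⊆ B → K.Nonempty → L.Nonempty →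
      volume K + volume L ≤ 2 * volume C := by
    intro K L hK hL hKA hLB hKn hLn
    obtain ⟨k, hk, hkmax⟩ := hK.exists_isGreatest hKn
    obtain ⟨l, hl, hlmin⟩ := hL.exists_isLeast hLn
    set K' := (fun x => x + l) '' K with hK'
    set L' := (fun x => x + k) '' L with hL'
    have e1 : volume K' = volume K := by
      rw [hK', Set.image_add_right, measure_preimage_add_right]
    have e2 : volume L' = volume L := by
      rw [hL', Set.image_add_right, measure_preimage_add_right]
    have hcL : MeasurableSet L' :=
      (hL.image (by fun_prop : Continuous fun x : ℝ => x + k)).measurableSet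
    have hint : volume (K' ∩ L') = 0 := by
      refine measure_mono_null (t := {k + l}) ?_ (by simp)
      rintro x ⟨⟨a, ha, rfl⟩, ⟨b, hb, hb'⟩⟩
      have h1 := hkmax ha
      have h2 := hlmin hb
      simp only [mem_singleton_iff] at *
      linarith
    have hu : volume (K' ∪ L') = volume K + volume L := by
      have := measure_union_add_inter K' hcL (μ := volume)
      rw [hint, add_zero, e1, e2] at this
      exact this
    have hsub : K' ∪ L' ⊆ (fun x => (2 : ℝ) * x) '' C := by
      rintro x (⟨a, ha, rfl⟩ | ⟨b, hb, rfl⟩)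
      · exact ⟨(a + l) / 2, h a (hKA ha) l (hLB hl), by simp only; ring⟩
      · exact ⟨(k + b) / 2, h k (hKA hk) b (hLB hb), by simp only; ring⟩
    have h3 : volume ((fun x => (2 : ℝ) * x) '' C) = 2 * volume C := by
      have := Measure.addHaar_smul (volume : Measure ℝ) 2 C
      simpa [← Set.image_smul, abs_of_pos] using this
    rw [← hu, ← h3]
    exact measure_mono hsub
  rw [hA.measure_eq_iSup_isCompact, hB.measure_eq_iSup_isCompact]
  simp only [iSup_and']
  obtain ⟨a, ha⟩ := hAn
  obtain ⟨b, hb⟩ := hBn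
  have : Nonempty (Set ℝ) := ⟨∅⟩
  simp only [iSup_subtype']
  have : Nonempty {K : Set ℝ // K ⊆ A ∧ IsCompact K} := ⟨⟨∅, by simp, isCompact_empty⟩⟩
  have : Nonempty {K : Set ℝ // K ⊆ B ∧ IsCompact K} := ⟨⟨∅, by simp, isCompact_empty⟩⟩
  refine ENNReal.iSup_add_iSup_le fun K L => ?_
  calc volume K.1 + volume L.1 ≤ volume (insert a K.1) + volume (insert b L.1) :=
        add_le_add (measure_mono (subset_insert _ _)) (measure_mono (subset_insert _ _))
    _ ≤ _ := key _ _ (K.2.2.insert a) (L.2.2.insert b) (insert_subset ha K.2.1)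
        (insert_subset hb L.2.1) ⟨a, by simp⟩ ⟨b, by simp⟩

lemma pl_norm (f g h : ℝ → ℝ) (hf : Measurable f) (hg : Measurable g) (hh : Measurable h)
    (f0 : ∀ x, 0 ≤ f x) (g0 : ∀ x, 0 ≤ g x) (h0 : ∀ x, 0 ≤ h x)
    (f1 : ∀ x, f x ≤ 1) (g1 : ∀ x, g x ≤ 1) (fs : ∀ t < 1, ∃ x, t < f x)
    (gs : ∀ t < 1, ∃ x, t < g x) (H : ∀ x y, f x * g y ≤ h ((x + y) / 2) ^ 2) :
    (∫⁻ x, ENNReal.ofReal (f x)) + (∫⁻ x, ENNReal.ofReal (g x)) ≤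
      2 * ∫⁻ x, ENNReal.ofReal (h x) := by
  have lc : ∀ f : ℝ → ℝ, Measurable f → (∀ x, 0 ≤ f x) → (∀ x, f x ≤ 1) →
      (∫⁻ x, ENNReal.ofReal (f x)) = ∫⁻ t in Ioo (0:ℝ) 1, volume {a | t < f a} := by
    intro f hf f0 f1
    rw [lintegral_eq_lintegral_meas_lt _ (Eventually.of_forall f0) hf.aemeasurable]
    rw [← Ioo_union_Ici_eq_Ioi (zero_lt_one' ℝ), lintegral_union measurableSet_Ici
      (by rw [Set.disjoint_left]; intro x hx hx'; exact absurd hx.2 (not_lt.2 hx'))]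
    rw [setLIntegral_congr_fun (g := fun _ => 0) measurableSet_Ici, lintegral_zero, add_zero]
    intro t ht
    have : {a | t < f a} = ∅ := by
      ext a
      simp only [mem_ofPred_eq, mem_empty_iff_false, iff_false, not_lt]
      exact (f1 a).trans ht
    simp only [this, measure_empty]
  have lh : ∫⁻ t in Ioo (0:ℝ) 1, volume {a | t < h a} ≤ ∫⁻ x, ENNReal.ofReal (h x) := by
    rw [lintegral_eq_lintegral_meas_lt _ (Eventually.of_forall h0) hh.aemeasurable]
    exact lintegral_mono_set (fun x hx => hx.1)
  have hmeas : ∀ f : ℝ → ℝ, Measurable fun t : ℝ => (volume {a | t < f a} : ENNReal) := by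
    intro f
    refine Antitone.measurable fun s t hst => measure_mono ?_
    intro a ha
    exact lt_of_le_of_lt hst ha
  rw [lc f hf f0 f1, lc g hg g0 g1, ← lintegral_add_left (hmeas f)]
  refine le_trans ?_ (mul_le_mul_right lh 2)
  rw [← lintegral_const_mul _ (hmeas h)]
  refine setLIntegral_mono' measurableSet_Ioo fun t ht => ?_
  refine bm_one _ _ _ (measurableSet_lt measurable_const hf) (measurableSet_lt measurable_const hg)
    (fs t ht.2) (gs t ht.2) ?_
  intro a ha b hb
  simp only [mem_ofPred_eq] at *
  have h2 := H a b
  have : t * t < h ((a + b) / 2) ^ 2 :=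
    lt_of_lt_of_le (mul_lt_mul'' ha hb ht.1.le ht.1.le) h2
  rw [← sq] at this
  exact lt_of_pow_lt_pow_left₀ 2 (h0 _) this

lemma amgm_ennreal (a b c : ENNReal) (h : a + b ≤ 2 * c) : a * b ≤ c ^ 2 := by
  rcases eq_or_ne c ⊤ with rfl | hc
  · simp
  have hab : a + b ≠ ⊤ := ne_top_of_le_ne_top (ENNReal.mul_ne_top (by simp) hc) h
  have ha : a ≠ ⊤ := fun h => hab (by simp [h])
  have hb : b ≠ ⊤ := fun h => hab (by simp [h])
  lift a to NNReal using ha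
  lift b to NNReal using hb
  lift c to NNReal using hc
  norm_cast at *
  have h' : (a:ℝ) + b ≤ 2 * c := by exact_mod_cast h
  have : (a:ℝ) * b ≤ c ^ 2 := by
    nlinarith [sq_nonneg ((a:ℝ) - b), a.2, b.2, c.2, a.coe_nonneg, b.coe_nonneg]
  exact_mod_cast this

lemma pl_one (f g h : ℝ → ℝ) (hf : Measurable f) (hg : Measurable g) (hh : Measurable h)
    (f0 : ∀ x, 0 ≤ f x) (g0 : ∀ x, 0 ≤ g x) (h0 : ∀ x, 0 ≤ h x)
    (f1 : ∀ x, f x ≤ 1) (g1 : ∀ x, g x ≤ 1) (H : ∀ x y, f x * g y ≤ h ((x + y) / 2) ^ 2) :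
    (∫⁻ x, ENNReal.ofReal (f x)) * (∫⁻ x, ENNReal.ofReal (g x)) ≤
      (∫⁻ x, ENNReal.ofReal (h x)) ^ 2 := by
  have bf : BddAbove (range f) := ⟨1, by rintro _ ⟨x, rfl⟩; exact f1 x⟩
  have bg : BddAbove (range g) := ⟨1, by rintro _ ⟨x, rfl⟩; exact g1 x⟩
  set S := ⨆ x, f x with hS
  set T := ⨆ x, g x with hT
  have fS : ∀ x, f x ≤ S := fun x => le_ciSup bf x
  have gT : ∀ x, g x ≤ T := fun x => le_ciSup bg x
  rcases ((f0 0).trans (fS 0)).eq_or_lt with hS0 | hS0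
  · have : ∀ x, f x = 0 := fun x => le_antisymm ((fS x).trans hS0.ge) (f0 x)
    simp [this]
  rcases ((g0 0).trans (gT 0)).eq_or_lt with hT0 | hT0
  · have : ∀ x, g x = 0 := fun x => le_antisymm ((gT x).trans hT0.ge) (g0 x)
    simp [this]
  set q := Real.sqrt (S * T) with hq
  have hST : 0 < S * T := mul_pos hS0 hT0
  have q0 : 0 < q := Real.sqrt_pos.2 hST
  have q2 : q ^ 2 = S * T := Real.sq_sqrt hST.le
  have sup_ex : ∀ (f : ℝ → ℝ) (S : ℝ), S = ⨆ x, f x → 0 < S → ∀ t < 1, ∃ x, t < f x / S := by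
    intro f S hS hS0 t ht
    have : t * S < ⨆ x, f x := by rw [← hS]; nlinarith
    obtain ⟨x, hx⟩ := exists_lt_of_lt_ciSup this
    exact ⟨x, by rw [lt_div_iff₀ hS0]; exact hx⟩
  have := pl_norm (fun x => f x / S) (fun x => g x / T) (fun x => h x / q)
    (hf.div_const _) (hg.div_const _) (hh.div_const _)
    (fun x => div_nonneg (f0 x) hS0.le) (fun x => div_nonneg (g0 x) hT0.le)
    (fun x => div_nonneg (h0 x) q0.le) (fun x => (div_le_one hS0).2 (fS x))
    (fun x => (div_le_one hT0).2 (gT x)) (sup_ex f S hS hS0) (sup_ex g T hT hT0) (by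
      intro x y
      rw [div_pow, q2, div_mul_div_comm]
      gcongr
      exact H x y)
  have h2 := amgm_ennreal _ _ _ this
  have sc : ∀ (f : ℝ → ℝ) (S : ℝ), Measurable f → 0 < S → (∫⁻ x, ENNReal.ofReal (f x)) =
      ENNReal.ofReal S * ∫⁻ x, ENNReal.ofReal (f x / S) := by
    intro f S hf hS
    rw [← lintegral_const_mul _ (by fun_prop)]
    congr 1
    ext x
    rw [← ENNReal.ofReal_mul hS.le, mul_div_cancel₀ _ hS.ne']
  rw [sc f S hf hS0, sc g T hg hT0, sc h q hh q0, mul_pow, ← ENNReal.ofReal_pow q0.le, q2,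
    ENNReal.ofReal_mul hS0.le]
  calc _ = ENNReal.ofReal S * ENNReal.ofReal T * ((∫⁻ x, ENNReal.ofReal (f x / S)) *
      ∫⁻ x, ENNReal.ofReal (g x / T)) := by ring
    _ ≤ _ := by gcongr

/-- Property (τ) of the one-dimensional Gaussian measure. -/
lemma tau_one (f g : ℝ → ENNReal) (hf : Measurable f) (hg : Measurable g)
    (f1 : ∀ x, f x ≤ 1) (g1 : ∀ x, g x ≤ 1) (k : ℝ) (hk : 0 ≤ k)
    (H : ∀ x y, f x * g y * ENNReal.ofReal (Real.exp (-(x - y) ^ 2 / 4)) ≤ ENNReal.ofReal k) :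
    (∫⁻ x, f x ∂gaussianReal 0 1) * (∫⁻ x, g x ∂gaussianReal 0 1) ≤ ENNReal.ofReal k := by
  set γ := gaussianPDFReal 0 1 with hγ
  have hγm : Measurable γ := measurable_gaussianPDFReal 0 1
  have γ0 : ∀ x, 0 ≤ γ x := fun x => gaussianPDFReal_nonneg 0 1 x
  have hγe : ∀ x, γ x = (Real.sqrt (2 * Real.pi))⁻¹ * Real.exp (-x ^ 2 / 2) := by
    intro x; simp [hγ, gaussianPDFReal]
  have γ1 : ∀ x, γ x ≤ 1 := by
    intro x
    rw [hγe]
    have : (1:ℝ) ≤ Real.sqrt (2 * Real.pi) := by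
      rw [Real.one_le_sqrt]; nlinarith [Real.pi_gt_three]
    have e1 : Real.exp (-x ^ 2 / 2) ≤ 1 := Real.exp_le_one_iff.2 (by nlinarith [sq_nonneg x])
    exact mul_le_one₀ (inv_le_one_of_one_le₀ this) (Real.exp_nonneg _) e1
  have conv : ∀ f : ℝ → ENNReal, Measurable f → (∀ x, f x ≤ 1) → (∫⁻ x, f x ∂gaussianReal 0 1) =
      ∫⁻ x, ENNReal.ofReal ((f x).toReal * γ x) := by
    intro f hf f1
    rw [gaussianReal_of_var_ne_zero _ one_ne_zero,
      lintegral_withDensity_eq_lintegral_mul _ (measurable_gaussianPDF 0 1) hf]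
    congr 1
    ext x
    have : f x ≠ ⊤ := ne_top_of_le_ne_top (by simp) (f1 x)
    rw [ENNReal.ofReal_mul ENNReal.toReal_nonneg, ENNReal.ofReal_toReal this, Pi.mul_apply,
      mul_comm]
    rfl
  have t1 : ∀ f : ℝ → ENNReal, (∀ x, f x ≤ 1) → ∀ x, (f x).toReal ≤ 1 := fun f f1 x =>
    ENNReal.toReal_mono (by simp) (f1 x) |>.trans (by simp)
  rw [conv f hf f1, conv g hg g1]
  have := pl_one (fun x => (f x).toReal * γ x) (fun x => (g x).toReal * γ x)
    (fun x => Real.sqrt k * γ x) (by fun_prop) (by fun_prop) (by fun_prop)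
    (fun x => mul_nonneg ENNReal.toReal_nonneg (γ0 x))
    (fun x => mul_nonneg ENNReal.toReal_nonneg (γ0 x))
    (fun x => mul_nonneg (Real.sqrt_nonneg _) (γ0 x))
    (fun x => mul_le_one₀ (t1 f f1 x) (γ0 x) (γ1 x))
    (fun x => mul_le_one₀ (t1 g g1 x) (γ0 x) (γ1 x)) (by
      intro x y
      have h1 : (f x).toReal * (g y).toReal * Real.exp (-(x - y) ^ 2 / 4) ≤ k := by
        have := ENNReal.toReal_mono (by simp) (H x y)
        rwa [ENNReal.toReal_mul, ENNReal.toReal_mul, ENNReal.toReal_ofReal (Real.exp_nonneg _),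
          ENNReal.toReal_ofReal hk] at this
      have h2 : γ x * γ y = Real.exp (-(x - y) ^ 2 / 4) * γ ((x + y) / 2) ^ 2 := by
        rw [hγe, hγe, hγe, mul_pow, ← Real.exp_nat_mul]
        have : Real.exp (-x ^ 2 / 2) * Real.exp (-y ^ 2 / 2) = Real.exp (-(x - y) ^ 2 / 4) *
          Real.exp ((2:ℕ) * (-((x + y) / 2) ^ 2 / 2)) := by
          rw [← Real.exp_add, ← Real.exp_add]; congr 1; push_cast; ring
        linear_combination ((Real.sqrt (2 * Real.pi))⁻¹ ^ 2) * this
      rw [mul_pow, Real.sq_sqrt hk]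
      calc (f x).toReal * γ x * ((g y).toReal * γ y)
          = (f x).toReal * (g y).toReal * (γ x * γ y) := by ring
        _ = ((f x).toReal * (g y).toReal * Real.exp (-(x - y) ^ 2 / 4)) * γ ((x + y) / 2) ^ 2 := by
            rw [h2]; ring
        _ ≤ k * γ ((x + y) / 2) ^ 2 := by gcongr)
  refine this.trans (le_of_eq ?_)
  have hi : ∫⁻ x, ENNReal.ofReal (Real.sqrt k * γ x) = ENNReal.ofReal (Real.sqrt k) := by
    simp_rw [ENNReal.ofReal_mul (Real.sqrt_nonneg k)]
    rw [lintegral_const_mul _ (by fun_prop)]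
    rw [lintegral_gaussianPDFReal_eq_one 0 one_ne_zero, mul_one]
  rw [hi, ← ENNReal.ofReal_pow (Real.sqrt_nonneg k), Real.sq_sqrt hk]

/-- Standard Gaussian measure on `ι → ℝ`. -/
def stdG (ι : Type*) [Fintype ι] : Measure (ι → ℝ) := Measure.pi fun _ => gaussianReal 0 1

instance (ι : Type*) [Fintype ι] : IsProbabilityMeasure (stdG ι) := by
  unfold stdG; infer_instance

lemma iso_gauss {ι : Type*} [Fintype ι] (A : Set (ι → ℝ)) (hA : MeasurableSet A) (r : ℝ) :
    stdG ι A * stdG ι {x | ∀ a ∈ A, r ≤ ∑ i, (a i - x i) ^ 2} ≤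
      ENNReal.ofReal (Real.exp (-r / 4)) := by
  classical
  set B := {x : ι → ℝ | ∀ a ∈ A, r ≤ ∑ i, (a i - x i) ^ 2} with hBdef
  have hB : MeasurableSet B := by
    have : B = ⋂ a ∈ A, {x | r ≤ ∑ i, (a i - x i) ^ 2} := by ext; simp [hBdef]
    rw [this]
    exact (isClosed_biInter fun a _ => isClosed_le continuous_const (by fun_prop)).measurableSet
  set f : (ι → ℝ) → ENNReal := A.indicator 1 with hf
  set g : (ι → ℝ) → ENNReal := B.indicator 1 with hg
  have fm : Measurable f := measurable_one.indicator hA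
  have gm : Measurable g := measurable_one.indicator hB
  have ind1 : ∀ (A : Set (ι → ℝ)) x, A.indicator (1 : (ι → ℝ) → ENNReal) x ≤ 1 := fun A x =>
    Set.indicator_apply_le' (fun _ => le_rfl) (fun _ => zero_le)
  let μ : ι → Measure ℝ := fun _ => gaussianReal 0 1
  have m1 : ∀ (f : (ι → ℝ) → ENNReal) (s : Finset ι), (∀ x, f x ≤ 1) → ∀ x, lmarginal μ s f x ≤ 1 := by
    intro f s f1 x
    refine (lmarginal_mono (g := fun _ => 1) f1 x).trans ?_
    simp [lmarginal]
  have key : ∀ s : Finset ι, ∀ x y, lmarginal μ s f x * lmarginal μ s g y *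
      ENNReal.ofReal (Real.exp (-(∑ i ∈ sᶜ, (x i - y i) ^ 2) / 4)) ≤
        ENNReal.ofReal (Real.exp (-r / 4)) := by
    intro s
    induction s using Finset.induction_on with
    | empty =>
      intro x y
      simp only [lmarginal_empty, Finset.compl_empty]
      by_cases hx : x ∈ A
      · by_cases hy : y ∈ B
        · simp only [hf, hg, hx, hy, indicator_of_mem, Pi.one_apply, one_mul]
          apply ENNReal.ofReal_le_ofReal
          apply Real.exp_le_exp.2
          have := hy x hx
          linarith
        · simp [hg, hy]
      · simp [hf, hx]
    | insert i s hi ih =>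
      intro x y
      rw [lmarginal_insert _ fm hi, lmarginal_insert _ gm hi]
      set c := Real.exp (-(∑ j ∈ (insert i s)ᶜ, (x j - y j) ^ 2) / 4) with hc
      have c0 : 0 < c := Real.exp_pos _
      have hsum : ∀ a b : ℝ, ∑ j ∈ sᶜ, (Function.update x i a j - Function.update y i b j) ^ 2 =
          (a - b) ^ 2 + ∑ j ∈ (insert i s)ᶜ, (x j - y j) ^ 2 := by
        intro a b
        have : sᶜ = insert i (insert i s)ᶜ := by
          ext j; by_cases h : j = i
          · subst h; simp [hi]
          · simp [h]
        rw [this, Finset.sum_insert (by simp)]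
        congr 1
        · simp
        · refine Finset.sum_congr rfl fun j hj => ?_
          have : j ≠ i := by rintro rfl; simp at hj
          simp [this]
      have := tau_one (fun t => lmarginal μ s f (Function.update x i t))
        (fun t => lmarginal μ s g (Function.update y i t))
        ((fm.lmarginal μ).comp (measurable_update x)) ((gm.lmarginal μ).comp (measurable_update y))
        (fun t => m1 f s (ind1 A) _) (fun t => m1 g s (ind1 B) _) (Real.exp (-r / 4) / c)
        (by positivity) (by
          intro a b
          have h1 := ih (Function.update x i a) (Function.update y i b)
          rw [hsum, show -((a - b) ^ 2 + ∑ j ∈ (insert i s)ᶜ, (x j - y j) ^ 2) / 4 =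
            -(a - b) ^ 2 / 4 + -(∑ j ∈ (insert i s)ᶜ, (x j - y j) ^ 2) / 4 by ring, Real.exp_add,
            ← hc, ENNReal.ofReal_mul (Real.exp_nonneg _), ← mul_assoc] at h1
          rw [ENNReal.ofReal_div_of_pos c0]
          rwa [ENNReal.le_div_iff_mul_le (Or.inl (by simpa using c0)) (Or.inl (by simp))])
      rw [ENNReal.ofReal_div_of_pos c0,
        ENNReal.le_div_iff_mul_le (Or.inl (by simpa using c0)) (Or.inl (by simp))] at this
      exact this
  have := key Finset.univ 0 0
  simp only [Finset.compl_univ, Finset.sum_empty, neg_zero, zero_div, Real.exp_zero,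
    ENNReal.ofReal_one, mul_one] at this
  rw [lmarginal_univ, lmarginal_univ, hf, hg, lintegral_indicator_one hA,
    lintegral_indicator_one hB] at this
  exact this

/-! ### Simple random walk estimates -/

lemma srwP_nonneg (d n : ℕ) (x y : V d) : 0 ≤ srwP d n x y := by
  induction n generalizing x with
  | zero => simp only [srwP]; split_ifs <;> norm_num
  | succ n ih =>
    simp only [srwP]
    exact mul_nonneg (by positivity) (Finset.sum_nonneg fun i _ => add_nonneg (ih _) (ih _))

lemma srwP_transl (d n : ℕ) (x y z : V d) : srwP d n (x + z) (y + z) = srwP d n x y := by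
  induction n generalizing x with
  | zero => simp [srwP]
  | succ n ih =>
    simp only [srwP]
    congr 1
    refine Finset.sum_congr rfl fun i _ => ?_
    rw [← ih (x + unitV d i), ← ih (x - unitV d i)]
    congr 2 <;> abel

lemma srwP_neg (d n : ℕ) (x y : V d) : srwP d n (-x) (-y) = srwP d n x y := by
  induction n generalizing x with
  | zero => simp [srwP]
  | succ n ih =>
    simp only [srwP]
    congr 1
    refine Finset.sum_congr rfl fun i _ => ?_
    rw [← ih (x + unitV d i), ← ih (x - unitV d i), add_comm]
    congr 2 <;> abel

lemma srwP_symm (d n : ℕ) (x y : V d) : srwP d n x y = srwP d n y x := by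
  rw [← srwP_neg, ← srwP_transl d n (-x) (-y) (x + y)]
  congr 1 <;> abel

/-- Signed permutation of coordinates. -/
def sperm {d : ℕ} (σ : Equiv.Perm (Fin d)) (s : Fin d → ℤ) (x : V d) : V d :=
  fun i => s i * x (σ i)

lemma srwP_sperm (d n : ℕ) (σ : Equiv.Perm (Fin d)) (s : Fin d → ℤ) (hs : ∀ i, s i = 1 ∨ s i = -1)
    (x y : V d) : srwP d n (sperm σ s x) (sperm σ s y) = srwP d n x y := by
  have hinj : ∀ x y : V d, sperm σ s x = sperm σ s y ↔ x = y := by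
    intro x y
    refine ⟨fun h => ?_, fun h => by rw [h]⟩
    ext i
    have := congrFun h (σ.symm i)
    simp only [sperm, Equiv.apply_symm_apply] at this
    rcases hs (σ.symm i) with h | h <;> rw [h] at this <;> linarith
  induction n generalizing x with
  | zero => simp [srwP, hinj]
  | succ n ih =>
    simp only [srwP]
    congr 1
    refine Eq.trans ?_ (Equiv.sum_comp σ fun i =>
      (srwP d n (x + unitV d i) y + srwP d n (x - unitV d i) y))
    refine Finset.sum_congr rfl fun i _ => ?_
    rw [← ih (x + unitV d (σ i)), ← ih (x - unitV d (σ i))]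
    have e : ∀ j, unitV d (σ i) (σ j) = unitV d i j := by
      intro j; simp [unitV]
    rcases hs i with h | h
    · have e1 : sperm σ s (x + unitV d (σ i)) = sperm σ s x + unitV d i := by
        ext j
        simp only [sperm, Pi.add_apply, e]
        by_cases hj : j = i
        · subst hj; simp [unitV, h, mul_add]
        · simp [unitV, hj]
      have e2 : sperm σ s (x - unitV d (σ i)) = sperm σ s x - unitV d i := by
        ext j
        simp only [sperm, Pi.sub_apply, e]
        by_cases hj : j = i
        · subst hj; simp [unitV, h, mul_sub]
        · simp [unitV, hj]
      rw [e1, e2]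
    · have e1 : sperm σ s (x + unitV d (σ i)) = sperm σ s x - unitV d i := by
        ext j
        simp only [sperm, Pi.add_apply, Pi.sub_apply, e]
        by_cases hj : j = i
        · subst hj; simp [unitV, h, mul_add, sub_eq_add_neg]
        · simp [unitV, hj]
      have e2 : sperm σ s (x - unitV d (σ i)) = sperm σ s x + unitV d i := by
        ext j
        simp only [sperm, Pi.add_apply, Pi.sub_apply, e]
        by_cases hj : j = i
        · subst hj; simp [unitV, h, mul_sub]
        · simp [unitV, hj]
      rw [e1, e2, add_comm]

lemma srwP_supp (d n : ℕ) (x y : V d) (h : srwP d n x y ≠ 0) (i : Fin d) : |x i - y i| ≤ n := by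
  induction n generalizing x with
  | zero =>
    simp only [srwP] at h
    have : x = y := by by_contra h'; simp [h'] at h
    simp [this]
  | succ n ih =>
    simp only [srwP] at h
    have h1 := right_ne_zero_of_mul h
    obtain ⟨j, _, hj⟩ := Finset.exists_ne_zero_of_sum_ne_zero h1
    have hu : |unitV d j i| ≤ 1 := by simp only [unitV]; split_ifs <;> simp
    rw [abs_le] at hu ⊢
    have : srwP d n (x + unitV d j) y ≠ 0 ∨ srwP d n (x - unitV d j) y ≠ 0 := by
      by_contra hc; push Not at hc; rw [hc.1, hc.2] at hj; simp at hj
    rcases this with h2 | h2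
    · have := abs_le.1 (ih _ h2); simp only [Pi.add_apply] at this; push_cast; constructor <;> omega
    · have := abs_le.1 (ih _ h2); simp only [Pi.sub_apply] at this; push_cast; constructor <;> omega

lemma srwP_CK (d m n : ℕ) (x y : V d) (s : Finset (V d))
    (hs : ∀ z, (∀ i, |x i - z i| ≤ m) → z ∈ s) :
    ∑ z ∈ s, srwP d m x z * srwP d n z y = srwP d (m + n) x y := by
  induction m generalizing x with
  | zero =>
    have hx : x ∈ s := hs x (by simp)
    simp only [srwP, zero_add]
    simp [hx]
  | succ m ih =>
    rw [show m + 1 + n = (m + n) + 1 by ring]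
    simp only [srwP]
    simp_rw [mul_assoc]
    rw [← Finset.mul_sum]
    congr 1
    simp_rw [Finset.sum_mul]
    rw [Finset.sum_comm]
    refine Finset.sum_congr rfl fun j _ => ?_
    have hu : ∀ i, |unitV d j i| ≤ 1 := by intro i; simp only [unitV]; split_ifs <;> simp
    rw [← ih (x + unitV d j), ← ih (x - unitV d j), ← Finset.sum_add_distrib]
    · refine Finset.sum_congr rfl fun z _ => by ring
    · intro z hz
      refine hs z fun i => ?_
      have h1 := abs_le.1 (hz i); have h2 := abs_le.1 (hu i)
      simp only [Pi.sub_apply] at h1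
      rw [abs_le]; push_cast; constructor <;> omega
    · intro z hz
      refine hs z fun i => ?_
      have h1 := abs_le.1 (hz i); have h2 := abs_le.1 (hu i)
      simp only [Pi.add_apply] at h1
      rw [abs_le]; push_cast; constructor <;> omega

lemma srwP_chern (d n : ℕ) (x y : V d) (i : Fin d) (s : ℝ) :
    srwP d n x y ≤ Real.exp (s * ((x i : ℝ) - y i) + n * (s ^ 2 / 2)) := by
  induction n generalizing x with
  | zero =>
    simp only [srwP]
    split_ifs with h
    · simp [h]
    · positivity
  | succ n ih =>
    simp only [srwP]
    have hd : 0 < d := i.pos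
    set E := Real.exp (s * ((x i : ℝ) - y i) + n * (s ^ 2 / 2)) with hE
    have hb : ∀ j, srwP d n (x + unitV d j) y + srwP d n (x - unitV d j) y ≤
        E * (2 * Real.cosh (if i = j then s else 0)) := by
      intro j
      refine (add_le_add (ih _) (ih _)).trans (le_of_eq ?_)
      rw [Real.cosh_eq, hE, mul_div_cancel₀ _ two_ne_zero, mul_add, ← Real.exp_add, ← Real.exp_add]
      congr 2
      · simp only [Pi.add_apply, unitV]; split_ifs <;> push_cast <;> ring
      · simp only [Pi.sub_apply, unitV]; split_ifs <;> push_cast <;> ring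
    have hc : ∀ j, E * (2 * Real.cosh (if i = j then s else 0)) ≤ E * (2 * Real.exp (s ^ 2 / 2)) := by
      intro j
      have : Real.cosh (if i = j then s else 0) ≤ Real.exp (s ^ 2 / 2) := by
        split_ifs
        · exact Real.cosh_le_exp_half_sq s
        · rw [Real.cosh_zero]; exact Real.one_le_exp (by positivity)
      gcongr
    have := Finset.sum_le_sum fun j (_ : j ∈ Finset.univ) => (hb j).trans (hc j)
    rw [Finset.sum_const, Finset.card_univ, Fintype.card_fin, nsmul_eq_mul] at this
    have hd' : (0:ℝ) < d := by exact_mod_cast hd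
    calc _ ≤ 1 / (2 * (d:ℝ)) * (d * (E * (2 * Real.exp (s ^ 2 / 2)))) := by gcongr
      _ = E * Real.exp (s ^ 2 / 2) := by field_simp
      _ = _ := by rw [hE, ← Real.exp_add]; congr 1; push_cast; ring

lemma srwP_gauss (d n : ℕ) (x y : V d) (i : Fin d) (hn : 1 ≤ n) :
    srwP d n x y ≤ Real.exp (-((x i : ℝ) - y i) ^ 2 / (2 * n)) := by
  refine (srwP_chern d n x y i (-((x i : ℝ) - y i) / n)).trans (le_of_eq ?_)
  have : (n:ℝ) ≠ 0 := by positivity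
  congr 1
  field_simp
  ring

/-! Fourier representation -/

/-- Uniform measure on the unit cube. -/
def cubeM (d : ℕ) : Measure (Fin d → ℝ) := Measure.pi fun _ => volume.restrict (Icc (0:ℝ) 1)

instance (d : ℕ) : IsProbabilityMeasure (cubeM d) := by
  have : IsProbabilityMeasure (volume.restrict (Icc (0:ℝ) 1)) := ⟨by simp⟩
  unfold cubeM; infer_instance

def qf (d : ℕ) (t : Fin d → ℝ) : ℝ := (1 / d) * ∑ i, Real.cos (2 * Real.pi * t i)

lemma qf_abs (d : ℕ) (t : Fin d → ℝ) : |qf d t| ≤ 1 := by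
  unfold qf
  rcases Nat.eq_zero_or_pos d with rfl | hd
  · simp
  have hd' : (0:ℝ) < d := by exact_mod_cast hd
  rw [abs_mul, abs_of_pos (by positivity : (0:ℝ) < 1 / d)]
  have : |∑ i, Real.cos (2 * Real.pi * t i)| ≤ d := by
    refine (Finset.abs_sum_le_sum_abs _ _).trans ?_
    refine (Finset.sum_le_sum fun i _ => Real.abs_cos_le_one _).trans ?_
    simp
  rw [one_div, inv_mul_le_iff₀ hd']; simpa using this

lemma qf_cont (d : ℕ) : Continuous (qf d) := by unfold qf; fun_prop

lemma int_exp_unit (n : ℤ) : ∫ t in Icc (0:ℝ) 1, Complex.exp (2 * Real.pi * Complex.I * n * t) =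
    if n = 0 then 1 else 0 := by
  rw [integral_Icc_eq_integral_Ioc, ← intervalIntegral.integral_of_le zero_le_one]
  split_ifs with h
  · simp [h]
  · rw [integral_exp_mul_complex (by
      have : (n:ℂ) ≠ 0 := by exact_mod_cast h
      simp [this, Real.pi_ne_zero])]
    simp only [Complex.ofReal_one, mul_one, Complex.ofReal_zero, mul_zero, Complex.exp_zero]
    rw [show 2 * (Real.pi:ℂ) * Complex.I * n = n * (2 * Real.pi * Complex.I) by ring,
      Complex.exp_int_mul_two_pi_mul_I]
    simp

lemma fourier_zero (d : ℕ) (x : V d) : ∫ t, Real.cos (2 * Real.pi * ∑ i, t i * x i) ∂cubeM d =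
    if x = 0 then 1 else 0 := by
  have h1 : ∫ t, Complex.exp (2 * Real.pi * (∑ i, t i * x i : ℝ) * Complex.I) ∂cubeM d =
      if x = 0 then 1 else 0 := by
    have := integral_fintype_prod_eq_prod (𝕜 := ℂ) (ι := Fin d) (E := fun _ => ℝ)
      (μ := fun _ => volume.restrict (Icc (0:ℝ) 1))
      (fun i t => Complex.exp (2 * Real.pi * Complex.I * (x i) * t))
    simp_rw [int_exp_unit] at this
    rw [cubeM]
    trans (∏ i, if x i = 0 then (1:ℂ) else 0)
    · rw [← this]
      congr 1
      ext t
      rw [← Complex.exp_sum]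
      congr 1
      push_cast
      rw [Finset.mul_sum, Finset.sum_mul]
      refine Finset.sum_congr rfl fun i _ => by ring
    · split_ifs with h
      · simp [h]
      · obtain ⟨i, hi⟩ := Function.ne_iff.1 h
        exact Finset.prod_eq_zero (Finset.mem_univ i) (by simpa using hi)
  have h2 := congrArg Complex.re h1
  have hint : Integrable (fun t : Fin d → ℝ =>
      Complex.exp (2 * Real.pi * (∑ i, t i * x i : ℝ) * Complex.I)) (cubeM d) := by
    refine Integrable.of_bound (C := 1) ?_ (Eventually.of_forall fun t => ?_)
    · exact Continuous.aestronglyMeasurable (by fun_prop)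
    · have := Complex.norm_exp_ofReal_mul_I (2 * Real.pi * ∑ i, t i * x i)
      push_cast at this ⊢
      exact this.le
  have h3 := integral_re hint
  simp only [RCLike.re_to_complex] at h3
  rw [← h3] at h2
  have e : ∀ t : Fin d → ℝ, (Complex.exp (2 * Real.pi * (∑ i, t i * x i : ℝ) * Complex.I)).re =
      Real.cos (2 * Real.pi * ∑ i, t i * x i) := by
    intro t
    have := Complex.exp_ofReal_mul_I_re (2 * Real.pi * ∑ i, t i * x i)
    rw [← this]; push_cast; rfl
  simp_rw [e] at h2
  rw [h2]
  split_ifs <;> simp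

lemma fourier_rep (d n : ℕ) (x y : V d) : srwP d n x y =
    ∫ t, qf d t ^ n * Real.cos (2 * Real.pi * ∑ i, t i * ((x - y) i : ℤ)) ∂cubeM d := by
  induction n generalizing x with
  | zero =>
    simp only [srwP, pow_zero, one_mul]
    rw [fourier_zero]
    simp [sub_eq_zero]
  | succ n ih =>
    have hint : ∀ x : V d, Integrable (fun t => qf d t ^ n *
        Real.cos (2 * Real.pi * ∑ i, t i * ((x - y) i : ℤ))) (cubeM d) := by
      intro x
      refine Integrable.of_bound (C := 1) ?_ (Eventually.of_forall fun t => ?_)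
      · have := qf_cont d
        exact Continuous.aestronglyMeasurable (by fun_prop)
      · rw [Real.norm_eq_abs, abs_mul, abs_pow]
        exact mul_le_one₀ (pow_le_one₀ (abs_nonneg _) (qf_abs d t)) (abs_nonneg _)
          (Real.abs_cos_le_one _)
    simp only [srwP]
    simp_rw [ih]
    simp_rw [← integral_add (hint _) (hint _)]
    have hint2 : ∀ j ∈ (Finset.univ : Finset (Fin d)), Integrable (fun t =>
        qf d t ^ n * Real.cos (2 * Real.pi * ∑ i, t i * ((x + unitV d j - y) i : ℤ)) +
        qf d t ^ n * Real.cos (2 * Real.pi * ∑ i, t i * ((x - unitV d j - y) i : ℤ))) (cubeM d) :=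
      fun j _ => (hint _).add (hint _)
    rw [← integral_finsetSum _ hint2, ← integral_const_mul]
    congr 1
    ext t
    have : ∀ j, qf d t ^ n * Real.cos (2 * Real.pi * ∑ i, t i * ((x + unitV d j - y) i : ℤ)) +
        qf d t ^ n * Real.cos (2 * Real.pi * ∑ i, t i * ((x - unitV d j - y) i : ℤ)) =
        2 * (qf d t ^ n * Real.cos (2 * Real.pi * ∑ i, t i * ((x - y) i : ℤ))) *
          Real.cos (2 * Real.pi * t j) := by
      intro j
      have e1 : ∑ i, t i * ((x + unitV d j - y) i : ℤ) = ∑ i, t i * ((x - y) i : ℤ) + t j := by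
        have : t j = ∑ i, t i * ((unitV d j i : ℤ) : ℝ) := by simp [unitV]
        rw [this, ← Finset.sum_add_distrib]
        refine Finset.sum_congr rfl fun i _ => ?_
        simp only [Pi.sub_apply, Pi.add_apply]; push_cast; ring
      have e2 : ∑ i, t i * ((x - unitV d j - y) i : ℤ) = ∑ i, t i * ((x - y) i : ℤ) - t j := by
        have : t j = ∑ i, t i * ((unitV d j i : ℤ) : ℝ) := by simp [unitV]
        rw [this, ← Finset.sum_sub_distrib]
        refine Finset.sum_congr rfl fun i _ => ?_
        simp only [Pi.sub_apply]; push_cast; ring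
      rw [e1, e2, mul_add, mul_sub, Real.cos_add, Real.cos_sub]; ring
    simp_rw [this]
    rw [← Finset.mul_sum, pow_succ, qf]
    rcases Nat.eq_zero_or_pos d with rfl | hd
    · simp
    have : (d:ℝ) ≠ 0 := by positivity
    field_simp

lemma one_dim_int (c : ℝ) (hc : 0 < c) :
    ∫ t in Icc (0:ℝ) 1, Real.exp (-(c * (1 - |Real.cos (2 * Real.pi * t)|))) ≤
      3 * Real.sqrt (Real.pi / (8 * c)) := by
  have hg : ∀ j : ℝ, Integrable fun t : ℝ => Real.exp (-(8 * c) * (t - j) ^ 2) := fun j =>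
    (integrable_exp_neg_mul_sq (by positivity : 0 < 8 * c)).comp_sub_right j
  have hgi : ∀ j : ℝ, ∫ t : ℝ, Real.exp (-(8 * c) * (t - j) ^ 2) = Real.sqrt (Real.pi / (8 * c)) := by
    intro j
    rw [integral_sub_right_eq_self (fun t => Real.exp (-(8 * c) * t ^ 2)) j]
    exact integral_gaussian _
  have hpt : ∀ t ∈ Icc (0:ℝ) 1, Real.exp (-(c * (1 - |Real.cos (2 * Real.pi * t)|))) ≤
      Real.exp (-(8 * c) * (t - 0) ^ 2) + Real.exp (-(8 * c) * (t - 1 / 2) ^ 2) +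
        Real.exp (-(8 * c) * (t - 1) ^ 2) := by
    intro t ht
    have h1 : Real.sin (2 * Real.pi * t) ^ 2 / 2 ≤ 1 - |Real.cos (2 * Real.pi * t)| := by
      have := Real.sin_sq_add_cos_sq (2 * Real.pi * t)
      rw [← sq_abs (Real.cos _)] at this
      nlinarith [sq_nonneg (1 - |Real.cos (2 * Real.pi * t)|)]
    have jordan : ∀ s : ℝ, |s| ≤ 1 / 4 → 16 * s ^ 2 ≤ Real.sin (2 * Real.pi * s) ^ 2 := by
      intro s hs
      have hp := Real.pi_pos
      have := Real.mul_le_sin (x := 2 * Real.pi * |s|) (by positivity) (by nlinarith)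
      have e : 2 / Real.pi * (2 * Real.pi * |s|) = 4 * |s| := by field_simp; ring
      rw [e] at this
      have h2 : Real.sin (2 * Real.pi * |s|) ^ 2 = Real.sin (2 * Real.pi * s) ^ 2 := by
        rcases abs_cases s with ⟨h, _⟩ | ⟨h, _⟩ <;> rw [h]
        rw [mul_neg, Real.sin_neg, neg_sq]
      rw [← h2]
      nlinarith [abs_nonneg s, sq_abs s]
    have hj : ∃ j : ℝ, (j = 0 ∨ j = 1 / 2 ∨ j = 1) ∧
        8 * (t - j) ^ 2 ≤ 1 - |Real.cos (2 * Real.pi * t)| := by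
      rcases le_total t (1 / 4) with h | h
      · refine ⟨0, by simp, ?_⟩
        have := jordan t (abs_le.2 ⟨by linarith [ht.1], h⟩)
        rw [sub_zero]; linarith
      rcases le_total t (3 / 4) with h' | h'
      · refine ⟨1 / 2, by simp, ?_⟩
        have := jordan (t - 1 / 2) (abs_le.2 ⟨by linarith, by linarith⟩)
        rw [show 2 * Real.pi * (t - 1 / 2) = 2 * Real.pi * t - Real.pi by ring, Real.sin_sub_pi,
          neg_sq] at this
        linarith
      · refine ⟨1, by simp, ?_⟩
        have := jordan (t - 1) (abs_le.2 ⟨by linarith, by linarith [ht.2]⟩)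
        rw [show 2 * Real.pi * (t - 1) = 2 * Real.pi * t - 2 * Real.pi by ring,
          Real.sin_sub_two_pi] at this
        linarith
    obtain ⟨j, hj, hle⟩ := hj
    have hm : Real.exp (-(c * (1 - |Real.cos (2 * Real.pi * t)|))) ≤
        Real.exp (-(8 * c) * (t - j) ^ 2) := Real.exp_le_exp.2 (by nlinarith)
    have p0 := Real.exp_pos (-(8 * c) * (t - 0) ^ 2)
    have p1 := Real.exp_pos (-(8 * c) * (t - 1 / 2) ^ 2)
    have p2 := Real.exp_pos (-(8 * c) * (t - 1) ^ 2)
    rcases hj with rfl | rfl | rfl <;> linarith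
  calc _ ≤ ∫ t in Icc (0:ℝ) 1, (Real.exp (-(8 * c) * (t - 0) ^ 2) +
        Real.exp (-(8 * c) * (t - 1 / 2) ^ 2) + Real.exp (-(8 * c) * (t - 1) ^ 2)) := by
        refine setIntegral_mono_on ?_ ?_ measurableSet_Icc hpt
        · exact (Continuous.integrableOn_Icc (by fun_prop))
        · exact (((hg _).add (hg _)).add (hg _)).integrableOn
    _ ≤ ∫ t, (Real.exp (-(8 * c) * (t - 0) ^ 2) +
        Real.exp (-(8 * c) * (t - 1 / 2) ^ 2) + Real.exp (-(8 * c) * (t - 1) ^ 2)) :=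
        setIntegral_le_integral (((hg _).add (hg _)).add (hg _))
          (Eventually.of_forall fun t => by positivity)
    _ = _ := by
        have h2 : Integrable fun t : ℝ => Real.exp (-(8 * c) * (t - 0) ^ 2) +
          Real.exp (-(8 * c) * (t - 1 / 2) ^ 2) := (hg _).add (hg _)
        rw [integral_add h2 (hg _), integral_add (hg _) (hg _), hgi, hgi, hgi]; ring

lemma srwP_heat (d : ℕ) (hd : 3 ≤ d) : ∃ C : ℝ, 0 < C ∧ ∀ n : ℕ, 1 ≤ n → ∀ x y : V d,
    srwP d n x y ≤ C / Real.sqrt n ^ d := by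
  have hd' : (0:ℝ) < d := by positivity
  refine ⟨(3 * Real.sqrt (Real.pi * d / 8)) ^ d, by positivity, fun n hn x y => ?_⟩
  have hn' : (0:ℝ) < n := by exact_mod_cast hn
  have hb : ∀ t : Fin d → ℝ, |qf d t| ^ n ≤
      ∏ i, Real.exp (-((n / d : ℝ) * (1 - |Real.cos (2 * Real.pi * t i)|))) := by
    intro t
    rw [← Real.exp_sum]
    have h1 : |qf d t| ≤ Real.exp (-((1 / d : ℝ) * ∑ i, (1 - |Real.cos (2 * Real.pi * t i)|))) := by
      refine le_trans ?_ (Real.add_one_le_exp _)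
      unfold qf
      rw [abs_mul, abs_of_pos (by positivity : (0:ℝ) < 1 / d), Finset.sum_sub_distrib]
      simp only [Finset.sum_const, Finset.card_univ, Fintype.card_fin, nsmul_eq_mul, mul_one]
      rw [mul_sub, one_div, inv_mul_cancel₀ hd'.ne']
      have := Finset.abs_sum_le_sum_abs (fun i => Real.cos (2 * Real.pi * t i)) Finset.univ
      have h2 : (0:ℝ) ≤ (d:ℝ)⁻¹ := by positivity
      nlinarith [mul_le_mul_of_nonneg_left this h2]
    refine (pow_le_pow_left₀ (abs_nonneg _) h1 n).trans (le_of_eq ?_)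
    rw [← Real.exp_nat_mul]
    congr 1
    rw [Finset.sum_neg_distrib, ← Finset.mul_sum]
    ring
  rw [fourier_rep]
  have hcont := qf_cont d
  calc ∫ t, qf d t ^ n * Real.cos (2 * Real.pi * ∑ i, t i * ((x - y) i : ℤ)) ∂cubeM d
      ≤ ∫ t, ∏ i, Real.exp (-((n / d : ℝ) * (1 - |Real.cos (2 * Real.pi * t i)|))) ∂cubeM d := by
        refine integral_mono ?_ ?_ fun t => ?_
        · refine Integrable.of_bound (C := 1) ?_ (Eventually.of_forall fun t => ?_)
          · exact Continuous.aestronglyMeasurable (by fun_prop)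
          · rw [Real.norm_eq_abs, abs_mul, abs_pow]
            exact mul_le_one₀ (pow_le_one₀ (abs_nonneg _) (qf_abs d t)) (abs_nonneg _)
              (Real.abs_cos_le_one _)
        · refine Integrable.of_bound (C := 1) ?_ (Eventually.of_forall fun t => ?_)
          · exact Continuous.aestronglyMeasurable (by fun_prop)
          · rw [Real.norm_eq_abs, abs_of_nonneg (by positivity)]
            refine Finset.prod_le_one (fun i _ => by positivity) fun i _ => ?_
            refine Real.exp_le_one_iff.2 ?_
            have := Real.abs_cos_le_one (2 * Real.pi * t i)
            have h2 : 0 ≤ (n / d : ℝ) * (1 - |Real.cos (2 * Real.pi * t i)|) :=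
              mul_nonneg (by positivity) (by linarith)
            linarith
        · refine (le_abs_self _).trans ?_
          rw [abs_mul, abs_pow]
          refine le_trans ?_ (hb t)
          exact mul_le_of_le_one_right (by positivity) (Real.abs_cos_le_one _)
    _ = ∏ i : Fin d, ∫ t in Icc (0:ℝ) 1,
          Real.exp (-((n / d : ℝ) * (1 - |Real.cos (2 * Real.pi * t)|))) :=
        integral_fintype_prod_eq_prod (𝕜 := ℝ) (ι := Fin d) (E := fun _ => ℝ)
          (μ := fun _ => volume.restrict (Icc (0:ℝ) 1))
          (fun i t => Real.exp (-((n / d : ℝ) * (1 - |Real.cos (2 * Real.pi * t)|))))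
    _ ≤ ∏ i : Fin d, (3 * Real.sqrt (Real.pi / (8 * (n / d)))) :=
        Finset.prod_le_prod (fun i _ => by positivity)
          (fun i _ => one_dim_int _ (by positivity))
    _ = _ := by
        rw [Finset.prod_const, Finset.card_univ, Fintype.card_fin,
          show Real.pi / (8 * (n / d)) = (Real.pi * d / 8) / n by field_simp,
          Real.sqrt_div (by positivity), ← mul_div_assoc, div_pow]

lemma tele_sqrt (n : ℕ) (hn : 1 ≤ n) : 1 / Real.sqrt (n + 1 : ℕ) ^ 3 ≤
    2 / Real.sqrt n - 2 / Real.sqrt (n + 1 : ℕ) := by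
  set a := Real.sqrt n with ha
  set b := Real.sqrt (n + 1 : ℕ) with hb
  have hn' : (0:ℝ) < n := by exact_mod_cast hn
  have ha0 : 0 < a := Real.sqrt_pos.2 hn'
  have hb0 : 0 < b := Real.sqrt_pos.2 (by positivity)
  have ha2 : a ^ 2 = n := Real.sq_sqrt hn'.le
  have hb2 : b ^ 2 = n + 1 := by rw [hb, Real.sq_sqrt (by positivity)]; push_cast; ring
  have hab : a ≤ b := Real.sqrt_le_sqrt (by push_cast; linarith)
  rw [div_sub_div _ _ ha0.ne' hb0.ne', div_le_div_iff₀ (by positivity) (by positivity)]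
  have h1 : (b - a) * (b + a) = 1 := by nlinarith
  have h2 : 1 ≤ (b - a) * (2 * b) := by nlinarith
  have : a * b ≤ 2 * (b - a) * b ^ 3 := by
    calc a * b ≤ b * b := by gcongr
      _ ≤ ((b - a) * (2 * b)) * (b * b) := by nlinarith [mul_pos hb0 hb0]
      _ = _ := by ring
  nlinarith

lemma sum_tail (T M : ℕ) (hT : 1 ≤ T) : ∑ j ∈ Finset.range M, 1 / Real.sqrt (j + T : ℕ) ^ 3 ≤
    3 / Real.sqrt T := by
  have hT1 : (1:ℝ) ≤ Real.sqrt T := by rw [Real.one_le_sqrt]; exact_mod_cast hT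
  have hstep : ∀ M : ℕ, ∑ j ∈ Finset.range (M + 1), 1 / Real.sqrt (j + T : ℕ) ^ 3 ≤
      3 / Real.sqrt T - 2 / Real.sqrt (M + T : ℕ) := by
    intro M
    induction M with
    | zero =>
      simp only [zero_add, Finset.range_one, Finset.sum_singleton]
      rw [← sub_div, show (3:ℝ) - 2 = 1 by norm_num]
      gcongr
      exact le_self_pow₀ hT1 (by norm_num)
    | succ M ih =>
      rw [Finset.sum_range_succ]
      have := tele_sqrt (M + T) (by omega)
      rw [show M + T + 1 = M + 1 + T by ring] at this
      linarith
  rcases M with _ | M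
  · simp only [Finset.range_zero, Finset.sum_empty]; positivity
  · refine (hstep M).trans ?_
    have : (0:ℝ) ≤ 2 / Real.sqrt (M + T : ℕ) := by positivity
    linarith

lemma srw_tail (d : ℕ) (hd : 3 ≤ d) : ∃ C : ℝ, 0 < C ∧ ∀ x y : V d, (Summable fun j => srwP d j x y) ∧
    ∀ t T : ℕ, 1 ≤ t → t ^ 2 ≤ T → ∑' j, srwP d (j + T) x y ≤ C / t ^ (d - 2) := by
  obtain ⟨C, hC, hh⟩ := srwP_heat d hd
  have hfin : ∀ x y : V d, ∀ t T : ℕ, 1 ≤ t → t ^ 2 ≤ T → ∀ M,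
      ∑ j ∈ Finset.range M, srwP d (j + T) x y ≤ 3 * C / t ^ (d - 2) := by
    intro x y t T ht hT M
    have hT1 : 1 ≤ T := le_trans (Nat.one_le_pow _ _ ht) hT
    have ht0 : (0:ℝ) < t := by exact_mod_cast ht
    have hsq : ∀ n : ℕ, T ≤ n → (t:ℝ) ≤ Real.sqrt n := fun n hn =>
      Real.le_sqrt_of_sq_le (by exact_mod_cast hT.trans hn)
    have : ∀ j, srwP d (j + T) x y ≤ C / t ^ (d - 3) * (1 / Real.sqrt (j + T : ℕ) ^ 3) := by
      intro j
      refine (hh (j + T) (by omega) x y).trans ?_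
      rw [div_mul_div_comm, mul_one]
      have h1 := hsq (j + T) (by omega)
      have : Real.sqrt (j + T : ℕ) ^ d = Real.sqrt (j + T : ℕ) ^ (d - 3) * Real.sqrt (j + T : ℕ) ^ 3 := by
        rw [← pow_add]; congr 1; omega
      rw [this]
      have h3 : 0 < Real.sqrt (j + T : ℕ) := lt_of_lt_of_le ht0 h1
      gcongr
    refine (Finset.sum_le_sum fun j _ => this j).trans ?_
    rw [← Finset.mul_sum]
    have h3 := sum_tail T M hT1
    have h4 : (3:ℝ) / Real.sqrt T ≤ 3 / t := by gcongr; exact hsq T le_rfl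
    calc _ ≤ C / t ^ (d - 3) * (3 / t) := by gcongr; exact h3.trans h4
      _ = _ := by
        rw [div_mul_div_comm, ← pow_succ, show d - 3 + 1 = d - 2 by omega, mul_comm C]
  refine ⟨3 * C, by positivity, fun x y => ⟨?_, ?_⟩⟩
  · rw [← summable_nat_add_iff 1]
    exact summable_of_sum_range_le (fun j => srwP_nonneg _ _ _ _) (hfin x y 1 1 le_rfl le_rfl)
  · intro t T ht hT
    exact Real.tsum_le_of_sum_range_le (fun j => srwP_nonneg _ _ _ _) (hfin x y t T ht hT)

lemma green_far (d : ℕ) (hd : 3 ≤ d) : ∃ C : ℝ, 0 < C ∧ ∀ x y : V d, ∀ t m : ℕ, 1 ≤ t → 1 ≤ m →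
    (∃ i, ((m * t : ℕ) : ℤ) ≤ |x i - y i|) →
    green d x y ≤ C / t ^ (d - 2) + t ^ 2 * Real.exp (-(m:ℝ) ^ 2 / 2) := by
  obtain ⟨C, hC, hh⟩ := srw_tail d hd
  refine ⟨C, hC, fun x y t m ht hm ⟨i, hi⟩ => ?_⟩
  obtain ⟨hs, ht'⟩ := hh x y
  have hsplit := hs.sum_add_tsum_nat_add (t ^ 2)
  rw [green, ← hsplit, add_comm]
  refine add_le_add (ht' t _ ht le_rfl) ?_
  have hmt : ((m * t : ℕ) : ℝ) ≤ |(x i : ℝ) - y i| := by exact_mod_cast hi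
  have : ∀ j ∈ Finset.range (t ^ 2), srwP d j x y ≤ Real.exp (-(m:ℝ) ^ 2 / 2) := by
    intro j hj
    rcases Nat.eq_zero_or_pos j with rfl | hj0
    · have : x ≠ y := by
        rintro rfl
        simp only [sub_self, abs_zero] at hi
        have : 0 < m * t := by positivity
        omega
      simp only [srwP, this, if_false]
      positivity
    · refine (srwP_gauss d j x y i hj0).trans (Real.exp_le_exp.2 ?_)
      have hj' : (j:ℝ) ≤ (t:ℝ) ^ 2 := by exact_mod_cast (Finset.mem_range.1 hj).le
      have hj0' : (0:ℝ) < j := by exact_mod_cast hj0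
      rw [div_le_div_iff₀ (by positivity) (by norm_num)]
      have h1 : ((m:ℝ) * t) ^ 2 ≤ ((x i : ℝ) - y i) ^ 2 := by
        rw [← sq_abs ((x i : ℝ) - y i)]
        push_cast at hmt
        gcongr
      have h2 : (m:ℝ) ^ 2 * j ≤ (m:ℝ) ^ 2 * t ^ 2 := by gcongr
      nlinarith
  refine (Finset.sum_le_sum this).trans (le_of_eq ?_)
  simp

lemma poly_exp (a : ℕ) : ∃ C : ℝ, 0 < C ∧ ∀ m : ℕ, 1 ≤ m →
    (m:ℝ) ^ a * Real.exp (-(m:ℝ) ^ 2 / 2) ≤ C := by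
  refine ⟨2 ^ a * a.factorial, by positivity, fun m hm => ?_⟩
  have h1 : (1:ℝ) ≤ m := by exact_mod_cast hm
  have h := Real.pow_div_factorial_le_exp ((m:ℝ) ^ 2 / 2) (by positivity) a
  rw [div_le_iff₀ (by positivity)] at h
  have h2 : (m:ℝ) ^ a ≤ 2 ^ a * ((m:ℝ) ^ 2 / 2) ^ a := by
    rw [← mul_pow]
    gcongr
    nlinarith
  calc (m:ℝ) ^ a * Real.exp (-(m:ℝ) ^ 2 / 2)
      ≤ 2 ^ a * (Real.exp ((m:ℝ) ^ 2 / 2) * a.factorial) * Real.exp (-(m:ℝ) ^ 2 / 2) := by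
        gcongr; exact h2.trans (by gcongr)
    _ = 2 ^ a * a.factorial * (Real.exp ((m:ℝ) ^ 2 / 2) * Real.exp (-(m:ℝ) ^ 2 / 2)) := by ring
    _ = _ := by rw [← Real.exp_add]; ring_nf; simp

lemma green_far' (d : ℕ) (hd : 3 ≤ d) : ∃ C : ℝ, 0 < C ∧ ∀ x y : V d, green d x y ≤ C ∧ ∀ m : ℕ, 1 ≤ m →
    ((∃ i, ((m ^ 8 : ℕ) : ℤ) ≤ |x i - y i|) → green d x y ≤ C / m ^ (2 * d)) ∧
    ((∃ i, ((m ^ 10 : ℕ) : ℤ) ≤ |x i - y i|) → green d x y ≤ C / m ^ 9) := by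
  obtain ⟨C0, hC0, hh0⟩ := srw_tail d hd
  obtain ⟨C1, hC1, hh⟩ := green_far d hd
  obtain ⟨C2, hC2, h2⟩ := poly_exp (14 + 2 * d)
  obtain ⟨C3, hC3, h3⟩ := poly_exp (18 + 9)
  refine ⟨C0 + 1 + (C1 + C2 + C3), by positivity, fun x y => ⟨?_, fun m hm => ⟨fun ⟨i, hi⟩ => ?_, fun ⟨i, hi⟩ => ?_⟩⟩⟩
  · obtain ⟨hs, ht'⟩ := hh0 x y
    have hsplit := hs.sum_add_tsum_nat_add 1
    have := ht' 1 1 le_rfl le_rfl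
    simp only [Finset.range_one, Finset.sum_singleton, Nat.cast_one, one_pow, div_one] at *
    have h0 : srwP d 0 x y ≤ 1 := by simp only [srwP]; split_ifs <;> norm_num
    rw [green, ← hsplit]
    linarith
  all_goals have hm0 : (1:ℝ) ≤ m := by exact_mod_cast hm
  · have := hh x y (m ^ 7) m (Nat.one_le_pow _ _ hm) hm ⟨i, by convert hi using 2; ring⟩
    refine this.trans ?_
    have a1 : C1 / ((m ^ 7 : ℕ) : ℝ) ^ (d - 2) ≤ C1 / m ^ (2 * d) := by
      push_cast; rw [← pow_mul]
      refine div_le_div_of_nonneg_left hC1.le (by positivity) (pow_le_pow_right₀ hm0 (by omega))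
    have a2 : ((m ^ 7 : ℕ) : ℝ) ^ 2 * Real.exp (-(m:ℝ) ^ 2 / 2) ≤ C2 / m ^ (2 * d) := by
      rw [le_div_iff₀ (by positivity)]
      refine le_trans (le_of_eq ?_) (h2 m hm)
      push_cast; ring
    refine (add_le_add a1 a2).trans ?_
    rw [← add_div]
    exact div_le_div_of_nonneg_right (by linarith) (by positivity)
  · have := hh x y (m ^ 9) m (Nat.one_le_pow _ _ hm) hm ⟨i, by convert hi using 2; ring⟩
    refine this.trans ?_
    have a1 : C1 / ((m ^ 9 : ℕ) : ℝ) ^ (d - 2) ≤ C1 / m ^ 9 := by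
      push_cast; rw [← pow_mul]
      refine div_le_div_of_nonneg_left hC1.le (by positivity) (pow_le_pow_right₀ hm0 (by omega))
    have a2 : ((m ^ 9 : ℕ) : ℝ) ^ 2 * Real.exp (-(m:ℝ) ^ 2 / 2) ≤ C3 / m ^ 9 := by
      rw [le_div_iff₀ (by positivity)]
      refine le_trans (le_of_eq ?_) (h3 m hm)
      push_cast; ring
    refine (add_le_add a1 a2).trans ?_
    rw [← add_div]
    exact div_le_div_of_nonneg_right (by linarith) (by positivity)

/-! ### Covariance decomposition -/

/-- The kernel `P^k + P^{k+1}`. -/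
def Qk (d k : ℕ) (x z : V d) : ℝ := srwP d k x z + srwP d (k + 1) x z

/-- Covariance of the far field. -/
def GY (d K : ℕ) (x y : V d) : ℝ := srwP d (2 * K) x y / 2 + ∑' j, srwP d (j + (2 * K + 1)) x y

/-- Covariance of the local field. -/
def Gloc (d K : ℕ) (x y : V d) : ℝ := green d x y - GY d K x y

lemma Qk_sum (d k : ℕ) (x y : V d) (s : Finset (V d))
    (hs : ∀ z, (∀ i, |x i - z i| ≤ (k + 1 : ℕ)) → z ∈ s) :
    ∑ z ∈ s, Qk d k x z * Qk d k y z =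
      srwP d (2 * k) x y + 2 * srwP d (2 * k + 1) x y + srwP d (2 * k + 2) x y := by
  have hs' : ∀ z, (∀ i, |x i - z i| ≤ k) → z ∈ s := fun z hz =>
    hs z fun i => (hz i).trans (by push_cast; omega)
  have c1 := srwP_CK d k k x y s hs'
  have c2 := srwP_CK d k (k + 1) x y s hs'
  have c3 := srwP_CK d (k + 1) k x y s hs
  have c4 := srwP_CK d (k + 1) (k + 1) x y s hs
  rw [show 2 * k = k + k by ring, show k + k + 2 = k + 1 + (k + 1) by ring, ← c1, ← c4, two_mul]
  nth_rewrite 1 [show k + k + 1 = k + (k + 1) by ring]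
  rw [show k + k + 1 = k + 1 + k by ring, ← c2, ← c3,
    ← Finset.sum_add_distrib, ← Finset.sum_add_distrib, ← Finset.sum_add_distrib]
  refine Finset.sum_congr rfl fun z _ => ?_
  simp only [Qk]
  rw [srwP_symm d k y z, srwP_symm d (k + 1) y z]
  ring

lemma GY_succ (d : ℕ) (hd : 3 ≤ d) (K : ℕ) (x y : V d) : GY d K x y =
    (srwP d (2 * K) x y + 2 * srwP d (2 * K + 1) x y + srwP d (2 * K + 2) x y) / 2 +
      GY d (K + 1) x y := by
  obtain ⟨C, hC, hh⟩ := srw_tail d hd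
  have hs := (summable_nat_add_iff (2 * K + 1)).2 (hh x y).1
  have := hs.sum_add_tsum_nat_add 2
  simp only [GY]
  rw [← this]
  simp only [Finset.sum_range_succ, Finset.sum_range_zero, zero_add]
  have e1 : ∀ j, srwP d (j + 2 + (2 * K + 1)) x y = srwP d (j + (2 * (K + 1) + 1)) x y := by
    intro j; congr 1; ring
  simp_rw [e1]
  rw [show 1 + (2 * K + 1) = 2 * K + 2 by ring, show 2 * (K + 1) = 2 * K + 2 by ring]
  ring

lemma green_eq (d : ℕ) (hd : 3 ≤ d) (K : ℕ) (x y : V d) : green d x y =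
    (if x = y then 1 / 2 else 0) + (∑ k ∈ Finset.range K,
      (srwP d (2 * k) x y + 2 * srwP d (2 * k + 1) x y + srwP d (2 * k + 2) x y) / 2) +
      GY d K x y := by
  induction K with
  | zero =>
    obtain ⟨C, hC, hh⟩ := srw_tail d hd
    have := (hh x y).1.sum_add_tsum_nat_add 1
    rw [green, ← this]
    simp only [Finset.range_one, Finset.sum_singleton, GY, srwP, Finset.range_zero, Finset.sum_empty,
      mul_zero, zero_add, add_zero]
    split_ifs <;> ring
  | succ K ih =>
    rw [ih, GY_succ d hd K, Finset.sum_range_succ]; ring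

lemma GY_nonneg (d K : ℕ) (x y : V d) : 0 ≤ GY d K x y := by
  unfold GY
  exact add_nonneg (by have := srwP_nonneg d (2 * K) x y; positivity)
    (tsum_nonneg fun j => srwP_nonneg _ _ _ _)

lemma Gloc_le (d K : ℕ) (x y : V d) : Gloc d K x y ≤ green d x y := by
  unfold Gloc; linarith [GY_nonneg d K x y]

lemma GY_small (d : ℕ) (hd : 3 ≤ d) : ∃ C : ℝ, 0 < C ∧ ∀ K t : ℕ, 1 ≤ t → t ^ 2 ≤ 2 * K →
    ∀ x y, GY d K x y ≤ C / t := by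
  obtain ⟨C, hC, hh⟩ := srw_tail d hd
  refine ⟨C, hC, fun K t ht hK x y => ?_⟩
  obtain ⟨hs, h⟩ := hh x y
  have h1 := h t (2 * K) ht hK
  have hs' := (summable_nat_add_iff (2 * K)).2 hs
  have := hs'.sum_add_tsum_nat_add 1
  have e1 : ∀ j, srwP d (j + 1 + 2 * K) x y = srwP d (j + (2 * K + 1)) x y := by
    intro j; congr 1; ring
  simp_rw [e1] at this
  simp only [Finset.range_one, Finset.sum_singleton, zero_add] at this
  have h3 := srwP_nonneg d (2 * K) x y
  have h4 : C / (t:ℝ) ^ (d - 2) ≤ C / t := by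
    have : (1:ℝ) ≤ t := by exact_mod_cast ht
    gcongr
    exact le_self_pow₀ this (by omega)
  unfold GY
  linarith

lemma GY_psd (d : ℕ) (hd : 3 ≤ d) (K : ℕ) (s : Finset (V d)) (a : V d → ℝ) :
    0 ≤ ∑ x ∈ s, ∑ y ∈ s, a x * a y * GY d K x y := by
  have hmono : ∀ K, ∑ x ∈ s, ∑ y ∈ s, a x * a y * GY d (K + 1) x y ≤
      ∑ x ∈ s, ∑ y ∈ s, a x * a y * GY d K x y := by
    intro K
    have hfin : ∃ S : Finset (V d), ∀ x ∈ s, ∀ z, (∀ i, |x i - z i| ≤ (K + 1 : ℕ)) → z ∈ S := by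
      classical
      refine ⟨s.biUnion fun x => Finset.Icc (fun i => x i - (K + 1 : ℕ)) (fun i => x i + (K + 1 : ℕ)), ?_⟩
      intro x hx z hz
      refine Finset.mem_biUnion.2 ⟨x, hx, Finset.mem_Icc.2 ⟨fun i => ?_, fun i => ?_⟩⟩
      · have := abs_le.1 (hz i); simp only; omega
      · have := abs_le.1 (hz i); simp only; omega
    obtain ⟨S, hS⟩ := hfin
    have e : ∀ x ∈ s, ∀ y ∈ s, a x * a y * GY d K x y = a x * a y * GY d (K + 1) x y +
        (1 / 2) * ∑ z ∈ S, (a x * Qk d K x z) * (a y * Qk d K y z) := by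
      intro x hx y _
      rw [GY_succ d hd, ← Qk_sum d K x y S (hS x hx)]
      have : ∑ z ∈ S, (a x * Qk d K x z) * (a y * Qk d K y z) =
          a x * a y * ∑ z ∈ S, Qk d K x z * Qk d K y z := by
        rw [Finset.mul_sum]; exact Finset.sum_congr rfl fun z _ => by ring
      rw [this]; ring
    rw [Finset.sum_congr rfl fun x hx => Finset.sum_congr rfl fun y hy => e x hx y hy]
    simp_rw [Finset.sum_add_distrib, ← Finset.mul_sum]
    have : ∑ x ∈ s, ∑ y ∈ s, ∑ z ∈ S, (a x * Qk d K x z) * (a y * Qk d K y z) =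
        ∑ z ∈ S, (∑ x ∈ s, a x * Qk d K x z) ^ 2 := by
      simp_rw [sq, Finset.sum_mul_sum]
      calc _ = ∑ x ∈ s, ∑ z ∈ S, ∑ y ∈ s, (a x * Qk d K x z) * (a y * Qk d K y z) :=
            Finset.sum_congr rfl fun x _ => Finset.sum_comm
        _ = _ := Finset.sum_comm
    rw [this]
    have : 0 ≤ ∑ z ∈ S, (∑ x ∈ s, a x * Qk d K x z) ^ 2 := Finset.sum_nonneg fun z _ => sq_nonneg _
    linarith
  have hanti : Antitone fun K => ∑ x ∈ s, ∑ y ∈ s, a x * a y * GY d K x y :=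
    antitone_nat_of_succ_le hmono
  obtain ⟨C, hC, hsm⟩ := GY_small d hd
  have hlim : ∀ x y, Tendsto (fun t : ℕ => GY d (t ^ 2) x y) atTop (nhds 0) := by
    intro x y
    refine squeeze_zero' (Eventually.of_forall fun t => GY_nonneg d _ x y)
      ((eventually_ge_atTop 1).mono fun t ht => hsm (t ^ 2) t ht (by omega) x y)
      (tendsto_const_div_atTop_nhds_zero_nat C)
  have hl2 : Tendsto (fun t : ℕ => ∑ x ∈ s, ∑ y ∈ s, a x * a y * GY d (t ^ 2) x y) atTop (nhds 0) := by
    have := tendsto_finset_sum s fun x _ => tendsto_finset_sum s fun y _ =>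
      (hlim x y).const_mul (a x * a y)
    simpa using this
  refine le_of_tendsto hl2 ((eventually_ge_atTop (K + 1)).mono fun t ht => ?_)
  refine hanti ?_
  nlinarith

section geom
variable {d : ℕ}

lemma dinf_le {x y : V d} {r : ℕ} : dinf x y ≤ r ↔ ∀ i, |x i - y i| ≤ (r : ℤ) := by
  unfold dinf
  rw [Finset.sup_le_iff]
  simp only [Finset.mem_univ, forall_const]
  exact forall_congr' fun i => by rw [abs_le]; omega

lemma le_dinf (x y : V d) (i : Fin d) : |x i - y i| ≤ (dinf x y : ℤ) := dinf_le.1 le_rfl i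

lemma dinf_comm (x y : V d) : dinf x y = dinf y x := by
  unfold dinf; congr 1; funext i; omega

lemma dinf_tri (x y z : V d) : dinf x z ≤ dinf x y + dinf y z := by
  rw [dinf_le]; intro i
  have h1 := abs_le.1 (le_dinf x y i)
  have h2 := abs_le.1 (le_dinf y z i)
  rw [abs_le]; push_cast; constructor <;> linarith

lemma dinf_self (x : V d) : dinf x x = 0 := Nat.le_zero.1 (dinf_le.2 (by simp))

lemma adj_symm {x y : V d} (h : adj x y) : adj y x := by
  unfold adj at *; rw [← h]; exact Finset.sum_congr rfl fun i _ => by omega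

lemma adj_dinf {x y : V d} (h : adj x y) : dinf x y ≤ 1 := by
  rw [dinf_le]; intro i
  have := Finset.single_le_sum (f := fun i => (x i - y i).natAbs) (fun _ _ => Nat.zero_le _)
    (Finset.mem_univ i)
  unfold adj at h
  rw [abs_le]; omega

lemma dinf_attained (hd : 0 < d) (x y : V d) : ∃ i, |x i - y i| = (dinf x y : ℤ) := by
  have : (Finset.univ : Finset (Fin d)).Nonempty := ⟨⟨0, hd⟩, Finset.mem_univ _⟩
  obtain ⟨i, _, hi⟩ := Finset.exists_mem_eq_sup _ this fun i => (x i - y i).natAbs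
  refine ⟨i, ?_⟩
  unfold dinf; rw [hi]; simp

lemma boxAt_iff {x y : V d} {r : ℕ} : y ∈ boxAt x (r : ℝ) ↔ dinf x y ≤ r := by
  rw [dinf_comm, dinf_le]
  unfold boxAt
  simp only [mem_ofPred_eq]
  exact forall_congr' fun i => by exact_mod_cast Iff.rfl

lemma adj_up (x : V d) (i : Fin d) : adj x (x + unitV d i) := by
  unfold adj unitV
  simp only [Pi.add_apply, sub_add_cancel_left]
  rw [Finset.sum_eq_single i] <;> simp +contextual

lemma adj_down (x : V d) (i : Fin d) : adj x (x - unitV d i) := by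
  unfold adj unitV
  simp only [Pi.sub_apply, sub_sub_cancel]
  rw [Finset.sum_eq_single i] <;> simp +contextual

lemma bdryAt_iff (hd : 0 < d) {x y : V d} {r : ℕ} : y ∈ bdryAt x (r : ℝ) ↔ dinf x y = r := by
  unfold bdryAt
  simp only [mem_ofPred_eq, boxAt_iff]
  constructor
  · rintro ⟨h1, z, h2, h3⟩
    have := dinf_tri x y z
    have := adj_dinf h3
    omega
  · intro h
    refine ⟨h.le, ?_⟩
    obtain ⟨i, hi⟩ := dinf_attained hd x y
    rcases abs_cases (x i - y i) with ⟨h1, h2⟩ | ⟨h1, h2⟩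
    · refine ⟨y - unitV d i, fun hc => ?_, adj_down y i⟩
      have := dinf_le.1 hc i
      simp only [Pi.sub_apply, unitV, if_true] at this
      have := abs_le.1 this; omega
    · refine ⟨y + unitV d i, fun hc => ?_, adj_up y i⟩
      have := dinf_le.1 hc i
      simp only [Pi.add_apply, unitV, if_true] at this
      have := abs_le.1 this; omega

/-- finset box -/
def fbx (x : V d) (r : ℕ) : Finset (V d) := Finset.Icc (fun i => x i - r) (fun i => x i + r)

lemma mem_fbx {x y : V d} {r : ℕ} : y ∈ fbx x r ↔ dinf x y ≤ r := by
  unfold fbx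
  rw [Finset.mem_Icc, dinf_le, Pi.le_def, Pi.le_def, ← forall_and]
  exact forall_congr' fun i => by rw [abs_le]; constructor <;> intro h <;> constructor <;> linarith [h.1, h.2]

lemma card_fbx (x : V d) (r : ℕ) : (fbx x r).card = (2 * r + 1) ^ d := by
  unfold fbx
  rw [Pi.card_Icc]
  simp only [Int.card_Icc]
  have : ∀ i, (x i + (r : ℤ) + 1 - (x i - r)).toNat = 2 * r + 1 := fun i => by omega
  simp [this]

/-- connection relation -/
def Cn (S : Set (V d)) (a b : V d) : Prop :=
  a ∈ S ∧ Relation.ReflTransGen (fun x y => x ∈ S ∧ adj x y ∧ y ∈ S) a b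

lemma Cn.refl {S : Set (V d)} {a : V d} (h : a ∈ S) : Cn S a a := ⟨h, .refl⟩

lemma Cn.ind {S : Set (V d)} {b : V d} {P : V d → Prop} (base : b ∈ S → P b)
    (step : ∀ a c, a ∈ S → adj a c → Cn S c b → P c → P a) {a : V d} (h : Cn S a b) : P a := by
  obtain ⟨ha, h⟩ := h
  induction h using Relation.ReflTransGen.head_induction_on with
  | refl => exact base ha
  | head h1 h2 ih => exact step _ _ h1.1 h1.2.1 ⟨h1.2.2, h2⟩ (ih h1.2.2)

lemma Cn.left {S : Set (V d)} {a b : V d} (h : Cn S a b) : a ∈ S := h.1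

lemma Cn.right {S : Set (V d)} {a b : V d} (h : Cn S a b) : b ∈ S :=
  h.ind (P := fun _ => b ∈ S) id fun _ _ _ _ _ h => h

lemma Cn.head {S : Set (V d)} {a c b : V d} (ha : a ∈ S) (h : adj a c) (h2 : Cn S c b) : Cn S a b :=
  ⟨ha, .head ⟨ha, h, h2.1⟩ h2.2⟩

lemma Cn.trans {S : Set (V d)} {a b c : V d} (h : Cn S a b) (h2 : Cn S b c) : Cn S a c :=
  ⟨h.1, h.2.trans h2.2⟩

lemma Cn.mono {S T : Set (V d)} (hST : S ⊆ T) {a b : V d} (h : Cn S a b) : Cn T a b :=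
  h.ind (P := fun a => Cn T a b) (fun hb => .refl (hST hb)) fun _ _ ha h1 _ h2 => .head (hST ha) h1 h2

lemma Cn.symm {S : Set (V d)} {a b : V d} (h : Cn S a b) : Cn S b a :=
  h.ind (P := fun a => Cn S b a) (fun hb => .refl hb) fun _ _ ha h1 h3 h2 =>
    h2.trans (.head h3.1 (adj_symm h1) (.refl ha))

lemma connIn_iff {S A B : Set (V d)} : ConnIn S A B ↔ ∃ a ∈ A, ∃ b ∈ B, Cn S a b := by
  constructor
  · rintro ⟨n, γ, h0, hn, hS, hadj⟩
    refine ⟨_, h0, _, hn, ?_⟩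
    have : ∀ k, k ≤ n → Cn S (γ 0) (γ k) := by
      intro k
      induction k with
      | zero => intro _; exact .refl (hS 0 (Nat.zero_le _))
      | succ k ih => intro hk
                     exact (ih (by omega)).trans (.head (hS k (by omega)) (hadj k (by omega)) (.refl (hS _ hk)))
    exact this n le_rfl
  · rintro ⟨a, ha, b, hb, h⟩
    have : ∃ (n : ℕ) (γ : ℕ → V d), γ 0 = a ∧ γ n ∈ B ∧ (∀ k, k ≤ n → γ k ∈ S) ∧
        ∀ k, k < n → adj (γ k) (γ (k + 1)) := by
      refine h.ind (P := fun a => ∃ (n : ℕ) (γ : ℕ → V d), γ 0 = a ∧ γ n ∈ B ∧ (∀ k, k ≤ n → γ k ∈ S) ∧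
        ∀ k, k < n → adj (γ k) (γ (k + 1))) ?_ ?_
      · intro hb'; exact ⟨0, fun _ => b, rfl, hb, fun _ _ => hb', fun k hk => by omega⟩
      · rintro a c haS hac _ ⟨n, γ, h0, hn, hS, hadj⟩
        refine ⟨n + 1, fun k => Nat.casesOn k a γ, rfl, hn, ?_, ?_⟩
        · rintro (_ | k) hk
          · exact haS
          · exact hS k (by omega)
        · rintro (_ | k) hk
          · simpa [h0] using hac
          · exact hadj k (by omega)
    obtain ⟨n, γ, h0, h1⟩ := this
    exact ⟨n, γ, h0 ▸ ha, h1⟩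

lemma Cn.cross {S : Set (V d)} {a b x : V d} {r : ℕ} (h : Cn S a b) (ha : dinf x a ≤ r)
    (hb : r ≤ dinf x b) : ∃ c, dinf x c = r ∧ Cn (S ∩ {z | dinf x z ≤ r}) a c := by
  revert ha
  refine h.ind (P := fun a => dinf x a ≤ r → ∃ c, dinf x c = r ∧ Cn (S ∩ {z | dinf x z ≤ r}) a c) ?_ ?_
  · intro hbS h; exact ⟨b, le_antisymm h hb, .refl ⟨hbS, h⟩⟩
  · intro a c haS hac _ ih har
    by_cases hc : dinf x c ≤ r
    · obtain ⟨e, he, he2⟩ := ih hc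
      exact ⟨e, he, .head ⟨haS, har⟩ hac he2⟩
    · have := dinf_tri x a c
      have := adj_dinf hac
      exact ⟨a, by omega, .refl ⟨haS, har⟩⟩

lemma Cn.switch {S : Set (V d)} {a b : V d} (P Q : V d → Prop) (h : Cn S a b)
    (hPQ : ∀ z ∈ S, P z ∨ Q z) (ha : P a) (hb : Q b) :
    ∃ c ∈ S, ∃ c', dinf c c' ≤ 1 ∧ P c ∧ Q c' := by
  revert ha
  refine h.ind (P := fun a => P a → ∃ c ∈ S, ∃ c', dinf c c' ≤ 1 ∧ P c ∧ Q c') ?_ ?_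
  · intro hbS h; exact ⟨b, hbS, b, by simp [dinf_self], h, hb⟩
  · intro a c haS hac hc ih har
    rcases hPQ c hc.1 with h | h
    · exact ih h
    · exact ⟨a, haS, c, adj_dinf hac, har, h⟩

lemma hull_path (n : ℕ) : ∀ (a b : V d), ∑ i, (a i - b i).natAbs = n →
    ∃ E : Finset (V d), E.card ≤ n + 1 ∧ (∀ z ∈ E, ∀ i, z i ∈ Set.uIcc (a i) (b i)) ∧ Cn (E : Set (V d)) a b := by
  induction n with
  | zero =>
    intro a b h
    have : a = b := by
      funext i
      have := (Finset.sum_eq_zero_iff.1 h) i (Finset.mem_univ _)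
      omega
    subst this
    exact ⟨{a}, by simp, by simp, .refl (by simp)⟩
  | succ n ih =>
    intro a b h
    have : ∃ i, a i ≠ b i := by
      by_contra hc
      push Not at hc
      simp [hc] at h
    obtain ⟨i, hi⟩ := this
    have key : ∀ a' : V d, adj a a' → (∀ j, j ≠ i → a' j = a j) → (a' i - b i).natAbs + 1 = (a i - b i).natAbs →
        ∃ E : Finset (V d), E.card ≤ n + 1 + 1 ∧ (∀ z ∈ E, ∀ i, z i ∈ Set.uIcc (a i) (b i)) ∧
          Cn (E : Set (V d)) a b := by
      intro a' hadj hj hi'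
      have hs : ∑ i, (a' i - b i).natAbs = n := by
        rw [← Finset.add_sum_erase _ _ (Finset.mem_univ i)] at h ⊢
        have : ∑ x ∈ Finset.univ.erase i, (a' x - b x).natAbs = ∑ x ∈ Finset.univ.erase i, (a x - b x).natAbs :=
          Finset.sum_congr rfl fun j hj' => by rw [hj j (Finset.ne_of_mem_erase hj')]
        rw [this]; omega
      have hu : ∀ j, Set.uIcc (a' j) (b j) ⊆ Set.uIcc (a j) (b j) := by
        intro j z hz
        by_cases hji : j = i
        · subst hji
          have h7 := abs_le.1 (dinf_le.1 (adj_dinf hadj) j)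
          rw [Set.mem_uIcc] at *; omega
        · rwa [hj j hji] at hz
      obtain ⟨E, h1, h2, h3⟩ := ih a' b hs
      refine ⟨insert a E, (Finset.card_insert_le _ _).trans (by omega), ?_, ?_⟩
      · intro z hz j
        rcases Finset.mem_insert.1 hz with rfl | hz
        · exact Set.left_mem_uIcc
        · exact hu j (h2 z hz j)
      · exact .head (by simp) hadj (h3.mono (by simp))
    rcases lt_or_gt_of_ne hi with h1 | h1
    · refine key (a + unitV d i) (adj_up a i) (fun j hj => by simp [unitV, hj]) ?_
      simp [unitV]; omega
    · refine key (a - unitV d i) (adj_down a i) (fun j hj => by simp [unitV, hj]) ?_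
      simp [unitV]; omega

lemma hull_Cn {S : Set (V d)} {a b : V d} (h : ∀ z : V d, (∀ i, z i ∈ Set.uIcc (a i) (b i)) → z ∈ S) : Cn S a b := by
  obtain ⟨E, _, h2, h3⟩ := hull_path _ a b rfl
  exact h3.mono fun z hz => h z (h2 z hz)

lemma sphere_conn (hd : 2 ≤ d) (x : V d) (r : ℕ) {y z : V d} (hy : dinf x y = r) (hz : dinf x z = r) :
    Cn {w | dinf x w = r} y z := by
  suffices H : ∀ y, dinf x y = r → Cn {w | dinf x w = r} y (fun i => x i + r) from
    (H y hy).trans (H z hz).symm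
  intro y hy
  have sph : ∀ w : V d, dinf x w ≤ r → (∃ i, (r : ℤ) ≤ |x i - w i|) → dinf x w = r := by
    rintro w h1 ⟨i, hi⟩
    have := le_dinf x w i
    have : (r : ℤ) ≤ dinf x w := hi.trans this
    omega
  obtain ⟨i, hi⟩ := dinf_attained (by omega) x y
  rw [hy] at hi
  have hyr := dinf_le.1 hy.le
  have h1 : Cn {w | dinf x w = r} y (fun j => if j = i then y i else x j + r) := by
    refine hull_Cn fun w hw => sph w (dinf_le.2 fun j => ?_) ⟨i, ?_⟩
    · have := hw j
      have h3 := abs_le.1 (hyr j)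
      by_cases hj : j = i
      · subst hj; simp at this; rw [this]; exact hyr j
      · simp only [hj, if_false, Set.mem_uIcc] at this; rw [abs_le]; omega
    · have := hw i; simp at this; rw [this, hi]
  refine h1.trans ?_
  obtain ⟨j, hj⟩ : ∃ j : Fin d, j ≠ i := by
    haveI : Nontrivial (Fin d) := Fin.nontrivial_iff_two_le.2 hd
    exact exists_ne i
  refine hull_Cn fun w hw => sph w (dinf_le.2 fun k => ?_) ⟨j, ?_⟩
  · have := hw k
    have h3 := abs_le.1 (hyr k)
    by_cases hk : k = i
    · subst hk; simp only [if_true, Set.mem_uIcc] at this; rw [abs_le]; omega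
    · simp [hk] at this; rw [this]; simp
  · have := hw j; simp [hj] at this; rw [this]; simp

lemma Cn.detour {S Q : Set (V d)} {a b : V d} (h : Cn (S ∪ Q) a b) :
    Cn S a b ∨ ∃ s ∈ Q, ∃ t ∈ Q, Cn (insert s S) a s ∧ Cn (insert t S) t b := by
  refine h.ind (P := fun a => Cn S a b ∨ ∃ s ∈ Q, ∃ t ∈ Q, Cn (insert s S) a s ∧ Cn (insert t S) t b) ?_ ?_
  · rintro (hb | hb)
    · exact .inl (.refl hb)
    · exact .inr ⟨b, hb, b, hb, .refl (by simp), .refl (by simp)⟩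
  · rintro a c (ha | ha) hac _ ih
    · rcases ih with ih | ⟨s, hs, t, ht, h1, h2⟩
      · exact .inl (.head ha hac ih)
      · exact .inr ⟨s, hs, t, ht, .head (by simp [ha]) hac h1, h2⟩
    · rcases ih with ih | ⟨s, hs, t, ht, h1, h2⟩
      · exact .inr ⟨a, ha, a, ha, .refl (by simp), .head (by simp) hac (ih.mono (by simp))⟩
      · exact .inr ⟨a, ha, t, ht, .refl (by simp), h2⟩

/-- cube index -/
def cub (v : ℕ) (z : V d) : V d := fun i => z i / (v : ℤ)

lemma cub_close {v : ℕ} (hv : 0 < v) {a b : V d} {i : Fin d} {k : ℕ} (h : |cub v a i - cub v b i| ≤ (k : ℤ)) :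
    |a i - b i| < (k + 1) * (v : ℤ) := by
  unfold cub at h
  have hv' : (0 : ℤ) < v := by exact_mod_cast hv
  have h1 := Int.emod_add_mul_ediv (a i) v
  have h2 := Int.emod_add_mul_ediv (b i) v
  have h3 := Int.emod_nonneg (a i) hv'.ne'
  have h4 := Int.emod_nonneg (b i) hv'.ne'
  have h5 := Int.emod_lt_of_pos (a i) hv'
  have h6 := Int.emod_lt_of_pos (b i) hv'
  rw [abs_le] at h
  rw [abs_lt]; constructor <;> nlinarith

lemma reroute {v : ℕ} (hv : 0 < v) (qs : Finset (V d)) : ∀ (S : Set (V d)) (a b : V d),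
    Cn (S ∪ {z | cub v z ∈ qs}) a b → ∃ E : Finset (V d), E.card ≤ qs.card * (d * v + 1) ∧
      (∀ z ∈ E, cub v z ∈ qs) ∧ Cn (S ∪ E) a b := by
  induction qs using Finset.induction_on with
  | empty => intro S a b h; exact ⟨∅, by simp, by simp, by simpa using h⟩
  | insert q qs hq ih =>
    intro S a b h
    have h' : Cn ((S ∪ {z | cub v z ∈ qs}) ∪ {z | cub v z = q}) a b := by
      refine h.mono ?_
      rintro z (hz | hz)
      · exact .inl (.inl hz)
      · rcases Finset.mem_insert.1 hz with hz | hz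
        · exact .inr hz
        · exact .inl (.inr hz)
    rw [Finset.card_insert_of_notMem hq]
    rcases h'.detour with h1 | ⟨s, hs, t, ht, h1, h2⟩
    · obtain ⟨E, e1, e2, e3⟩ := ih S a b h1
      exact ⟨E, by nlinarith, fun z hz => Finset.mem_insert_of_mem (e2 z hz), e3⟩
    · obtain ⟨E0, f1, f2, f3⟩ := hull_path _ s t rfl
      have hcard : ∑ i, (s i - t i).natAbs ≤ d * v := by
        have : ∀ i ∈ (Finset.univ : Finset (Fin d)), (s i - t i).natAbs ≤ v := by
          intro i _
          have := cub_close hv (a := s) (b := t) (i := i) (k := 0)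
            (by rw [mem_ofPred_eq] at hs ht; rw [hs, ht]; simp)
          rw [abs_lt] at this; push_cast at this; omega
        simpa using Finset.sum_le_card_nsmul _ _ _ this
      have hE0 : ∀ z ∈ E0, cub v z = q := by
        intro z hz
        funext i
        have h3 := f2 z hz i
        have hs' : s i / (v : ℤ) = q i := congrFun hs i
        have ht' : t i / (v : ℤ) = q i := congrFun ht i
        have hv' : (0 : ℤ) ≤ v := by positivity
        unfold cub
        rcases Set.mem_uIcc.1 h3 with ⟨h4, h5⟩ | ⟨h4, h5⟩
        · have := Int.ediv_le_ediv (by exact_mod_cast hv : (0 : ℤ) < v) h4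
          have := Int.ediv_le_ediv (by exact_mod_cast hv : (0 : ℤ) < v) h5
          omega
        · have := Int.ediv_le_ediv (by exact_mod_cast hv : (0 : ℤ) < v) h4
          have := Int.ediv_le_ediv (by exact_mod_cast hv : (0 : ℤ) < v) h5
          omega
      have h3 : Cn ((S ∪ E0) ∪ {z | cub v z ∈ qs}) a b := by
        have hsE := f3.left
        have htE := f3.right
        refine (h1.mono ?_).trans ((f3.mono ?_).trans (h2.mono ?_))
        · rintro z (rfl | hz | hz)
          · exact .inl (.inr hsE)
          · exact .inl (.inl hz)
          · exact .inr hz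
        · intro z hz; exact .inl (.inr hz)
        · rintro z (rfl | hz | hz)
          · exact .inl (.inr htE)
          · exact .inl (.inl hz)
          · exact .inr hz
      obtain ⟨E, e1, e2, e3⟩ := ih _ a b h3
      classical
      refine ⟨E0 ∪ E, (Finset.card_union_le _ _).trans (by nlinarith), ?_, ?_⟩
      · intro z hz
        rcases Finset.mem_union.1 hz with hz | hz
        · exact Finset.mem_insert.2 (.inl (hE0 z hz))
        · exact Finset.mem_insert_of_mem (e2 z hz)
      · refine e3.mono ?_
        rw [Finset.coe_union, Set.union_assoc]

end geom

section indep
variable {ι : Type*} [Fintype ι] [DecidableEq ι] {α : ι → Type*} [∀ i, MeasurableSpace (α i)]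

/-- the set depends only on the coordinates in `I` -/
def DepOn (A : Set (∀ i, α i)) (I : Finset ι) : Prop :=
  ∀ x y : ∀ i, α i, (∀ i ∈ I, x i = y i) → x ∈ A → y ∈ A

lemma indep_two (μ : ∀ i, Measure (α i)) [∀ i, IsProbabilityMeasure (μ i)] {A B : Set (∀ i, α i)}
    {I J : Finset ι} (hA : MeasurableSet A) (hB : MeasurableSet B) (hAI : DepOn A I) (hBJ : DepOn B J)
    (hIJ : Disjoint I J) : Measure.pi μ (A ∩ B) = Measure.pi μ A * Measure.pi μ B := by
  by_cases hne : Nonempty (∀ i, α i)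
  swap
  · have : A = ∅ := Set.eq_empty_of_forall_notMem fun x _ => hne ⟨x⟩
    simp [this]
  obtain ⟨x0⟩ := hne
  have hI : iIndepFun (fun i (x : ∀ i, α i) => x i) (Measure.pi μ) :=
    iIndepFun_pi (X := fun i (x : α i) => x) fun i => aemeasurable_id
  have h2 := hI.indepFun_finset I J hIJ fun i => measurable_pi_apply i
  have e : ∀ (S : Set (∀ i, α i)) (K : Finset ι), DepOn S K →
      (fun (x : ∀ i, α i) (i : K) => x i) ⁻¹' {y | Function.updateFinset x0 K y ∈ S} = S := by
    intro S K hS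
    ext x
    simp only [mem_preimage, mem_ofPred_eq]
    constructor
    · refine hS _ _ fun i hi => ?_
      simp [Function.updateFinset, hi]
    · refine hS _ _ fun i hi => ?_
      simp [Function.updateFinset, hi]
  have m : ∀ (S : Set (∀ i, α i)) (K : Finset ι), MeasurableSet S →
      MeasurableSet {y : ∀ i : K, α i | Function.updateFinset x0 K y ∈ S} := fun S K hS =>
    (measurable_updateFinset (s := K) (x := x0)) hS
  have := h2.measure_inter_preimage_eq_mul _ _ (m A I hA) (m B J hB)
  rwa [e A I hAI, e B J hBJ] at this

lemma indep_many (μ : ∀ i, Measure (α i)) [∀ i, IsProbabilityMeasure (μ i)] {τ : Type*} [DecidableEq τ] (s : Finset τ)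
    (A : τ → Set (∀ i, α i)) (I : τ → Finset ι) (hA : ∀ t ∈ s, MeasurableSet (A t))
    (hAI : ∀ t ∈ s, DepOn (A t) (I t)) (hI : ∀ t ∈ s, ∀ t' ∈ s, t ≠ t' → Disjoint (I t) (I t')) :
    Measure.pi μ {x | ∀ t ∈ s, x ∈ A t} = ∏ t ∈ s, Measure.pi μ (A t) := by
  induction s using Finset.induction_on with
  | empty => simp
  | insert t s ht ih =>
    rw [Finset.prod_insert ht, ← ih (fun t h => hA t (Finset.mem_insert_of_mem h))
      (fun t h => hAI t (Finset.mem_insert_of_mem h))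
      (fun t h t' h' => hI t (Finset.mem_insert_of_mem h) t' (Finset.mem_insert_of_mem h')),
      ← indep_two μ (hA t (Finset.mem_insert_self _ _)) (I := I t) (J := s.biUnion I)]
    · congr 1; ext x; simp [Finset.forall_mem_insert]
    · have : {x | ∀ t ∈ s, x ∈ A t} = ⋂ t ∈ s, A t := by ext; simp
      rw [this]
      exact Finset.measurableSet_biInter _ fun t h => hA t (Finset.mem_insert_of_mem h)
    · exact hAI t (Finset.mem_insert_self _ _)
    · intro x y hxy hx t' ht'
      exact hAI t' (Finset.mem_insert_of_mem ht') x y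
        (fun i hi => hxy i (Finset.mem_biUnion.2 ⟨t', ht', hi⟩)) (hx t' ht')
    · rw [Finset.disjoint_biUnion_right]
      intro t' ht'
      exact hI t (Finset.mem_insert_self _ _) t' (Finset.mem_insert_of_mem ht') (by rintro rfl; exact ht ht')

end indep

section trial
variable {ι : Type*} [Fintype ι] [DecidableEq ι]

lemma meas_bool (A : Set (ι → Bool)) : MeasurableSet A := A.toFinite.measurableSet

lemma trial_open (μ : ι → Measure Bool) [∀ i, IsProbabilityMeasure (μ i)] (p : ENNReal) (m : ℕ) (hp1 : p ≤ 1)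
    (E : Finset ι) (hE : E.card ≤ m) (hp : ∀ i ∈ E, p ≤ μ i {true}) :
    Measure.pi μ {x | ∃ i ∈ E, x i = false} ≤ 1 - p ^ m := by
  have h1 : {x : ι → Bool | ∃ i ∈ E, x i = false} = (Set.univ.pi fun i => if i ∈ E then {true} else Set.univ)ᶜ := by
    ext x
    simp only [mem_ofPred_eq, mem_compl_iff, Set.mem_univ_pi, not_forall]
    refine exists_congr fun i => ?_
    by_cases hi : i ∈ E <;> simp [hi]
  rw [h1, prob_compl_eq_one_sub (meas_bool _), Measure.pi_pi]
  refine tsub_le_tsub_left ?_ 1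
  calc p ^ m ≤ p ^ E.card := pow_le_pow_right_of_le_one' hp1 hE
    _ = ∏ i ∈ E, p := by simp
    _ = ∏ i, (if i ∈ E then p else 1) := by simp
    _ ≤ _ := Finset.prod_le_prod' fun i _ => by
        by_cases hi : i ∈ E
        · simpa [hi] using hp i hi
        · simp only [hi, if_false, measure_univ]; exact le_rfl

/-- independent trials after exposing the coordinates in `S` -/
lemma trial (μ : ι → Measure Bool) [∀ i, IsProbabilityMeasure (μ i)] (p : ENNReal) (m T : ℕ) (hp1 : p ≤ 1)
    (S : Finset ι) (F : Set (ι → Bool))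
    (h : ∀ x : ι → Bool, ∃ E : ℕ → Finset ι, (∀ t < T, (E t).card ≤ m ∧ ∀ i ∈ E t, p ≤ μ i {true}) ∧
      (∀ t < T, Disjoint (E t) S) ∧
      (∀ t < T, ∀ t' < T, t ≠ t' → Disjoint (E t) (E t')) ∧
      ∀ y : ι → Bool, (∀ i ∈ S, y i = x i) → y ∈ F → ∀ t < T, ∃ i ∈ E t, y i = false) :
    Measure.pi μ F ≤ (1 - p ^ m) ^ T := by
  have hm : ∀ f : (ι → Bool) → ENNReal, Measurable f := fun f _ _ => meas_bool _
  rw [← lintegral_indicator_one (meas_bool F), lintegral_eq_lmarginal_univ (fun _ => false),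
    ← Finset.union_compl S, lmarginal_union _ _ (hm _) disjoint_compl_right]
  have key : ∀ x, (∫⋯∫⁻_Sᶜ, F.indicator 1 ∂μ) x ≤ (1 - p ^ m) ^ T := by
    intro x
    obtain ⟨E, h1, h2, h3, h4⟩ := h x
    have hG : Measure.pi μ {y | ∀ t ∈ Finset.range T, y ∈ {y : ι → Bool | ∃ i ∈ E t, y i = false}} ≤ (1 - p ^ m) ^ T := by
      rw [indep_many μ (Finset.range T) (fun t => {y : ι → Bool | ∃ i ∈ E t, y i = false}) E
        (fun t _ => meas_bool _) (fun t _ x y hxy ⟨i, hi, hx⟩ => ⟨i, hi, by rw [← hxy i hi]; exact hx⟩)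
        (fun t ht t' ht' => h3 t (Finset.mem_range.1 ht) t' (Finset.mem_range.1 ht'))]
      calc _ ≤ ∏ t ∈ Finset.range T, (1 - p ^ m) := Finset.prod_le_prod' fun t ht =>
            trial_open μ p m hp1 _ (h1 t (Finset.mem_range.1 ht)).1 (h1 t (Finset.mem_range.1 ht)).2
        _ = _ := by simp
    refine le_trans ?_ hG
    set G := {y | ∀ t ∈ Finset.range T, y ∈ {y : ι → Bool | ∃ i ∈ E t, y i = false}} with hGdef
    have hGdep : ∀ a b : ι → Bool, (∀ i ∈ Sᶜ, a i = b i) → a ∈ G → b ∈ G := by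
      intro a b hab ha t ht
      obtain ⟨i, hi, hx⟩ := ha t ht
      refine ⟨i, hi, ?_⟩
      rw [← hab i]
      · exact hx
      · rw [Finset.mem_compl]
        exact Finset.disjoint_left.1 (h2 t (Finset.mem_range.1 ht)) hi
    have e1 : Measure.pi μ G = (∫⋯∫⁻_Sᶜ, G.indicator 1 ∂μ) x := by
      rw [← lintegral_indicator_one (meas_bool G), lintegral_eq_lmarginal_univ x,
        ← Finset.union_compl S, lmarginal_union _ _ (hm _) disjoint_compl_right]
      have : ∀ z, (∫⋯∫⁻_Sᶜ, G.indicator 1 ∂μ) z = (∫⋯∫⁻_Sᶜ, G.indicator 1 ∂μ) x := by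
        intro z
        simp only [lmarginal]
        refine lintegral_congr fun y => ?_
        have : Function.updateFinset z Sᶜ y ∈ G ↔ Function.updateFinset x Sᶜ y ∈ G := by
          constructor <;> refine hGdep _ _ fun i hi => ?_ <;> simp [Function.updateFinset, Finset.mem_compl.1 hi]
        by_cases hz : Function.updateFinset x Sᶜ y ∈ G
        · rw [indicator_of_mem hz, indicator_of_mem (this.2 hz)]; rfl
        · rw [indicator_of_notMem hz, indicator_of_notMem (fun h => hz (this.1 h))]
      have h5 : (∫⋯∫⁻_Sᶜ, G.indicator 1 ∂μ) = fun _ => (∫⋯∫⁻_Sᶜ, G.indicator 1 ∂μ) x := funext this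
      rw [h5]
      simp [lmarginal]
    rw [e1]
    simp only [lmarginal]
    refine lintegral_mono fun y => ?_
    by_cases hz : Function.updateFinset x Sᶜ y ∈ F
    · have : Function.updateFinset x Sᶜ y ∈ G := by
        intro t ht
        exact h4 _ (fun i hi => by simp [Function.updateFinset, hi]) hz t (Finset.mem_range.1 ht)
      rw [indicator_of_mem hz, indicator_of_mem this]
    · rw [indicator_of_notMem hz]; exact bot_le
  calc _ ≤ (∫⋯∫⁻_S, (fun _ => (1 - p ^ m) ^ T) ∂μ) (fun _ => false) := lmarginal_mono key _
    _ = _ := by simp [lmarginal]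

end trial

section bt
variable {d : ℕ}

def Anch (X : Set (V d)) (Q : ℕ) : Set (V d) := {a | ∃ b, dinf 0 b = Q ∧ Cn X a b}

/-- open sites of a configuration -/
def opn {Q : ℕ} (w : ↥(fbx (0 : V d) Q) → Bool) : Set (V d) := {z | ∃ h : z ∈ fbx (0 : V d) Q, w ⟨z, h⟩ = true}

def Fi (X : Set (V d)) {Q : ℕ} (w : ↥(fbx (0 : V d) Q) → Bool) (r : ℕ) : Set (V d) :=
  X ∪ (opn w ∩ {z | r < dinf 0 z})

def BTBad (X : Set (V d)) (Q : ℕ) (r r' : ℕ) (y : V d) : Set (↥(fbx (0 : V d) Q) → Bool) :=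
  {w | (∃ z ∈ Anch X Q, dinf 0 z ≤ r' ∧ ¬ Cn (Fi X w r) y z) ∧
    ∀ z ∈ Anch X Q, dinf 0 z ≤ r → ¬ Cn (Fi X w r) y z → ¬ Cn (Fi X w r') y z}

lemma Fi_mono (X : Set (V d)) {Q : ℕ} (w : ↥(fbx (0 : V d) Q) → Bool) {r r' : ℕ} (h : r' ≤ r) : Fi X w r ⊆ Fi X w r' := by
  refine Set.union_subset_union_right _ (Set.inter_subset_inter_right _ fun z hz => ?_)
  simp only [mem_ofPred_eq] at *; omega

lemma near_both (hd : 2 ≤ d) {y : V d} {r U : ℕ} {A A' : Set (V d)}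
    (hc : ∀ x, dinf y x = r → (∃ a ∈ A, dinf x a ≤ U) ∨ (∃ a ∈ A', dinf x a ≤ U))
    {a a' : V d} (ha : a ∈ A) (ha' : a' ∈ A') (har : dinf y a = r) (har' : dinf y a' = r) :
    ∃ x, dinf y x = r ∧ ∃ a ∈ A, ∃ a' ∈ A', dinf x a ≤ U + 1 ∧ dinf x a' ≤ U + 1 := by
  obtain ⟨c, hcS, c', h1, ⟨b, hb, hb2⟩, ⟨b', hb', hb2'⟩⟩ := (sphere_conn hd y r har har').switch
    (fun x => ∃ a ∈ A, dinf x a ≤ U) (fun x => ∃ a ∈ A', dinf x a ≤ U) hc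
    ⟨a, ha, by simp [dinf_self]⟩ ⟨a', ha', by simp [dinf_self]⟩
  refine ⟨c, hcS, b, hb, b', hb', by omega, ?_⟩
  have := dinf_tri c c' b'
  omega

structure BTHyp (X G : Set (V d)) (Q U W sep k m r0 : ℕ) : Prop where
  dens : ∀ x, dinf 0 x ≤ r0 → ∃ a ∈ Anch X Q, dinf x a ≤ U
  win : ∀ y, dinf 0 y ≤ r0 → ∀ xs : ℕ → V d, (∀ j, 1 ≤ j → j ≤ k → dinf y (xs j) = j * sep) →
    ∃ j, 1 ≤ j ∧ j ≤ k ∧ ∀ a b, dinf (xs j) a ≤ U + 1 → dinf (xs j) b ≤ U + 1 →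
      ∃ E : Finset (V d), E.card ≤ m ∧ (∀ z ∈ E, z ∈ G ∧ dinf (xs j) z ≤ W) ∧ Cn (X ∪ E) a b

lemma bt_find (hd : 2 ≤ d) {X G : Set (V d)} {Q U W sep k m r0 : ℕ} (H : BTHyp X G Q U W sep k m r0)
    (hU : U + 1 ≤ sep) (hQ : r0 + k * sep ≤ Q) (F : Set (V d)) (hF : X ⊆ F) (y0 z0 : V d)
    (hy0 : y0 ∈ Anch X Q) (hz0 : z0 ∈ Anch X Q) (hyz : ¬ Cn F y0 z0) (r : ℕ) (hr : r + k * sep ≤ r0)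
    (hyr : dinf 0 y0 ≤ r) (hzr : dinf 0 z0 ≤ r) :
    ∃ E : Finset (V d), E.card ≤ m ∧ (∀ z ∈ E, z ∈ G ∧ r ≤ dinf 0 z + (k * sep + W) ∧ dinf 0 z ≤ r + (k * sep + W)) ∧
      ∃ z ∈ Anch X Q, dinf 0 z ≤ r + k * sep + (U + 1) ∧ ¬ Cn F y0 z ∧ Cn (F ∪ E) y0 z := by
  set A : Set (V d) := {a | a ∈ Anch X Q ∧ Cn F y0 a} with hA
  set A' : Set (V d) := {a | a ∈ Anch X Q ∧ ¬ Cn F y0 a} with hA'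
  have cov : ∀ x, dinf 0 x ≤ r0 → (∃ a ∈ A, dinf x a ≤ U) ∨ (∃ a ∈ A', dinf x a ≤ U) := by
    intro x hx
    obtain ⟨a, ha, hau⟩ := H.dens x hx
    by_cases h : Cn F y0 a
    · exact .inl ⟨a, ⟨ha, h⟩, hau⟩
    · exact .inr ⟨a, ⟨ha, h⟩, hau⟩
  have crossA : ∀ a ∈ A, ∀ (x : V d) (s : ℕ), dinf x a ≤ s → dinf 0 x + s ≤ Q → ∃ c ∈ A, dinf x c = s := by
    rintro a ⟨⟨b, hb, hab⟩, ha2⟩ x s h1 h2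
    have := dinf_tri 0 x b
    obtain ⟨c, hc, hac⟩ := hab.cross h1 (by omega)
    have hac := hac.mono (Set.inter_subset_left)
    exact ⟨c, ⟨⟨b, hb, hac.symm.trans hab⟩, ha2.trans (hac.mono hF)⟩, hc⟩
  have crossA' : ∀ a ∈ A', ∀ (x : V d) (s : ℕ), dinf x a ≤ s → dinf 0 x + s ≤ Q → ∃ c ∈ A', dinf x c = s := by
    rintro a ⟨⟨b, hb, hab⟩, ha2⟩ x s h1 h2
    have := dinf_tri 0 x b
    obtain ⟨c, hc, hac⟩ := hab.cross h1 (by omega)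
    have hac := hac.mono (Set.inter_subset_left)
    exact ⟨c, ⟨⟨b, hb, hac.symm.trans hab⟩, fun h => ha2 (h.trans (hac.mono hF).symm)⟩, hc⟩
  have hyA : y0 ∈ A := ⟨hy0, .refl (hF (by obtain ⟨b, _, h⟩ := hy0; exact h.left))⟩
  have hzA : z0 ∈ A' := ⟨hz0, hyz⟩
  obtain ⟨c, hc, hcr⟩ := crossA y0 hyA 0 r hyr (by rw [dinf_self]; omega)
  obtain ⟨c', hc', hcr'⟩ := crossA' z0 hzA 0 r hzr (by rw [dinf_self]; omega)
  obtain ⟨y, hy, a, ha, a', ha', hya, hya'⟩ := near_both hd (fun x hx => cov x (by omega)) hc hc' hcr hcr'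
  have step : ∀ j, ∃ x, 1 ≤ j → j ≤ k → dinf y x = j * sep ∧ ∃ a ∈ A, ∃ a' ∈ A', dinf x a ≤ U + 1 ∧ dinf x a' ≤ U + 1 := by
    intro j
    by_cases hj : 1 ≤ j ∧ j ≤ k
    · have h1 : sep ≤ j * sep := Nat.le_mul_of_pos_left _ hj.1
      have h2 : j * sep ≤ k * sep := Nat.mul_le_mul_right _ hj.2
      obtain ⟨c, hc, hcr⟩ := crossA a ha y (j * sep) (by omega) (by omega)
      obtain ⟨c', hc', hcr'⟩ := crossA' a' ha' y (j * sep) (by omega) (by omega)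
      obtain ⟨x, hx, h⟩ := near_both hd (y := y) (r := j * sep) (fun x hx => cov x (by
        have := dinf_tri 0 y x; omega)) hc hc' hcr hcr'
      exact ⟨x, fun _ _ => ⟨hx, h⟩⟩
    · exact ⟨0, fun h1 h2 => absurd ⟨h1, h2⟩ hj⟩
  choose xs hxs using step
  obtain ⟨j, hj1, hj2, hw⟩ := H.win y (by omega) xs fun j h1 h2 => (hxs j h1 h2).1
  obtain ⟨hxj, b, hb, b', hb', hjb, hjb'⟩ := hxs j hj1 hj2
  obtain ⟨E, e1, e2, e3⟩ := hw b b' hjb hjb'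
  have h2 : j * sep ≤ k * sep := Nat.mul_le_mul_right _ hj2
  refine ⟨E, e1, fun z hz => ⟨(e2 z hz).1, ?_, ?_⟩, b', hb'.1, ?_, hb'.2, ?_⟩
  · have := (e2 z hz).2
    have t1 := dinf_tri 0 z y
    have t2 := dinf_tri z (xs j) y
    rw [dinf_comm z (xs j), dinf_comm (xs j) y] at t2
    omega
  · have := (e2 z hz).2
    have t1 := dinf_tri 0 y z
    have t2 := dinf_tri y (xs j) z
    omega
  · have t1 := dinf_tri 0 y b'
    have t2 := dinf_tri y (xs j) b'
    omega
  · exact (hb.2.mono Set.subset_union_left).trans (e3.mono (Set.union_subset_union_left _ hF))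

lemma bt_bad (hd : 2 ≤ d) {X G : Set (V d)} {Q U W sep k m r0 T r r' : ℕ} (H : BTHyp X G Q U W sep k m r0)
    (hU : U + 1 ≤ sep) (hUW : U + 1 ≤ W) (hQ : r0 + k * sep ≤ Q) (hr : r ≤ r0) (hrr : r' + T * (2 * (k * sep + W) + 1) ≤ r)
    (μ : ↥(fbx (0 : V d) Q) → Measure Bool) [∀ i, IsProbabilityMeasure (μ i)] (p : ENNReal) (hp1 : p ≤ 1)
    (hp : ∀ z : ↥(fbx (0 : V d) Q), (z : V d) ∈ G → p ≤ μ z {true}) (y0 : V d) (hy0 : y0 ∈ Anch X Q) (hyr : dinf 0 y0 ≤ r') :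
    Measure.pi μ (BTBad X Q r r' y0) ≤ (1 - p ^ m) ^ T := by
  classical
  set h := k * sep + W with hh
  set sp := 2 * h + 1 with hsp
  refine trial μ p m T hp1 (Finset.univ.filter fun z : ↥(fbx (0 : V d) Q) => r < dinf 0 (z : V d)) _ fun w => ?_
  have hFw : ∀ w' : ↥(fbx (0 : V d) Q) → Bool, (∀ i ∈ (Finset.univ.filter fun z : ↥(fbx (0 : V d) Q) => r < dinf 0 (z : V d)), w' i = w i) →
      Fi X w' r = Fi X w r := by
    intro w' hw
    unfold Fi opn
    congr 1; ext z
    simp only [mem_inter_iff, mem_ofPred_eq]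
    refine and_congr_left fun hz => exists_congr fun hzD => ?_
    rw [hw _ (by simp [hz])]
  by_cases hex : ∃ z ∈ Anch X Q, dinf 0 z ≤ r' ∧ ¬ Cn (Fi X w r) y0 z
  swap
  · refine ⟨fun _ => ∅, by simp, by simp, by simp, fun w' hw hF t ht => absurd hF.1 ?_⟩
    rw [hFw w' hw]; exact hex
  obtain ⟨z0, hz0, hzr, hyz⟩ := hex
  have hs : ∀ t, t < T → (t + 1) * sp + r' ≤ r := fun t ht => by
    have : (t + 1) * sp ≤ T * sp := Nat.mul_le_mul_right _ ht
    omega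
  have step : ∀ t, ∃ E : Finset (V d), t < T → E.card ≤ m ∧ (∀ z ∈ E, z ∈ G ∧ r' + t * sp + 1 ≤ dinf 0 z ∧ dinf 0 z ≤ r' + (t + 1) * sp) ∧
      ∃ z ∈ Anch X Q, dinf 0 z ≤ r ∧ ¬ Cn (Fi X w r) y0 z ∧ Cn (Fi X w r ∪ E) y0 z := by
    intro t
    by_cases ht : t < T
    swap
    · exact ⟨∅, fun h => absurd h ht⟩
    have h1 := hs t ht
    have h2 : (t + 1) * sp = t * sp + (2 * h + 1) := by rw [hsp]; ring
    obtain ⟨E, e1, e2, z, hz, hz1, hz2, hz3⟩ := bt_find hd H hU hQ (Fi X w r) Set.subset_union_left y0 z0 hy0 hz0 hyz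
      (r' + t * sp + h + 1) (by omega) (by omega) (by omega)
    exact ⟨E, fun _ => ⟨e1, fun z hz => ⟨(e2 z hz).1, by have := (e2 z hz).2.1; omega, by have := (e2 z hz).2.2; omega⟩,
      z, hz, by omega, hz2, hz3⟩⟩
  choose E hE using step
  refine ⟨fun t => Finset.univ.filter fun z : ↥(fbx (0 : V d) Q) => (z : V d) ∈ E t, ?_, ?_, ?_, ?_⟩
  · intro t ht
    refine ⟨?_, fun z hz => hp z ((hE t ht).2.1 _ (Finset.mem_filter.1 hz).2).1⟩
    refine le_trans ?_ (hE t ht).1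
    refine Finset.card_le_card_of_injOn Subtype.val (fun z hz => (Finset.mem_filter.1 hz).2) Subtype.val_injective.injOn
  · intro t ht
    rw [Finset.disjoint_left]
    intro z hz hz'
    have h1 := ((hE t ht).2.1 _ (Finset.mem_filter.1 hz).2).2.2
    have h2 := (Finset.mem_filter.1 hz').2
    have := hs t ht
    omega
  · have key : ∀ t < T, ∀ t' < T, t < t' → ∀ z : V d, z ∈ E t → z ∈ E t' → False := by
      intro t ht t' ht' htt z hz hz'
      have h1 := ((hE t ht).2.1 _ hz).2.2
      have h2 := ((hE t' ht').2.1 _ hz').2.1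
      have : (t + 1) * sp ≤ t' * sp := Nat.mul_le_mul_right _ htt
      omega
    intro t ht t' ht' hne
    rw [Finset.disjoint_left]
    intro z hz hz'
    rcases lt_or_gt_of_ne hne with h | h
    · exact key t ht t' ht' h z (Finset.mem_filter.1 hz).2 (Finset.mem_filter.1 hz').2
    · exact key t' ht' t ht h z (Finset.mem_filter.1 hz').2 (Finset.mem_filter.1 hz).2
  · intro w' hw hF t ht
    by_contra hc
    push Not at hc
    obtain ⟨e1, e2, z, hz, hz1, hz2, hz3⟩ := hE t ht
    have hF' := hFw w' hw
    refine hF.2 z hz hz1 (by rwa [hF']) (hz3.mono ?_)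
    rw [← hF']
    refine Set.union_subset (Fi_mono X w' (by omega)) fun x hx => ?_
    have h3 := e2 x hx
    have h4 := hs t ht
    have hxD : x ∈ fbx (0 : V d) Q := by rw [mem_fbx]; omega
    refine .inr ⟨⟨hxD, ?_⟩, ?_⟩
    · have := hc ⟨x, hxD⟩ (by simpa using hx)
      simpa using this
    · simp only [mem_ofPred_eq]; omega

lemma bt_growth {X : Set (V d)} {Q J : ℕ} (ρ : ℕ → ℕ) (hρ : ∀ i, ρ (i + 1) ≤ ρ i) (hρQ : ρ 0 ≤ Q)
    (hJ : (2 * Q + 1) ^ d < 2 ^ J) (w : ↥(fbx (0 : V d) Q) → Bool)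
    (hw : ∀ i < J, ∀ y ∈ Anch X Q, dinf 0 y ≤ ρ (i + 1) → w ∉ BTBad X Q (ρ i) (ρ (i + 1)) y)
    (y z : V d) (hy : y ∈ Anch X Q) (hz : z ∈ Anch X Q) (hyr : dinf 0 y ≤ ρ J) (hzr : dinf 0 z ≤ ρ J) :
    Cn (Fi X w (ρ J)) y z := by
  classical
  have hmono : Antitone ρ := antitone_nat_of_succ_le hρ
  have hX : ∀ y ∈ Anch X Q, ∀ r, y ∈ Fi X w r := by
    rintro y ⟨b, _, h⟩ r; exact .inl h.left
  have main : ∀ i ≤ J, ∀ y ∈ Anch X Q, dinf 0 y ≤ ρ i →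
      (∀ z ∈ Anch X Q, dinf 0 z ≤ ρ i → Cn (Fi X w (ρ i)) y z) ∨
      2 ^ i ≤ ((fbx (0 : V d) Q).filter fun z => Cn (Fi X w (ρ i)) y z).card := by
    intro i
    induction i with
    | zero =>
      intro _ y hy hyr
      right
      rw [pow_zero, Nat.one_le_iff_ne_zero, ← Nat.pos_iff_ne_zero, Finset.card_pos]
      exact ⟨y, Finset.mem_filter.2 ⟨mem_fbx.2 (hyr.trans hρQ), .refl (hX y hy _)⟩⟩
    | succ i ih =>
      intro hi y hy hyr
      have hm := Fi_mono X w (hρ i)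
      by_cases hall : ∀ z ∈ Anch X Q, dinf 0 z ≤ ρ (i + 1) → Cn (Fi X w (ρ i)) y z
      · exact .inl fun z hz hzr => (hall z hz hzr).mono hm
      right
      push Not at hall
      have hb := hw i hi y hy hyr
      have hb2 : ∃ z ∈ Anch X Q, dinf 0 z ≤ ρ i ∧ ¬ Cn (Fi X w (ρ i)) y z ∧ Cn (Fi X w (ρ (i + 1))) y z := by
        by_contra hc
        push Not at hc
        exact hb ⟨hall, hc⟩
      obtain ⟨z, hz, hzr, hyz, hyz'⟩ := hb2
      have h1 := (ih (by omega) y hy (hyr.trans (hρ i))).resolve_left fun h => hyz (h z hz hzr)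
      have h2 := (ih (by omega) z hz hzr).resolve_left fun h => hyz (h y hy (hyr.trans (hρ i))).symm
      rw [pow_succ, mul_two]
      refine (add_le_add h1 h2).trans ?_
      rw [← Finset.card_union_of_disjoint]
      · refine Finset.card_le_card fun x hx => ?_
        rcases Finset.mem_union.1 hx with hx | hx
        · have := Finset.mem_filter.1 hx
          exact Finset.mem_filter.2 ⟨this.1, this.2.mono hm⟩
        · have := Finset.mem_filter.1 hx
          exact Finset.mem_filter.2 ⟨this.1, hyz'.trans (this.2.mono hm)⟩
      · rw [Finset.disjoint_left]
        intro x hx hx'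
        exact hyz ((Finset.mem_filter.1 hx).2.trans (Finset.mem_filter.1 hx').2.symm)
  refine (main J le_rfl y hy hyr).resolve_right (fun h => ?_) z hz hzr
  have := (Finset.card_filter_le (fbx (0 : V d) Q) fun z => Cn (Fi X w (ρ J)) y z)
  rw [card_fbx] at this
  omega

/-- the abstract gluing lemma -/
lemma bt_main (hd : 2 ≤ d) {X G : Set (V d)} {Q U W sep k m r0 T J rJ : ℕ} (H : BTHyp X G Q U W sep k m r0)
    (hU : U + 1 ≤ sep) (hUW : U + 1 ≤ W) (hQ : r0 + k * sep ≤ Q)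
    (hr : rJ + J * (T * (2 * (k * sep + W) + 1)) ≤ r0) (hJ : (2 * Q + 1) ^ d < 2 ^ J)
    (μ : ↥(fbx (0 : V d) Q) → Measure Bool) [∀ i, IsProbabilityMeasure (μ i)] (p : ENNReal) (hp1 : p ≤ 1)
    (hp : ∀ z : ↥(fbx (0 : V d) Q), (z : V d) ∈ G → p ≤ μ z {true}) :
    Measure.pi μ {w | ∃ y ∈ Anch X Q, ∃ z ∈ Anch X Q, dinf 0 y ≤ rJ ∧ dinf 0 z ≤ rJ ∧ ¬ Cn (X ∪ opn w) y z} ≤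
      J * (2 * Q + 1) ^ d * (1 - p ^ m) ^ T := by
  classical
  set s := T * (2 * (k * sep + W) + 1) with hs
  set ρ : ℕ → ℕ := fun i => rJ + (J - i) * s with hρ
  have hρ1 : ∀ i, ρ (i + 1) ≤ ρ i := fun i => by
    simp only [hρ]; gcongr; omega
  have hρ2 : ∀ i < J, ρ (i + 1) + s = ρ i := fun i hi => by
    simp only [hρ]
    have : J - i = (J - (i + 1)) + 1 := by omega
    rw [this]; ring
  have hρJ : ρ J = rJ := by simp [hρ]
  have hρ0 : ∀ i, ρ i ≤ r0 := fun i => by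
    refine le_trans ?_ hr
    simp only [hρ]; gcongr; omega
  have sub : {w | ∃ y ∈ Anch X Q, ∃ z ∈ Anch X Q, dinf 0 y ≤ rJ ∧ dinf 0 z ≤ rJ ∧ ¬ Cn (X ∪ opn w) y z} ⊆
      ⋃ i ∈ Finset.range J, ⋃ y ∈ fbx (0 : V d) Q, {w | y ∈ Anch X Q ∧ dinf 0 y ≤ ρ (i + 1) ∧ w ∈ BTBad X Q (ρ i) (ρ (i + 1)) y} := by
    rintro w ⟨y, hy, z, hz, hyr, hzr, hyz⟩
    by_contra hc
    simp only [Set.mem_iUnion, mem_ofPred_eq, not_exists, not_and, Finset.mem_range] at hc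
    refine hyz ((bt_growth ρ hρ1 ((hρ0 0).trans (by omega)) hJ w ?_ y z hy hz (by rwa [hρJ]) (by rwa [hρJ])).mono ?_)
    · intro i hi y hy hyr
      exact hc i hi y (mem_fbx.2 (hyr.trans ((hρ0 _).trans (by omega)))) hy hyr
    · exact Set.union_subset_union_right _ Set.inter_subset_left
  refine (measure_mono sub).trans ((measure_biUnion_finset_le _ _).trans ?_)
  calc _ ≤ ∑ i ∈ Finset.range J, ∑ y ∈ fbx (0 : V d) Q, (1 - p ^ m) ^ T := by
        refine Finset.sum_le_sum fun i hi => (measure_biUnion_finset_le _ _).trans (Finset.sum_le_sum fun y _ => ?_)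
        by_cases hy : y ∈ Anch X Q ∧ dinf 0 y ≤ ρ (i + 1)
        · refine (measure_mono (t := BTBad X Q (ρ i) (ρ (i + 1)) y) fun w hw => hw.2.2).trans
            (bt_bad hd H hU hUW hQ (hρ0 i) (hρ2 i (Finset.mem_range.1 hi)).le μ p hp1 hp y hy.1 hy.2)
        · have : {w : ↥(fbx (0 : V d) Q) → Bool | y ∈ Anch X Q ∧ dinf 0 y ≤ ρ (i + 1) ∧ w ∈ BTBad X Q (ρ i) (ρ (i + 1)) y} = ∅ :=
            Set.eq_empty_of_forall_notMem fun w hw => hy ⟨hw.1, hw.2.1⟩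
          rw [this]; simp
    _ = _ := by
        simp only [Finset.sum_const, card_fbx, Finset.card_range, nsmul_eq_mul]
        push_cast; ring

end bt

section cond

lemma gauss_ratio (e : ℝ) (he : 0 < e) : ∃ c : ℝ, 0 < c ∧ c ≤ 1 ∧ ∀ T a : ℝ, 0 ≤ T → a ≤ T →
    ENNReal.ofReal (c * Real.exp (-T ^ 2)) * gaussianReal 0 1 (Iio a) ≤ gaussianReal 0 1 (Ico (a - e) a) := by
  have hq : Real.exp (-e ^ 2 / 2) < 1 := by rw [Real.exp_lt_one_iff]; nlinarith
  have hpi : 0 < (√(2 * Real.pi))⁻¹ := by positivity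
  refine ⟨min (1 - Real.exp (-e ^ 2 / 2)) (e * ((√(2 * Real.pi))⁻¹ * Real.exp (-e ^ 2))), ?_, ?_, ?_⟩
  · refine lt_min (by linarith) (by positivity)
  · exact (min_le_left _ _).trans (by linarith [Real.exp_pos (-e ^ 2 / 2)])
  intro T a hT haT
  set c := min (1 - Real.exp (-e ^ 2 / 2)) (e * ((√(2 * Real.pi))⁻¹ * Real.exp (-e ^ 2)))
  by_cases ha : a ≤ 0
  · have h1 : gaussianReal 0 1 (Iio (a - e)) ≤ ENNReal.ofReal (Real.exp (-e ^ 2 / 2)) * gaussianReal 0 1 (Iio a) := by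
      rw [gaussianReal_apply _ one_ne_zero, gaussianReal_apply _ one_ne_zero,
        ← lintegral_indicator measurableSet_Iio, ← lintegral_indicator measurableSet_Iio,
        ← lintegral_sub_right_eq_self _ e, ← lintegral_const_mul']
      · refine lintegral_mono fun x => ?_
        by_cases hx : x < a
        · rw [indicator_of_mem (show x - e ∈ Iio (a - e) by simpa using hx), indicator_of_mem (show x ∈ Iio a from hx)]
          unfold gaussianPDF
          rw [← ENNReal.ofReal_mul (Real.exp_pos _).le]
          refine ENNReal.ofReal_le_ofReal ?_
          simp only [gaussianPDFReal_def, NNReal.coe_one, mul_one, sub_zero]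
          rw [mul_left_comm]
          gcongr
          rw [← Real.exp_add, Real.exp_le_exp]
          nlinarith
        · rw [indicator_of_notMem (show x - e ∉ Iio (a - e) by simpa using hx)]; exact bot_le
      · exact ENNReal.ofReal_ne_top
    have h2 : gaussianReal 0 1 (Iio a) ≤ gaussianReal 0 1 (Iio (a - e)) + gaussianReal 0 1 (Ico (a - e) a) := by
      refine (measure_mono ?_).trans (measure_union_le _ _)
      rw [Iio_union_Ico_eq_Iio (by linarith)]
    have hfin : gaussianReal 0 1 (Iio a) ≠ ⊤ := measure_ne_top _ _
    have h3 : ENNReal.ofReal (1 - Real.exp (-e ^ 2 / 2)) * gaussianReal 0 1 (Iio a) ≤ gaussianReal 0 1 (Ico (a - e) a) := by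
      rw [ENNReal.ofReal_sub _ (Real.exp_pos _).le, ENNReal.ofReal_one, ENNReal.sub_mul (fun _ _ => hfin), one_mul]
      rw [tsub_le_iff_left]
      exact h2.trans (by gcongr)
    refine le_trans ?_ h3
    gcongr
    refine (mul_le_of_le_one_right ?_ ?_).trans (min_le_left _ _)
    · exact le_min (by linarith) (by positivity)
    · rw [Real.exp_le_one_iff]; nlinarith
  · push Not at ha
    have h1 : ENNReal.ofReal (c * Real.exp (-T ^ 2)) ≤ gaussianReal 0 1 (Ico (a - e) a) := by
      rw [gaussianReal_apply _ one_ne_zero]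
      have h2 : ∫⁻ x in Ico (a - e) a, ENNReal.ofReal ((√(2 * Real.pi))⁻¹ * Real.exp (-e ^ 2) * Real.exp (-T ^ 2)) ≤
          ∫⁻ x in Ico (a - e) a, gaussianPDF 0 1 x := by
        refine setLIntegral_mono' measurableSet_Ico fun x hx => ?_
        unfold gaussianPDF
        refine ENNReal.ofReal_le_ofReal ?_
        simp only [gaussianPDFReal_def, NNReal.coe_one, mul_one, sub_zero]
        rw [mul_assoc]
        gcongr
        rw [← Real.exp_add, Real.exp_le_exp]
        obtain ⟨hx1, hx2⟩ := hx
        have h3 : x ^ 2 ≤ (T + e) ^ 2 := sq_le_sq' (by linarith) (by linarith)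
        nlinarith [sq_nonneg (T - e)]
      refine le_trans ?_ h2
      rw [setLIntegral_const, Real.volume_Ico, ← ENNReal.ofReal_mul (by positivity)]
      refine ENNReal.ofReal_le_ofReal ?_
      have : c ≤ e * ((√(2 * Real.pi))⁻¹ * Real.exp (-e ^ 2)) := min_le_right _ _
      calc c * Real.exp (-T ^ 2) ≤ e * ((√(2 * Real.pi))⁻¹ * Real.exp (-e ^ 2)) * Real.exp (-T ^ 2) := by gcongr
        _ = _ := by ring
    refine le_trans ?_ h1
    exact mul_le_of_le_one_right (bot_le) prob_le_one

lemma cond_pi {ι : Type*} [Fintype ι] (μ : ι → Measure ℝ) [∀ i, IsProbabilityMeasure (μ i)] (C : ι → Set ℝ)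
    (hC : ∀ i, MeasurableSet (C i)) (h0 : ∀ i, μ i (C i) ≠ 0) (B : Set (ι → ℝ)) (hB : MeasurableSet B) :
    Measure.pi μ (B ∩ Set.univ.pi C) = (∏ i, μ i (C i)) * Measure.pi (fun i => (μ i)[|C i]) B := by
  haveI : ∀ i, IsProbabilityMeasure ((μ i)[|C i]) := fun i => cond_isProbabilityMeasure (h0 i)
  rw [← Measure.restrict_apply hB, Measure.restrict_pi_pi]
  have : Measure.pi (fun i => (μ i).restrict (C i)) = (∏ i, μ i (C i)) • Measure.pi (fun i => (μ i)[|C i]) := by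
    refine Measure.pi_eq fun s hs => ?_
    rw [Measure.smul_apply, Measure.pi_pi, smul_eq_mul, ← Finset.prod_mul_distrib]
    refine Finset.prod_congr rfl fun i _ => ?_
    rw [cond_apply (hC i), ← mul_assoc, ENNReal.mul_inv_cancel (h0 i) (measure_ne_top _ _), one_mul,
      Measure.restrict_apply (hs i), Set.inter_comm]
  rw [this, Measure.smul_apply, smul_eq_mul]

variable {d : ℕ}

def lv (Q : ℕ) (b : ℝ) (ψ : V d → ℝ) (ζ : ↥(fbx (0 : V d) Q) → ℝ) (h : ℝ) : Set (V d) :=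
  {z | ∃ hz : z ∈ fbx (0 : V d) Q, h ≤ b * ζ ⟨z, hz⟩ + ψ z}

def BTFail (Q rJ : ℕ) (X Y : Set (V d)) : Prop :=
  ∃ y ∈ Anch X Q, ∃ z ∈ Anch X Q, dinf 0 y ≤ rJ ∧ dinf 0 z ≤ rJ ∧ ¬ Cn Y y z

lemma bt_gauss (hd : 2 ≤ d) {G : Set (V d)} {Q U W sep k m r0 T J rJ : ℕ}
    (hU : U + 1 ≤ sep) (hUW : U + 1 ≤ W) (hQ : r0 + k * sep ≤ Q)
    (hr : rJ + J * (T * (2 * (k * sep + W) + 1)) ≤ r0) (hJ : (2 * Q + 1) ^ d < 2 ^ J)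
    (b h1 h2 : ℝ) (hb : 0 < b) (h12 : h2 ≤ h1) (ψ : V d → ℝ) (p : ENNReal) (hp1 : p ≤ 1)
    (hp : ∀ z ∈ G, p * gaussianReal 0 1 (Iio ((h1 - ψ z) / b)) ≤ gaussianReal 0 1 (Ico ((h2 - ψ z) / b) ((h1 - ψ z) / b))) :
    stdG ↥(fbx (0 : V d) Q) {ζ | BTHyp (lv Q b ψ ζ h1) G Q U W sep k m r0 ∧ BTFail Q rJ (lv Q b ψ ζ h1) (lv Q b ψ ζ h2)} ≤
      J * (2 * Q + 1) ^ d * (1 - p ^ m) ^ T := by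
  classical
  set D := fbx (0 : V d) Q with hD
  set δ : ENNReal := J * (2 * Q + 1) ^ d * (1 - p ^ m) ^ T with hδ
  set o1 : ↥D → ℝ → Bool := fun z t => decide ((h1 - ψ z) / b ≤ t) with ho1
  set o2 : ↥D → ℝ → Bool := fun z t => decide ((h2 - ψ z) / b ≤ t) with ho2
  have mo : ∀ c : ℝ, Measurable fun t : ℝ => decide (c ≤ t) := fun c => by
    refine measurable_to_bool ?_
    have : (fun t : ℝ => decide (c ≤ t)) ⁻¹' {true} = Ici c := by ext; simp
    rw [this]; exact measurableSet_Ici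
  have hdiv : ∀ (h : ℝ) (z : V d) (t : ℝ), h ≤ b * t + ψ z ↔ (h - ψ z) / b ≤ t := fun h z t => by
    rw [div_le_iff₀ hb]; constructor <;> intro h <;> linarith
  have l1 : ∀ ζ, lv Q b ψ ζ h1 = opn fun z => o1 z (ζ z) := fun ζ => by
    ext z; simp only [lv, opn, ho1, mem_ofPred_eq, decide_eq_true_eq, hdiv]
  have l2 : ∀ ζ, lv Q b ψ ζ h2 = opn fun z => o2 z (ζ z) := fun ζ => by
    ext z; simp only [lv, opn, ho2, mem_ofPred_eq, decide_eq_true_eq, hdiv]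
  set C : (↥D → Bool) → ↥D → Set ℝ := fun s z => {t | o1 z t = s z} with hC
  have mC : ∀ s z, MeasurableSet (C s z) := fun s z =>
    (mo ((h1 - ψ z) / b)) (measurableSet_singleton (s z))
  set Bs : (↥D → Bool) → Set (↥D → Bool) := fun s =>
    {w | BTFail Q rJ (opn s) (opn s ∪ opn w)} with hBs
  have mO2 : Measurable fun (ζ : ↥D → ℝ) z => o2 z (ζ z) :=
    measurable_pi_lambda _ fun z => (mo ((h2 - ψ z) / b)).comp (measurable_pi_apply z)
  have key : ∀ s : ↥D → Bool, BTHyp (opn s) G Q U W sep k m r0 →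
      stdG ↥D (((fun (ζ : ↥D → ℝ) z => o2 z (ζ z)) ⁻¹' Bs s) ∩ Set.univ.pi (C s)) ≤ δ * stdG ↥D (Set.univ.pi (C s)) := by
    intro s hs
    by_cases h0 : ∃ z, gaussianReal 0 1 (C s z) = 0
    · obtain ⟨z, hz⟩ := h0
      have : stdG ↥D (Set.univ.pi (C s)) = 0 := by
        unfold stdG; rw [Measure.pi_pi]; exact Finset.prod_eq_zero (Finset.mem_univ z) hz
      rw [measure_mono_null Set.inter_subset_right this]; exact bot_le
    push Not at h0
    haveI : ∀ z, IsProbabilityMeasure ((gaussianReal 0 1)[|C s z]) := fun z => cond_isProbabilityMeasure (h0 z)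
    haveI : ∀ z, IsProbabilityMeasure (((gaussianReal 0 1)[|C s z]).map (o2 z)) := fun z =>
      Measure.isProbabilityMeasure_map (mo _).aemeasurable
    unfold stdG
    rw [cond_pi _ _ (mC s) h0 _ (mO2 (meas_bool _)), Measure.pi_pi, mul_comm]
    gcongr
    rw [← Measure.map_apply mO2 (meas_bool _), Measure.pi_map_pi fun z => (mo _).aemeasurable]
    refine (bt_main hd hs hU hUW hQ hr hJ _ p hp1 fun z hz => ?_)
    rw [Measure.map_apply (mo _) (measurableSet_singleton _), cond_apply (mC s z)]
    rw [mul_comm, ← div_eq_mul_inv, ENNReal.le_div_iff_mul_le (.inl (h0 z)) (.inl (measure_ne_top _ _))]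
    cases hsz : s z with
    | true =>
      have : C s z ∩ o2 z ⁻¹' {true} = C s z := by
        refine Set.inter_eq_left.2 fun t ht => ?_
        simp only [hC, mem_ofPred_eq, ho1, hsz, decide_eq_true_eq] at ht
        simp only [ho2, mem_preimage, mem_singleton_iff, decide_eq_true_eq]
        refine le_trans ?_ ht
        gcongr
      rw [this]
      exact mul_le_of_le_one_left bot_le hp1
    | false =>
      have e1 : C s z = Iio ((h1 - ψ z) / b) := by
        ext t; simp [hC, ho1, hsz]
      have e2 : C s z ∩ o2 z ⁻¹' {true} = Ico ((h2 - ψ z) / b) ((h1 - ψ z) / b) := by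
        rw [e1]; ext t; simp [ho2, and_comm]
      rw [e2, e1]; exact hp z hz
  have sub : {ζ | BTHyp (lv Q b ψ ζ h1) G Q U W sep k m r0 ∧ BTFail Q rJ (lv Q b ψ ζ h1) (lv Q b ψ ζ h2)} ⊆
      ⋃ s ∈ (Finset.univ.filter fun s : ↥D → Bool => BTHyp (opn s) G Q U W sep k m r0),
        ((fun (ζ : ↥D → ℝ) z => o2 z (ζ z)) ⁻¹' Bs s) ∩ Set.univ.pi (C s) := by
    rintro ζ ⟨hζ1, hζ2⟩
    rw [l1] at hζ1
    rw [l1, l2] at hζ2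
    simp only [Set.mem_iUnion]
    refine ⟨fun z => o1 z (ζ z), Finset.mem_filter.2 ⟨Finset.mem_univ _, hζ1⟩, ?_, ?_⟩
    · obtain ⟨y, hy, z, hz, h3, h4, h5⟩ := hζ2
      refine ⟨y, hy, z, hz, h3, h4, fun hc => h5 ?_⟩
      rwa [Set.union_eq_self_of_subset_left] at hc
      rw [← l1, ← l2]
      rintro z ⟨hz, h⟩
      exact ⟨hz, h12.trans h⟩
    · intro z _; rfl
  refine (measure_mono sub).trans ((measure_biUnion_finset_le _ _).trans ?_)
  calc _ ≤ ∑ s ∈ (Finset.univ.filter fun s : ↥D → Bool => BTHyp (opn s) G Q U W sep k m r0), δ * stdG ↥D (Set.univ.pi (C s)) :=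
        Finset.sum_le_sum fun s hs => key s (Finset.mem_filter.1 hs).2
    _ ≤ ∑ s : ↥D → Bool, δ * stdG ↥D (Set.univ.pi (C s)) :=
        Finset.sum_le_sum_of_subset (Finset.filter_subset _ _)
    _ = δ * ∑ s : ↥D → Bool, stdG ↥D (Set.univ.pi (C s)) := by rw [Finset.mul_sum]
    _ = δ * stdG ↥D (⋃ s : ↥D → Bool, Set.univ.pi (C s)) := by
        rw [measure_iUnion, tsum_fintype]
        · intro s s' hss
          refine Set.disjoint_left.2 fun ζ h h' => hss (funext fun z => ?_)
          exact (h z trivial).symm.trans (h' z trivial)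
        · exact fun s => MeasurableSet.univ_pi (mC s)
    _ ≤ δ * 1 := by gcongr; exact prob_le_one
    _ = δ := mul_one _

end cond

section model

def dt {ι : Type*} [Fintype ι] (c ξ : ι → ℝ) : ℝ := ∑ i, c i * ξ i

lemma dt_meas {ι : Type*} [Fintype ι] (c : ι → ℝ) : Measurable (dt c) := by
  unfold dt; fun_prop

lemma dt_law {ι : Type*} [Fintype ι] (c : ι → ℝ) :
    (stdG ι).map (dt c) = gaussianReal 0 (Real.toNNReal (dt c c)) := by
  haveI : IsProbabilityMeasure ((stdG ι).map (dt c)) := Measure.isProbabilityMeasure_map (dt_meas c).aemeasurable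
  refine Measure.ext_of_charFun ?_
  ext t
  rw [charFun_gaussianReal, charFun_apply_real, integral_map (dt_meas c).aemeasurable (by fun_prop)]
  have h1 : ∀ ξ : ι → ℝ, Complex.exp (t * (dt c ξ : ℝ) * Complex.I) = ∏ i, Complex.exp ((t * c i : ℝ) * (ξ i : ℝ) * Complex.I) := by
    intro ξ
    rw [← Complex.exp_sum]; congr 1
    simp only [dt]; push_cast
    rw [Finset.mul_sum, Finset.sum_mul]
    exact Finset.sum_congr rfl fun i _ => by ring
  simp_rw [h1]
  unfold stdG
  rw [integral_fintype_prod_eq_prod (f := fun i (x : ℝ) => Complex.exp ((t * c i : ℝ) * (x : ℝ) * Complex.I))]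
  have h2 : ∀ i, ∫ x : ℝ, Complex.exp ((t * c i : ℝ) * (x : ℝ) * Complex.I) ∂(gaussianReal 0 1) = Complex.exp (-((t * c i : ℝ)) ^ 2 / 2) := by
    intro i
    rw [← charFun_apply_real, charFun_gaussianReal]
    congr 1; push_cast; simp; ring
  simp_rw [h2]
  rw [← Complex.exp_sum]; congr 1
  have h3 : 0 ≤ dt c c := Finset.sum_nonneg fun i _ => mul_self_nonneg _
  have h4 : ((Real.toNNReal (dt c c) : NNReal) : ℂ) = ((dt c c : ℝ) : ℂ) := by
    rw [← Real.coe_toNNReal _ h3]; simp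
  rw [h4]
  simp only [dt]; push_cast
  simp only [mul_zero, zero_mul, zero_sub]
  rw [Finset.sum_mul, Finset.sum_div, ← Finset.sum_neg_distrib]
  exact Finset.sum_congr rfl fun i _ => by ring

lemma law_eq {Ω Ω' α : Type*} [MeasurableSpace Ω] [MeasurableSpace Ω'] [Fintype α] (P : Measure Ω) (P' : Measure Ω')
    [IsProbabilityMeasure P] [IsProbabilityMeasure P'] (X : α → Ω → ℝ) (X' : α → Ω' → ℝ)
    (hX : ∀ i, Measurable (X i)) (hX' : ∀ i, Measurable (X' i))
    (h : ∀ a : α → ℝ, P.map (fun ω => ∑ i, a i * X i ω) = P'.map (fun ω => ∑ i, a i * X' i ω))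
    (B : Set (α → ℝ)) (hB : MeasurableSet B) : P {ω | (fun i => X i ω) ∈ B} = P' {ω | (fun i => X' i ω) ∈ B} := by
  classical
  have m1 : Measurable fun ω i => X i ω := measurable_pi_lambda _ hX
  have m2 : Measurable fun ω i => X' i ω := measurable_pi_lambda _ hX'
  have key : P.map (fun ω i => X i ω) = P'.map (fun ω i => X' i ω) := by
    haveI := Measure.isProbabilityMeasure_map (μ := P) m1.aemeasurable
    haveI := Measure.isProbabilityMeasure_map (μ := P') m2.aemeasurable
    refine Measure.ext_of_charFunDual ?_
    ext L
    rw [charFunDual_eq_charFun_map_one, charFunDual_eq_charFun_map_one,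
      Measure.map_map (by fun_prop) m1, Measure.map_map (by fun_prop) m2]
    have hL : ∀ x : α → ℝ, L x = ∑ i, L (Pi.single i 1) * x i := by
      intro x
      conv_lhs => rw [pi_eq_sum_univ' x, map_sum]
      refine Finset.sum_congr rfl fun i _ => ?_
      rw [map_smul, smul_eq_mul, mul_comm]
    have e1 : (L ∘ fun ω i => X i ω) = fun ω => ∑ i, L (Pi.single i 1) * X i ω := by
      ext ω; exact hL _
    have e2 : (L ∘ fun ω i => X' i ω) = fun ω => ∑ i, L (Pi.single i 1) * X' i ω := by
      ext ω; exact hL _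
    rw [e1, e2, h]
  have := congrArg (fun μ => μ B) key
  simp only [Measure.map_apply m1 hB, Measure.map_apply m2 hB] at this
  exact this

/-- Finite-valued events are measurable. -/
lemma meas_cfg {Ω α : Type*} [MeasurableSpace Ω] [Fintype α] (X : α → Ω → ℝ) (hX : ∀ i, Measurable (X i)) (t : α → ℝ)
    (Pr : Set α → Prop) : MeasurableSet {ω | Pr {i | t i ≤ X i ω}} := by
  classical
  have h : Measurable fun ω => fun i => decide (t i ≤ X i ω) := by
    refine measurable_pi_lambda _ fun i => ?_
    refine measurable_to_bool ?_
    have : (fun ω => decide (t i ≤ X i ω)) ⁻¹' {true} = {ω | t i ≤ X i ω} := by ext; simp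
    rw [this]; exact measurableSet_le measurable_const (hX i)
  have := h (meas_bool {f : α → Bool | Pr {i | f i = true}})
  convert this using 1
  ext ω; simp

lemma GY_factor (d : ℕ) (hd : 3 ≤ d) (K : ℕ) (s : Finset (V d)) : ∃ B : V d → ↥s → ℝ, ∀ x ∈ s, ∀ y ∈ s,
    dt (B x) (B y) = GY d K x y := by
  classical
  let A : Matrix ↥s ↥s ℝ := fun x y => GY d K x y
  have hsym : ∀ x y : V d, GY d K x y = GY d K y x := by
    intro x y
    have h1 := green_eq d hd K x y
    have h2 := green_eq d hd K y x
    have h3 : green d x y = green d y x := by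
      unfold green; exact tsum_congr fun k => srwP_symm d k x y
    simp only [srwP_symm d _ x y] at h1
    rw [h3] at h1
    rw [h1] at h2
    simp only [eq_comm (a := x)] at h2
    linarith
  have hA : A.PosSemidef := by
    refine Matrix.posSemidef_iff_dotProduct_mulVec.2 ⟨?_, fun x => ?_⟩
    · ext i j; simp [A, Matrix.conjTranspose_apply]; exact hsym _ _
    · have := GY_psd d hd K s (fun z => if hz : z ∈ s then x ⟨z, hz⟩ else 0)
      have e : star x ⬝ᵥ A.mulVec x = ∑ y ∈ s, ∑ z ∈ s, (if hz : y ∈ s then x ⟨y, hz⟩ else 0) * (if hz : z ∈ s then x ⟨z, hz⟩ else 0) * GY d K y z := by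
        rw [← Finset.sum_attach s]
        simp only [dotProduct, Matrix.mulVec, Finset.univ_eq_attach]
        refine Finset.sum_congr rfl fun y _ => ?_
        rw [← Finset.sum_attach s, Finset.mul_sum]
        refine Finset.sum_congr rfl fun z _ => ?_
        simp [A]; ring
      rw [e]; exact this
  open scoped MatrixOrder in
  have h0 : 0 ≤ A := Matrix.nonneg_iff_posSemidef.2 hA
  open scoped MatrixOrder Matrix.Norms.L2Operator in
  obtain ⟨C, hC⟩ := CStarAlgebra.nonneg_iff_eq_star_mul_self.1 h0
  rw [Matrix.star_eq_conjTranspose] at hC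
  refine ⟨fun x w => if hx : x ∈ s then C w ⟨x, hx⟩ else 0, fun x hx y hy => ?_⟩
  have := congrFun (congrFun hC ⟨x, hx⟩) ⟨y, hy⟩
  simp only [A, Matrix.mul_apply, Matrix.conjTranspose_apply, star_trivial] at this
  rw [this]; simp [dt, hx, hy]

end model

section model2
variable {d : ℕ}

lemma law_lv {Ω Ω' : Type*} [MeasurableSpace Ω] [MeasurableSpace Ω'] (P : Measure Ω) (P' : Measure Ω')
    [IsProbabilityMeasure P] [IsProbabilityMeasure P'] (X : V d → Ω → ℝ) (X' : V d → Ω' → ℝ)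
    (hX : ∀ i, Measurable (X i)) (hX' : ∀ i, Measurable (X' i)) (s : Finset (V d))
    (h : ∀ a : V d → ℝ, P.map (fun ω => ∑ i ∈ s, a i * X i ω) = P'.map (fun ω => ∑ i ∈ s, a i * X' i ω))
    (h1 h2 : ℝ) (Pr : Set (V d) → Set (V d) → Prop) :
    P {ω | Pr {z | z ∈ s ∧ h1 ≤ X z ω} {z | z ∈ s ∧ h2 ≤ X z ω}} =
      P' {ω | Pr {z | z ∈ s ∧ h1 ≤ X' z ω} {z | z ∈ s ∧ h2 ≤ X' z ω}} := by
  classical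
  have hB : MeasurableSet {f : ↥s → ℝ | Pr {z | ∃ hz : z ∈ s, h1 ≤ f ⟨z, hz⟩} {z | ∃ hz : z ∈ s, h2 ≤ f ⟨z, hz⟩}} := by
    have := meas_cfg (α := ↥s ⊕ ↥s) (Ω := ↥s → ℝ) (fun i f => f (Sum.elim id id i)) (fun i => by fun_prop)
      (Sum.elim (fun _ => h1) (fun _ => h2))
      (fun S => Pr {z | ∃ hz : z ∈ s, Sum.inl ⟨z, hz⟩ ∈ S} {z | ∃ hz : z ∈ s, Sum.inr ⟨z, hz⟩ ∈ S})
    simpa using this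
  have := law_eq P P' (fun i : ↥s => X i) (fun i : ↥s => X' i) (fun i => hX i) (fun i => hX' i) (fun a => by
    have := h (fun z => if hz : z ∈ s then a ⟨z, hz⟩ else 0)
    simp_rw [← Finset.sum_attach s] at this
    simpa using this) _ hB
  simpa using this

/-- Coordinates of the model. -/
abbrev MI (d Q K : ℕ) := ↥(fbx (0 : V d) Q) ⊕ ((Fin K × ↥(fbx (0 : V d) (Q + K + 1))) ⊕ ↥(fbx (0 : V d) Q))

def bc : ℝ := (√2)⁻¹

lemma bc_pos : 0 < bc := by unfold bc; positivity

lemma bc_sq : bc * bc = 1 / 2 := by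
  unfold bc; rw [← mul_inv, Real.mul_self_sqrt (by norm_num)]; norm_num

open Classical in
def lco (d Q K : ℕ) (x : V d) : MI d Q K → ℝ
  | Sum.inl z => if x = z then bc else 0
  | Sum.inr (Sum.inl (k, z)) => bc * Qk d k x z
  | Sum.inr (Sum.inr _) => 0

def yco {d Q : ℕ} (K : ℕ) (B : V d → ↥(fbx (0 : V d) Q) → ℝ) (x : V d) : MI d Q K → ℝ
  | Sum.inr (Sum.inr w) => B x w
  | _ => 0

lemma lco_dot (hd : 3 ≤ d) (Q K : ℕ) {x y : V d} (hx : dinf 0 x ≤ Q) :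
    dt (lco d Q K x) (lco d Q K y) = Gloc d K x y := by
  classical
  have h1 := green_eq d hd K x y
  have hg : Gloc d K x y = green d x y - GY d K x y := rfl
  rw [hg, h1]
  simp only [dt, Fintype.sum_sum_type, lco, mul_zero, Finset.sum_const_zero, add_zero]
  rw [add_sub_cancel_right]
  congr 1
  · have : ∀ z : ↥(fbx (0 : V d) Q), (if x = ↑z then bc else 0) * (if y = ↑z then bc else 0) = if (⟨x, mem_fbx.2 hx⟩ : ↥(fbx (0 : V d) Q)) = z then (if x = y then 1 / 2 else 0) else 0 := by
      intro z
      by_cases h : x = z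
      · have h' : (⟨x, mem_fbx.2 hx⟩ : ↥(fbx (0 : V d) Q)) = z := Subtype.ext h
        rw [if_pos h, if_pos h']
        by_cases hy : x = y
        · rw [if_pos hy, if_pos (hy ▸ h), bc_sq]
        · rw [if_neg hy, if_neg (fun h2 => hy (h.trans h2.symm)), mul_zero]
      · have h' : ¬ (⟨x, mem_fbx.2 hx⟩ : ↥(fbx (0 : V d) Q)) = z := fun h2 => h (congrArg Subtype.val h2)
        rw [if_neg h, if_neg h', zero_mul]
    simp_rw [this]
    rw [Finset.sum_ite_eq]; simp
  · rw [Fintype.sum_prod_type, ← Fin.sum_univ_eq_sum_range (fun k => (srwP d (2 * k) x y + 2 * srwP d (2 * k + 1) x y + srwP d (2 * k + 2) x y) / 2)]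
    refine Finset.sum_congr rfl fun k _ => ?_
    have := Qk_sum d k x y (fbx 0 (Q + K + 1)) (by
      intro z hz
      rw [mem_fbx]
      have h3 : dinf x z ≤ k + 1 := dinf_le.2 (by intro i; have := hz i; push_cast; exact this)
      have := dinf_tri 0 x z
      have := k.2
      omega)
    rw [← this, Finset.sum_div, ← Finset.sum_attach (fbx (0 : V d) (Q + K + 1))]
    refine Finset.sum_congr rfl fun z _ => ?_
    linear_combination (Qk d k x z * Qk d k y z) * bc_sq

lemma lco_supp (Q K : ℕ) (x : V d) (z : ↥(fbx (0 : V d) (Q + K + 1))) (k : Fin K) (h : K < dinf x z) :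
    lco d Q K x (Sum.inr (Sum.inl (k, z))) = 0 := by
  have hk := k.2
  have h1 : ∀ n, n ≤ K → srwP d n x z = 0 := by
    intro n hn
    by_contra h2
    have := dinf_le.2 (srwP_supp d n x z h2)
    omega
  simp only [lco, Qk]
  rw [h1 _ (by omega), h1 _ (by omega)]; simp

def mco {d Q : ℕ} (K : ℕ) (B : V d → ↥(fbx (0 : V d) Q) → ℝ) (x : V d) : MI d Q K → ℝ :=
  fun i => lco d Q K x i + yco K B x i

lemma dt_add_left {ι : Type*} [Fintype ι] (a b c : ι → ℝ) : dt (fun i => a i + b i) c = dt a c + dt b c := by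
  simp [dt, add_mul, Finset.sum_add_distrib]

lemma dt_comm {ι : Type*} [Fintype ι] (a b : ι → ℝ) : dt a b = dt b a := by
  simp [dt, mul_comm]

lemma mco_dot (hd : 3 ≤ d) (Q K : ℕ) (B : V d → ↥(fbx (0 : V d) Q) → ℝ)
    (hB : ∀ x ∈ fbx 0 Q, ∀ y ∈ fbx 0 Q, dt (B x) (B y) = GY d K x y) {x y : V d} (hx : dinf 0 x ≤ Q) (hy : dinf 0 y ≤ Q) :
    dt (mco K B x) (mco K B y) = green d x y := by
  have h1 := lco_dot hd Q K (y := y) hx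
  have h2 : dt (yco K B x) (yco K B y) = GY d K x y := by
    rw [← hB x (mem_fbx.2 hx) y (mem_fbx.2 hy)]
    simp [dt, yco]
  have h3 : ∀ x y : V d, dt (lco d Q K x) (yco K B y) = 0 := by
    intro x y; simp [dt, yco, lco]
  have hg : Gloc d K x y = green d x y - GY d K x y := rfl
  unfold mco
  rw [dt_add_left, dt_comm (lco d Q K x), dt_comm (yco K B x), dt_add_left, dt_add_left, dt_comm (lco d Q K y),
    dt_comm (yco K B y), h1, h3, h3, dt_comm (yco K B y), h2, hg]; ring

lemma dt_sum {ι : Type*} [Fintype ι] (s : Finset (V d)) (a : V d → ℝ) (c : V d → ι → ℝ) (ξ : ι → ℝ) :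
    ∑ x ∈ s, a x * dt (c x) ξ = dt (fun i => ∑ x ∈ s, a x * c x i) ξ := by
  simp only [dt, Finset.mul_sum, Finset.sum_mul]
  rw [Finset.sum_comm]
  exact Finset.sum_congr rfl fun _ _ => Finset.sum_congr rfl fun _ _ => by ring

/-- The model has the law of the free field. -/
lemma model_law (hd : 3 ≤ d) {Ω : Type*} [MeasurableSpace Ω] (P : Measure Ω) [IsProbabilityMeasure P] (φ : V d → Ω → ℝ)
    (hφ : IsGFF P φ) (Q K : ℕ) (B : V d → ↥(fbx (0 : V d) Q) → ℝ)
    (hB : ∀ x ∈ fbx 0 Q, ∀ y ∈ fbx 0 Q, dt (B x) (B y) = GY d K x y) (s : Finset (V d)) (hs : ∀ x ∈ s, dinf 0 x ≤ Q)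
    (h1 h2 : ℝ) (Pr : Set (V d) → Set (V d) → Prop) :
    P {ω | Pr {z | z ∈ s ∧ h1 ≤ φ z ω} {z | z ∈ s ∧ h2 ≤ φ z ω}} =
      stdG (MI d Q K) {ξ | Pr {z | z ∈ s ∧ h1 ≤ dt (mco K B z) ξ} {z | z ∈ s ∧ h2 ≤ dt (mco K B z) ξ}} := by
  refine law_lv P (stdG (MI d Q K)) φ (fun z ξ => dt (mco K B z) ξ) hφ.1 (fun i => dt_meas _) s (fun a => ?_) h1 h2 Pr
  rw [hφ.2 s a]
  simp_rw [dt_sum]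
  rw [dt_law]
  congr 2
  rw [← dt_sum]
  refine Finset.sum_congr rfl fun x hx => ?_
  rw [dt_comm, ← dt_sum, Finset.mul_sum]
  refine Finset.sum_congr rfl fun y hy => ?_
  rw [← mco_dot hd Q K B hB (hs x hx) (hs y hy), dt_comm (mco K B x)]; ring

/-- Symmetries of the free field. -/
lemma gff_sym {Ω : Type*} [MeasurableSpace Ω] (P : Measure Ω) [IsProbabilityMeasure P] (φ : V d → Ω → ℝ)
    (hφ : IsGFF P φ) (τ : V d → V d) (hτ : Function.Injective τ) (hg : ∀ n x y, srwP d n (τ x) (τ y) = srwP d n x y)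
    (s : Finset (V d)) (h1 h2 : ℝ) (Pr : Set (V d) → Set (V d) → Prop) :
    P {ω | Pr {z | z ∈ s ∧ h1 ≤ φ z ω} {z | z ∈ s ∧ h2 ≤ φ z ω}} =
      P {ω | Pr {z | z ∈ s ∧ h1 ≤ φ (τ z) ω} {z | z ∈ s ∧ h2 ≤ φ (τ z) ω}} := by
  classical
  refine law_lv P P φ (fun z ω => φ (τ z) ω) hφ.1 (fun i => hφ.1 _) s (fun a => ?_) h1 h2 Pr
  have := hφ.2 (s.image τ) (fun z => a (Function.invFun τ z))
  simp only [Finset.sum_image hτ.injOn, Function.leftInverse_invFun hτ _] at this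
  rw [this, hφ.2 s a]
  congr 2
  refine Finset.sum_congr rfl fun x _ => Finset.sum_congr rfl fun y _ => ?_
  unfold green
  simp only [hg]

/-- Gaussian tail bound. -/
lemma dt_tail {ι : Type*} [Fintype ι] (c : ι → ℝ) (v t : ℝ) (hv : 0 < v) (hc : dt c c ≤ v) (ht : 0 ≤ t) :
    stdG ι {ξ | t ≤ dt c ξ} ≤ ENNReal.ofReal (Real.exp (-t ^ 2 / (2 * v))) := by
  have hm : stdG ι {ξ | t ≤ dt c ξ} = gaussianReal 0 (Real.toNNReal (dt c c)) (Set.Ici t) := by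
    rw [← dt_law, Measure.map_apply (dt_meas c) measurableSet_Ici]; rfl
  rw [hm]
  have h0 : 0 ≤ dt c c := Finset.sum_nonneg fun i _ => mul_self_nonneg _
  have := measure_ge_le_exp_mul_mgf (μ := gaussianReal 0 (Real.toNNReal (dt c c))) (X := id) t (t := t / v) (by positivity)
    (integrable_exp_mul_gaussianReal _)
  rw [mgf_id_gaussianReal] at this
  rw [← ENNReal.ofReal_toReal (measure_ne_top (gaussianReal 0 (Real.toNNReal (dt c c))) (Set.Ici t))]
  refine ENNReal.ofReal_le_ofReal (le_trans this ?_)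
  simp only [Real.coe_toNNReal _ h0]
  rw [← Real.exp_add, Real.exp_le_exp]
  have e : -t ^ 2 / (2 * v) = -(t / v) * t + (0 * (t / v) + v * (t / v) ^ 2 / 2) := by
    field_simp; ring
  rw [e]
  gcongr

end model2

section model3
variable {d : ℕ}

def inrOnly {α β : Type*} (c : α ⊕ β → ℝ) : α ⊕ β → ℝ
  | Sum.inl _ => 0
  | Sum.inr j => c (Sum.inr j)

def Xs {Q : ℕ} (K : ℕ) (B : V d → ↥(fbx (0 : V d) Q) → ℝ) (h : ℝ) (ξ : MI d Q K → ℝ) : Set (V d) :=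
  {z | z ∈ fbx 0 Q ∧ h ≤ dt (mco K B z) ξ}

def Gs {Q : ℕ} (K : ℕ) (B : V d → ↥(fbx (0 : V d) Q) → ℝ) (M : ℝ) (ξ : MI d Q K → ℝ) : Set (V d) :=
  {z | z ∈ fbx 0 Q ∧ -M ≤ dt (inrOnly (mco K B z)) ξ}

lemma dt_split {Q : ℕ} (K : ℕ) (B : V d → ↥(fbx (0 : V d) Q) → ℝ) (z : V d) (hz : z ∈ fbx (0 : V d) Q) (ξ : MI d Q K → ℝ) :
    dt (mco K B z) ξ = bc * ξ (Sum.inl ⟨z, hz⟩) + dt (inrOnly (mco K B z)) ξ := by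
  classical
  simp only [dt, Fintype.sum_sum_type (α₁ := ↥(fbx (0 : V d) Q)), inrOnly, zero_mul, Finset.sum_const_zero, zero_add]
  congr 1
  have : ∀ w : ↥(fbx (0 : V d) Q), mco K B z (Sum.inl w) * ξ (Sum.inl w) = if (⟨z, hz⟩ : ↥(fbx (0 : V d) Q)) = w then bc * ξ (Sum.inl w) else 0 := by
    intro w
    simp only [mco, lco, yco, add_zero]
    by_cases h : z = w
    · rw [if_pos h, if_pos (Subtype.ext h)]
    · rw [if_neg h, if_neg (fun h2 => h (congrArg Subtype.val h2)), zero_mul]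
  simp_rw [this]
  rw [Finset.sum_ite_eq]; simp

lemma bt_model (hd : 2 ≤ d) {Q U W sep k m r0 T J rJ : ℕ} (K : ℕ) (B : V d → ↥(fbx (0 : V d) Q) → ℝ)
    (hU : U + 1 ≤ sep) (hUW : U + 1 ≤ W) (hQ : r0 + k * sep ≤ Q)
    (hr : rJ + J * (T * (2 * (k * sep + W) + 1)) ≤ r0) (hJ : (2 * Q + 1) ^ d < 2 ^ J)
    (h1 h2 M : ℝ) (h12 : h2 ≤ h1) (p : ENNReal) (hp1 : p ≤ 1)
    (hp : ∀ t : ℝ, -M ≤ t → p * gaussianReal 0 1 (Iio ((h1 - t) / bc)) ≤ gaussianReal 0 1 (Ico ((h2 - t) / bc) ((h1 - t) / bc))) :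
    stdG (MI d Q K) {ξ | BTHyp (Xs K B h1 ξ) (Gs K B M ξ) Q U W sep k m r0 ∧ BTFail Q rJ (Xs K B h1 ξ) (Xs K B h2 ξ)} ≤
      J * (2 * Q + 1) ^ d * (1 - p ^ m) ^ T := by
  classical
  set A := {ξ | BTHyp (Xs K B h1 ξ) (Gs K B M ξ) Q U W sep k m r0 ∧ BTFail Q rJ (Xs K B h1 ξ) (Xs K B h2 ξ)} with hA
  have mA : MeasurableSet A := by
    have := meas_cfg (α := ↥(fbx (0 : V d) Q) ⊕ (↥(fbx (0 : V d) Q) ⊕ ↥(fbx (0 : V d) Q))) (Ω := MI d Q K → ℝ)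
      (Sum.elim (fun z => dt (mco K B z)) (Sum.elim (fun z => dt (mco K B z)) (fun z => dt (inrOnly (mco K B z)))))
      (by rintro (i | i | i) <;> exact dt_meas _)
      (Sum.elim (fun _ => h1) (Sum.elim (fun _ => h2) (fun _ => -M)))
      (fun S => BTHyp {z | ∃ hz : z ∈ fbx (0 : V d) Q, Sum.inl ⟨z, hz⟩ ∈ S} {z | ∃ hz : z ∈ fbx (0 : V d) Q, Sum.inr (Sum.inr ⟨z, hz⟩) ∈ S} Q U W sep k m r0 ∧
        BTFail Q rJ {z | ∃ hz : z ∈ fbx (0 : V d) Q, Sum.inl ⟨z, hz⟩ ∈ S} {z | ∃ hz : z ∈ fbx (0 : V d) Q, Sum.inr (Sum.inl ⟨z, hz⟩) ∈ S})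
    simpa [hA, Xs, Gs] using this
  have mp := measurePreserving_sumPiEquivProdPi (fun _ : MI d Q K => gaussianReal 0 1)
  have mp' := mp.symm
  have e1 : stdG (MI d Q K) A = ((Measure.pi fun _ : ↥(fbx (0 : V d) Q) => gaussianReal 0 1).prod (Measure.pi fun _ : (Fin K × ↥(fbx (0 : V d) (Q + K + 1))) ⊕ ↥(fbx (0 : V d) Q) => gaussianReal 0 1))
      ((MeasurableEquiv.sumPiEquivProdPi fun _ : MI d Q K => ℝ).symm ⁻¹' A) :=
    (mp'.measure_preimage mA.nullMeasurableSet).symm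
  rw [e1, Measure.prod_apply_symm (mp'.measurable mA)]
  refine le_trans (lintegral_mono (g := fun _ => J * (2 * Q + 1) ^ d * (1 - p ^ m) ^ T) fun η => ?_) (by simp)
  have key : ∀ ζ, ∀ z, dt (inrOnly (mco K B z)) ((MeasurableEquiv.sumPiEquivProdPi fun _ : MI d Q K => ℝ).symm (ζ, η)) =
      dt (fun j => mco K B z (Sum.inr j)) η := by
    intro ζ z
    simp only [dt, Fintype.sum_sum_type (α₁ := ↥(fbx (0 : V d) Q)), inrOnly, zero_mul, Finset.sum_const_zero, zero_add]
    rfl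
  have hX : ∀ ζ h, Xs K B h ((MeasurableEquiv.sumPiEquivProdPi fun _ : MI d Q K => ℝ).symm (ζ, η)) =
      lv Q bc (fun z => dt (fun j => mco K B z (Sum.inr j)) η) ζ h := by
    intro ζ h
    ext z
    simp only [Xs, lv, mem_ofPred_eq]
    constructor
    · rintro ⟨hz, h'⟩
      rw [dt_split K B z hz, key] at h'
      exact ⟨hz, h'⟩
    · rintro ⟨hz, h'⟩
      refine ⟨hz, ?_⟩
      rw [dt_split K B z hz, key]; exact h'
  have hG : ∀ ζ, Gs K B M ((MeasurableEquiv.sumPiEquivProdPi fun _ : MI d Q K => ℝ).symm (ζ, η)) =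
      {z | z ∈ fbx 0 Q ∧ -M ≤ dt (fun j => mco K B z (Sum.inr j)) η} := by
    intro ζ; simp only [Gs, key]
  have := bt_gauss hd (G := {z | z ∈ fbx 0 Q ∧ -M ≤ dt (fun j => mco K B z (Sum.inr j)) η}) (m := m) hU hUW hQ hr hJ bc h1 h2
    bc_pos h12 (fun z => dt (fun j => mco K B z (Sum.inr j)) η) p hp1 (fun z hz => hp _ hz.2)
  refine le_trans (le_of_eq ?_) this
  unfold stdG
  congr 1
  ext ζ
  simp only [hA, mem_preimage, mem_ofPred_eq, hX, hG]

end model3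

section legs
variable {d : ℕ}

lemma Cn.map {S T : Set (V d)} (f : V d → V d) (hf : ∀ x y, adj x y → adj (f x) (f y)) (hST : ∀ z ∈ S, f z ∈ T) {a b : V d}
    (h : Cn S a b) : Cn T (f a) (f b) :=
  h.ind (P := fun a => Cn T (f a) (f b)) (fun hb => .refl (hST _ hb)) fun _ _ ha h1 _ h2 => .head (hST _ ha) (hf _ _ h1) h2

structure Sym (τ : V d → V d) : Prop where
  inj : Function.Injective τ
  srw : ∀ n x y, srwP d n (τ x) (τ y) = srwP d n x y
  ad : ∀ x y, adj x y → adj (τ x) (τ y)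
  di : ∀ x y, dinf (τ x) (τ y) = dinf x y

lemma sym_transl (c : V d) : Sym (fun z => z + c) :=
  ⟨fun x y h => by simpa using h, fun n x y => srwP_transl d n x y c, fun x y h => by simpa [adj] using h,
    fun x y => by simp [dinf]⟩

lemma sym_sperm (σ : Equiv.Perm (Fin d)) (s : Fin d → ℤ) (hs : ∀ i, s i = 1 ∨ s i = -1) : Sym (sperm σ s) := by
  have h1 : ∀ (x y : V d) i, (s i * x (σ i) - s i * y (σ i)).natAbs = (x (σ i) - y (σ i)).natAbs := by
    intro x y i
    rcases hs i with h | h <;> rw [h] <;> omega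
  have di : ∀ x y : V d, dinf (sperm σ s x) (sperm σ s y) = dinf x y := by
    intro x y
    simp only [dinf, sperm, h1]
    refine le_antisymm (Finset.sup_le fun i _ => Finset.le_sup (f := fun i => (x i - y i).natAbs) (Finset.mem_univ (σ i)))
      (Finset.sup_le fun i _ => ?_)
    have := Finset.le_sup (f := fun i => (x (σ i) - y (σ i)).natAbs) (Finset.mem_univ (σ.symm i))
    simpa using this
  refine ⟨fun x y h => ?_, fun n x y => srwP_sperm d n σ s hs x y, fun x y h => ?_, di⟩
  · have := di x y
    rw [h, dinf_self] at this
    have h2 := dinf_le.1 this.symm.le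
    ext i
    have := h2 i
    simpa [sub_eq_zero] using this
  · unfold adj at *
    rw [← h]; simp only [sperm, h1]
    exact Equiv.sum_comp σ fun i => (x i - y i).natAbs

variable {Ω : Type*} [MeasurableSpace Ω] (P : Measure Ω) [IsProbabilityMeasure P] (φ : V d → Ω → ℝ)

lemma leg_move (hφ : IsGFF P φ) {τ : V d → V d} (hτ : Sym τ) (h : ℝ) (r : ℕ) (c a b : V d) :
    P {ω | Cn (lvl φ h ω ∩ {z | dinf c z ≤ r}) a b} ≤
      P {ω | Cn (lvl φ h ω ∩ {z | dinf (τ c) z ≤ r}) (τ a) (τ b)} := by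
  have := gff_sym P φ hφ τ hτ.inj hτ.srw (fbx c r) h h (fun S _ => Cn S a b)
  have e : ∀ ω, lvl φ h ω ∩ {z | dinf c z ≤ r} = {z | z ∈ fbx c r ∧ h ≤ φ z ω} := by
    intro ω; ext z; simp only [lvl, mem_inter_iff, mem_ofPred_eq, mem_fbx]; tauto
  simp_rw [e, this]
  refine measure_mono fun ω hω => ?_
  refine Cn.map τ hτ.ad (fun z hz => ?_) hω
  simp only [mem_ofPred_eq, mem_fbx] at hz
  exact ⟨hz.2, by simpa [hτ.di] using hz.1⟩

lemma leg_exists (hd : 0 < d) (hφ : IsGFF P φ) (h : ℝ) (U R : ℕ) (hR : 2 * U + 1 ≤ R)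
    (hP : P {ω | ¬ ∃ a b, dinf 0 a ≤ U ∧ dinf 0 b = R ∧ Cn (lvl φ h ω) a b} ≤ 1 / 2) (ρ : ℕ) (hρ : ρ ≤ U + 1) :
    ∃ y : V d, dinf 0 y = ρ ∧ (4 * (2 * U + 3) ^ (2 * d) : ENNReal)⁻¹ ≤ P {ω | Cn (lvl φ h ω ∩ {z | dinf 0 z ≤ U + 1}) 0 y} := by
  classical
  by_contra hcon
  push Not at hcon
  set p1 := (4 * (2 * U + 3) ^ (2 * d) : ENNReal)⁻¹ with hp1
  set A := {ω | ∃ a b, dinf 0 a ≤ U ∧ dinf 0 b = R ∧ Cn (lvl φ h ω) a b} with hA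
  have h1 : (1 : ENNReal) ≤ P A + P Aᶜ := by
    rw [← measure_univ (μ := P), ← Set.union_compl_self A]; exact measure_union_le _ _
  have h2 : P A ≤ 1 / 4 := by
    have hsub : A ⊆ ⋃ x ∈ fbx (0 : V d) U, ⋃ y ∈ (fbx (0 : V d) (U + 1)).filter (fun y => dinf 0 y = ρ),
        {ω | Cn (lvl φ h ω ∩ {z | dinf x z ≤ U + 1}) x (y + x)} := by
      rintro ω ⟨a, b, ha, hb, hab⟩
      obtain ⟨w, hw, hw2⟩ := hab.cross (x := a) (r := ρ) (by rw [dinf_self]; omega) (by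
        have := dinf_tri 0 a b
        omega)
      simp only [mem_iUnion]
      have h3 : dinf 0 (w - a) = ρ := by
        rw [← hw]; simp only [dinf]; congr 1; funext i; simp only [Pi.zero_apply, Pi.sub_apply]; omega
      refine ⟨a, mem_fbx.2 ha, w - a, Finset.mem_filter.2 ⟨mem_fbx.2 (by omega), h3⟩, ?_⟩
      rw [sub_add_cancel]
      exact Cn.mono (fun z hz => ⟨hz.1, le_trans hz.2 hρ⟩ : lvl φ h ω ∩ {z | dinf a z ≤ ρ} ⊆ lvl φ h ω ∩ {z | dinf a z ≤ U + 1}) hw2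
    have hle : P A ≤ ∑ x ∈ fbx (0 : V d) U, ∑ y ∈ (fbx (0 : V d) (U + 1)).filter (fun y => dinf 0 y = ρ), p1 := by
      refine (measure_mono hsub).trans ((measure_biUnion_finset_le _ _).trans (Finset.sum_le_sum fun x _ => ?_))
      refine (measure_biUnion_finset_le _ _).trans (Finset.sum_le_sum fun y hy => ?_)
      have := leg_move P φ hφ (sym_transl (-x)) h (U + 1) x x (y + x)
      simp only [add_neg_cancel, add_neg_cancel_right] at this
      exact this.trans (hcon y (Finset.mem_filter.1 hy).2).le
    refine hle.trans ?_
    rw [Finset.sum_const, Finset.sum_const, nsmul_eq_mul, nsmul_eq_mul, ← mul_assoc, card_fbx]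
    have h4 : ((((2 * U + 1) ^ d : ℕ) : ENNReal)) * (((fbx (0 : V d) (U + 1)).filter (fun y => dinf 0 y = ρ)).card : ENNReal) ≤ (2 * U + 3) ^ (2 * d) := by
      have : (2 * U + 1) ^ d * ((fbx (0 : V d) (U + 1)).filter (fun y => dinf 0 y = ρ)).card ≤ (2 * U + 3) ^ (2 * d) := by
        rw [two_mul d, pow_add]
        refine Nat.mul_le_mul (Nat.pow_le_pow_left (by omega) _) ((Finset.card_filter_le _ _).trans ?_)
        rw [card_fbx]; exact (congrArg (· ^ d) (by ring)).le
      exact_mod_cast this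
    refine (mul_le_mul_left h4 _).trans (le_of_eq ?_)
    rw [hp1, ENNReal.mul_inv (by simp) (by simp), mul_left_comm, ENNReal.mul_inv_cancel]
    · simp
    · positivity
    · exact ENNReal.pow_ne_top (by finiteness)
  have h5 : P A + P Aᶜ ≤ 1 / 4 + 1 / 2 := add_le_add h2 hP
  have h6 := h1.trans h5
  have : (1 / 4 + 1 / 2 : ENNReal) < 1 := by
    rw [← ENNReal.toReal_lt_toReal (by finiteness) (by simp), ENNReal.toReal_add (by finiteness) (by finiteness)]
    simp; norm_num
  exact absurd h6 (not_le.2 this)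

/-- A set of displacements closed under lattice symmetries connects everything. -/
lemma coord_step (hd : 0 < d) {L : Set (V d)} {U W n : ℕ} {x : V d} {S : Set (V d)}
    (hL : ∀ ρ, ρ ≤ U + 1 → ∃ y ∈ L, dinf 0 y = ρ)
    (hL2 : ∀ y ∈ L, ∀ σ s, (∀ i, s i = 1 ∨ s i = -1) → sperm σ s y ∈ L)
    (hleg : ∀ c, dinf x c ≤ 2 * U + 2 → ∀ y ∈ L, ∃ E : Finset (V d), E.card ≤ n ∧ (∀ z ∈ E, dinf x z ≤ W) ∧ Cn (S ∪ E) c (c + y))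
    (hW : 2 * U + 2 ≤ W) (c c' : V d) (i : Fin d) (hc : dinf x c ≤ U + 1) (hc' : dinf x c' ≤ U + 1)
    (hcc : ∀ j, j ≠ i → c j = c' j) :
    ∃ E : Finset (V d), E.card ≤ 2 * n + 2 ∧ (∀ z ∈ E, dinf x z ≤ W) ∧ Cn (S ∪ E) c c' := by
  classical
  have b1 := abs_le.1 (dinf_le.1 hc i)
  have b2 := abs_le.1 (dinf_le.1 hc' i)
  push_cast at b1 b2
  obtain ⟨y, hy, hyρ⟩ := hL ((c' i - c i).natAbs / 2) (by omega)
  obtain ⟨j, hj⟩ := dinf_attained hd 0 y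
  rw [hyρ] at hj
  simp only [Pi.zero_apply, zero_sub, abs_neg] at hj
  -- sign so that coordinate i points from c to c'
  obtain ⟨e, he, he2⟩ : ∃ e : ℤ, (e = 1 ∨ e = -1) ∧ (c' i - c i = 2 * (e * y j) ∨ c' i - c i = 2 * (e * y j) + 1 ∨ c' i - c i = 2 * (e * y j) - 1) := by
    rcases le_total 0 (y j) with h | h <;> rcases le_total 0 (c' i - c i) with h' | h'
    · exact ⟨1, .inl rfl, by rw [abs_of_nonneg h] at hj; omega⟩
    · exact ⟨-1, .inr rfl, by rw [abs_of_nonneg h] at hj; omega⟩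
    · exact ⟨-1, .inr rfl, by rw [abs_of_nonpos h] at hj; omega⟩
    · exact ⟨1, .inl rfl, by rw [abs_of_nonpos h] at hj; omega⟩
  set y1 := sperm (Equiv.swap i j) (fun _ => e) y with hy1
  set y2 := sperm 1 (fun k => if k = i then 1 else -1) y1 with hy2
  have m1 : y1 ∈ L := hL2 _ hy _ _ fun _ => he
  have m2 : y2 ∈ L := hL2 _ m1 _ _ fun k => by by_cases h : k = i <;> simp [h]
  have v1 : y1 i = e * y j := by simp [hy1, sperm]
  have vs : ∀ k, k ≠ i → y1 k + y2 k = 0 := fun k hk => by simp [hy2, sperm, hk]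
  have vi : y1 i + y2 i = 2 * (e * y j) := by simp [hy2, sperm, v1]; ring
  have d1 : dinf 0 y1 ≤ U + 1 := by
    have := (sym_sperm (Equiv.swap i j) (fun _ => e) (fun _ => he)).di 0 y
    have e0 : sperm (Equiv.swap i j) (fun _ => e) (0 : V d) = 0 := by ext; simp [sperm]
    rw [e0, ← hy1, hyρ] at this
    omega
  obtain ⟨E1, hE1, hE1', hC1⟩ := hleg c (by omega) y1 m1
  obtain ⟨E2, hE2, hE2', hC2⟩ := hleg (c + y1) (by
    have h1 := dinf_tri x c (c + y1)
    have h2 : dinf c (c + y1) = dinf 0 y1 := by simp [dinf]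
    omega) y2 m2
  set w := c + y1 + y2 with hw
  have wi : w i = c i + 2 * (e * y j) := by simp only [hw, Pi.add_apply]; linarith
  have wk : ∀ k, k ≠ i → w k = c' k := fun k hk => by
    have := vs k hk; have := hcc k hk
    simp only [hw, Pi.add_apply]; omega
  have dw : dinf x w ≤ W := by
    refine dinf_le.2 fun k => ?_
    by_cases hk : k = i
    · subst hk; rw [wi, abs_le]; push_cast; omega
    · rw [wk k hk]; exact dinf_le.1 (by omega : dinf x c' ≤ W) k
  refine ⟨E1 ∪ E2 ∪ {w, c'}, ?_, ?_, ?_⟩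
  · refine (Finset.card_union_le _ _).trans ?_
    have := Finset.card_union_le E1 E2
    have := Finset.card_le_two (a := w) (b := c')
    omega
  · intro z hz
    simp only [Finset.mem_union, Finset.mem_insert, Finset.mem_singleton] at hz
    rcases hz with (h | h) | h | h
    · exact hE1' z h
    · exact hE2' z h
    · rw [h]; exact dw
    · rw [h]; omega
  · have k1 : Cn (S ∪ ↑(E1 ∪ E2 ∪ {w, c'})) c (c + y1) := hC1.mono (by intro z hz; simp at hz ⊢; tauto)
    have k2 : Cn (S ∪ ↑(E1 ∪ E2 ∪ {w, c'})) (c + y1) w := hC2.mono (by intro z hz; simp at hz ⊢; tauto)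
    refine k1.trans (k2.trans ?_)
    by_cases hwc : w = c'
    · rw [hwc]; exact .refl (by simp)
    · refine .head (by simp) ?_ (.refl (by simp))
      unfold adj
      rw [Finset.sum_eq_single i (fun k _ hk => by rw [wk k hk]; simp) (by simp)]
      have : w i ≠ c' i := fun h => hwc (by ext k; by_cases hk : k = i; · rw [hk]; exact h
                                            · exact wk k hk)
      omega

lemma legs_connect (hd : 0 < d) {L : Set (V d)} {U W n : ℕ} {x : V d} {S : Set (V d)}
    (hL : ∀ ρ, ρ ≤ U + 1 → ∃ y ∈ L, dinf 0 y = ρ)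
    (hL2 : ∀ y ∈ L, ∀ σ s, (∀ i, s i = 1 ∨ s i = -1) → sperm σ s y ∈ L)
    (hleg : ∀ c, dinf x c ≤ 2 * U + 2 → ∀ y ∈ L, ∃ E : Finset (V d), E.card ≤ n ∧ (∀ z ∈ E, dinf x z ≤ W) ∧ Cn (S ∪ E) c (c + y))
    (hW : 2 * U + 2 ≤ W) (a b : V d) (ha : dinf x a ≤ U + 1) (hb : dinf x b ≤ U + 1) :
    ∃ E : Finset (V d), E.card ≤ d * (2 * n + 2) + 1 ∧ (∀ z ∈ E, dinf x z ≤ W) ∧ Cn (S ∪ E) a b := by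
  classical
  have key : ∀ t : Finset (Fin d), ∃ E : Finset (V d), E.card ≤ t.card * (2 * n + 2) + 1 ∧ (∀ z ∈ E, dinf x z ≤ W) ∧
      Cn (S ∪ E) a (fun i => if i ∈ t then b i else a i) := by
    intro t
    induction t using Finset.induction_on with
    | empty => exact ⟨{a}, by simp, by simp; omega, by simpa using Cn.refl (by simp)⟩
    | insert i t hi ih =>
      obtain ⟨E, h1, h2, h3⟩ := ih
      have hbox : ∀ t : Finset (Fin d), dinf x (fun i => if i ∈ t then b i else a i) ≤ U + 1 := by
        intro t
        refine dinf_le.2 fun k => ?_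
        by_cases hk : k ∈ t
        · simp only [hk, if_true]; exact dinf_le.1 hb k
        · simp only [hk, if_false]; exact dinf_le.1 ha k
      obtain ⟨E', h1', h2', h3'⟩ := coord_step hd hL hL2 hleg hW (fun i => if i ∈ t then b i else a i)
        (fun k => if k ∈ insert i t then b k else a k) i (hbox _) (hbox _) (by
          intro j hj; simp [hj])
      refine ⟨E ∪ E', ?_, ?_, ?_⟩
      · have := Finset.card_union_le E E'
        rw [Finset.card_insert_of_notMem hi, add_mul]; omega
      · intro z hz
        rcases Finset.mem_union.1 hz with h | h
        · exact h2 z h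
        · exact h2' z h
      · exact (h3.mono (by intro z hz; simp at hz ⊢; tauto)).trans (h3'.mono (by intro z hz; simp at hz ⊢; tauto))
  obtain ⟨E, h1, h2, h3⟩ := key Finset.univ
  exact ⟨E, by simpa using h1, h2, by simpa using h3⟩

end legs

section count
variable {d : ℕ}

/-- Constants for the decay of the Green function. -/
def GreenC (d : ℕ) (C : ℝ) : Prop := 0 < C ∧ ∀ x y : V d, green d x y ≤ C ∧ ∀ m : ℕ, 1 ≤ m →
  ((∃ i, ((m ^ 8 : ℕ) : ℤ) ≤ |x i - y i|) → green d x y ≤ C / m ^ (2 * d)) ∧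
  ((∃ i, ((m ^ 10 : ℕ) : ℤ) ≤ |x i - y i|) → green d x y ≤ C / m ^ 9)

lemma cub_far {v : ℕ} (hv : 0 < v) {a b : V d} {i : Fin d} {k : ℕ} (h : (k : ℤ) + 1 ≤ |cub v a i - cub v b i|) :
    ((k * v : ℕ) : ℤ) ≤ |a i - b i| := by
  have hv' : (0 : ℤ) < v := by exact_mod_cast hv
  unfold cub at h
  have e1 := Int.mul_ediv_add_emod (a i) v
  have e2 := Int.mul_ediv_add_emod (b i) v
  have f1 := Int.emod_nonneg (a i) hv'.ne'
  have f2 := Int.emod_lt_of_pos (a i) hv'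
  have f3 := Int.emod_nonneg (b i) hv'.ne'
  have f4 := Int.emod_lt_of_pos (b i) hv'
  push_cast
  rcases le_abs.1 h with h | h
  · refine le_trans ?_ (le_abs_self _)
    nlinarith
  · refine le_trans ?_ (neg_le_abs _)
    nlinarith

lemma count_class (hd : 3 ≤ d) {Q K : ℕ} {C : ℝ} (hC : GreenC d C) {m : ℕ} (hm1 : 1 ≤ m) (T : Finset (V d)) (rep : V d → V d)
    (hrep : ∀ q ∈ T, cub (m ^ 8) (rep q) = q ∧ dinf 0 (rep q) ≤ Q)
    (hpar : ∀ q ∈ T, ∀ q' ∈ T, ∀ i, (2 : ℤ) ∣ q i - q' i) (δ : MI d Q K → ℝ) (r2 e : ℝ) (hδ : ∑ i, δ i ^ 2 ≤ r2) (he : 0 < e)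
    (hbad : ∀ q ∈ T, e ≤ dt (lco d Q K (rep q)) δ) (hm : 2 * r2 * C ≤ e ^ 2 * m ^ 9) :
    T.card * e ^ 2 ≤ 2 * r2 * C * (1 + 3 ^ d) := by
  classical
  obtain ⟨hC0, hC⟩ := hC
  have hr2 : 0 ≤ r2 := le_trans (Finset.sum_nonneg fun i _ => sq_nonneg _) hδ
  have hmR : (1 : ℝ) ≤ m := by exact_mod_cast hm1
  obtain ⟨n, hn⟩ : ∃ n : ℝ, n = (T.card : ℝ) := ⟨_, rfl⟩
  rw [← hn]
  have hn0 : 0 ≤ n := by rw [hn]; positivity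
  set c : MI d Q K → ℝ := fun i => ∑ q ∈ T, 1 * lco d Q K (rep q) i with hc
  have h1 : n * e ≤ dt c δ := by
    rw [hc, ← dt_sum T (fun _ => 1) (fun q => lco d Q K (rep q)) δ, hn, ← nsmul_eq_mul, ← Finset.sum_const]
    exact Finset.sum_le_sum fun q hq => by rw [one_mul]; exact hbad q hq
  have h2 : (dt c δ) ^ 2 ≤ dt c c * r2 := by
    have := Finset.sum_mul_sq_le_sq_mul_sq Finset.univ c δ
    refine this.trans ?_
    have e : ∑ i, c i ^ 2 = dt c c := Finset.sum_congr rfl fun i _ => by ring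
    rw [e]
    exact mul_le_mul_of_nonneg_left hδ (Finset.sum_nonneg fun i _ => mul_self_nonneg _)
  have h3 : dt c c ≤ n * (C * (1 + 3 ^ d + n / m ^ 9)) := by
    have e : dt c c = ∑ q ∈ T, ∑ q' ∈ T, Gloc d K (rep q) (rep q') := by
      conv_lhs => rw [hc, ← dt_sum T (fun _ => 1) (fun q => lco d Q K (rep q))]
      refine Finset.sum_congr rfl fun q hq => ?_
      rw [dt_comm, ← dt_sum T (fun _ => 1) (fun q => lco d Q K (rep q)), one_mul]
      refine Finset.sum_congr rfl fun q' hq' => ?_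
      rw [one_mul, dt_comm, lco_dot hd Q K (hrep q hq).2]
    rw [e, hn, ← nsmul_eq_mul, ← Finset.sum_const]
    refine Finset.sum_le_sum fun q hq => ?_
    have hpt : ∀ q' ∈ T, Gloc d K (rep q) (rep q') ≤ (if q' = q then C else 0) + (if q' ∈ fbx q (m ^ 2) then C / m ^ (2 * d) else 0) + C / m ^ 9 := by
      intro q' hq'
      refine (Gloc_le d K _ _).trans ?_
      obtain ⟨g1, g2⟩ := hC (rep q) (rep q')
      obtain ⟨g3, g4⟩ := g2 m hm1
      have p1 : (0 : ℝ) ≤ C / m ^ 9 := by positivity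
      have p2 : (0 : ℝ) ≤ C / m ^ (2 * d) := by positivity
      by_cases hqq : q' = q
      · rw [if_pos hqq]
        have : (0 : ℝ) ≤ (if q' ∈ fbx q (m ^ 2) then C / m ^ (2 * d) else 0) := by split_ifs <;> simp [p2]
        linarith
      · rw [if_neg hqq]
        by_cases hcl : q' ∈ fbx q (m ^ 2)
        · rw [if_pos hcl]
          have : ∃ i, q i ≠ q' i := by
            by_contra hh; push Not at hh; exact hqq (by ext i; rw [hh i])
          obtain ⟨i, hi⟩ := this
          have hp := hpar q hq q' hq' i
          have hab : (1 : ℤ) + 1 ≤ |q i - q' i| := by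
            obtain ⟨t, ht⟩ := hp
            have : t ≠ 0 := fun h => hi (by rw [h] at ht; linarith)
            rw [ht, abs_mul]
            have := Int.one_le_abs this
            norm_num; linarith
          have := cub_far (v := m ^ 8) (by positivity) (a := rep q) (b := rep q') (i := i) (k := 1) (by
            rw [(hrep q hq).1, (hrep q' hq').1]; exact_mod_cast hab)
          have := g3 ⟨i, by simpa using this⟩
          linarith
        · rw [if_neg hcl]
          rw [mem_fbx, dinf_le] at hcl
          push Not at hcl
          obtain ⟨i, hi⟩ := hcl
          have := cub_far (v := m ^ 8) (by positivity) (a := rep q) (b := rep q') (i := i) (k := m ^ 2) (by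
            rw [(hrep q hq).1, (hrep q' hq').1]; omega)
          have := g4 ⟨i, by rw [← pow_add] at this; exact this⟩
          linarith
    refine (Finset.sum_le_sum hpt).trans ?_
    rw [Finset.sum_add_distrib, Finset.sum_add_distrib, Finset.sum_ite_eq', if_pos hq, Finset.sum_const, nsmul_eq_mul,
      ← Finset.sum_filter, Finset.sum_const, nsmul_eq_mul]
    have hcard : ((T.filter fun q' => q' ∈ fbx q (m ^ 2)).card : ℝ) ≤ 3 ^ d * m ^ (2 * d) := by
      have : (T.filter fun q' => q' ∈ fbx q (m ^ 2)).card ≤ (fbx q (m ^ 2)).card :=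
        Finset.card_le_card fun z hz => (Finset.mem_filter.1 hz).2
      rw [card_fbx] at this
      have h5 : (2 * m ^ 2 + 1) ^ d ≤ 3 ^ d * m ^ (2 * d) := by
        rw [pow_mul, ← mul_pow]
        refine Nat.pow_le_pow_left ?_ _
        have : 1 ≤ m ^ 2 := Nat.one_le_pow _ _ hm1
        omega
      exact_mod_cast this.trans h5
    have h6 : ((T.filter fun q' => q' ∈ fbx q (m ^ 2)).card : ℝ) * (C / m ^ (2 * d)) ≤ 3 ^ d * C := by
      calc _ ≤ (3 ^ d * (m : ℝ) ^ (2 * d)) * (C / m ^ (2 * d)) := by gcongr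
        _ = 3 ^ d * C := by field_simp
    have h7 : (T.card : ℝ) * (C / m ^ 9) = C * (n / m ^ 9) := by rw [← hn]; ring
    rw [h7, ← hn]; linarith
  have h4 : (n * e) ^ 2 ≤ n * (C * (1 + 3 ^ d + n / m ^ 9)) * r2 :=
    (pow_le_pow_left₀ (by positivity) h1 2).trans (h2.trans (mul_le_mul_of_nonneg_right h3 hr2))
  rcases hn0.eq_or_lt with h0 | h0
  · rw [← h0]; simp; positivity
  have h5 : n * e ^ 2 ≤ C * (1 + 3 ^ d + n / m ^ 9) * r2 := by
    have : n * (n * e ^ 2) ≤ n * (C * (1 + 3 ^ d + n / m ^ 9) * r2) := by nlinarith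
    exact le_of_mul_le_mul_left this h0
  have h6 : 2 * (C * (n / m ^ 9) * r2) ≤ n * e ^ 2 := by
    have : 2 * (C * (n / m ^ 9) * r2) = n * ((2 * r2 * C) / m ^ 9) := by ring
    rw [this]
    refine mul_le_mul_of_nonneg_left ?_ hn0
    rw [div_le_iff₀ (by positivity)]; exact hm
  nlinarith

lemma reroute_leg (hd : 3 ≤ d) {Q K : ℕ} {C : ℝ} (hC : GreenC d C) {m : ℕ} (hm1 : 1 ≤ m) {ξ ξ' : MI d Q K → ℝ} {r2 e h : ℝ}
    (hδ : ∑ i, (ξ' i - ξ i) ^ 2 ≤ r2) (he : 0 < e) (hm : 2 * r2 * C ≤ e ^ 2 * m ^ 9) {c a b : V d} {r : ℕ} (hcQ : dinf 0 c + r ≤ Q)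
    (hA : Cn {z | dinf c z ≤ r ∧ h ≤ dt (lco d Q K z) ξ'} a b) (n0 : ℕ)
    (hn0 : 2 ^ d * (2 * r2 * C * (1 + 3 ^ d)) / e ^ 2 ≤ n0) :
    ∃ E : Finset (V d), E.card ≤ n0 * (d * m ^ 8 + 1) ∧ (∀ z ∈ E, dinf c z ≤ r + m ^ 8) ∧
      Cn ({z | dinf c z ≤ r ∧ h - e ≤ dt (lco d Q K z) ξ} ∪ E) a b := by
  classical
  have hv : 0 < m ^ 8 := by positivity
  set δ : MI d Q K → ℝ := fun i => ξ' i - ξ i with hδd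
  set bad := (fbx c r).filter (fun z => e ≤ dt (lco d Q K z) δ) with hbad
  set qs := bad.image (cub (m ^ 8)) with hqs
  have hex : ∀ q, ∃ z, q ∈ qs → z ∈ bad ∧ cub (m ^ 8) z = q := by
    intro q
    by_cases hq : q ∈ qs
    · obtain ⟨z, hz, hz2⟩ := Finset.mem_image.1 hq
      exact ⟨z, fun _ => ⟨hz, hz2⟩⟩
    · exact ⟨0, fun h => absurd h hq⟩
  choose rep hrep using hex
  set par : V d → (Fin d → Bool) := fun q i => decide ((2 : ℤ) ∣ q i) with hpar
  have hcl : ∀ π, (((qs.filter fun q => par q = π).card : ℝ)) * e ^ 2 ≤ 2 * r2 * C * (1 + 3 ^ d) := by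
    intro π
    refine count_class hd hC hm1 (qs.filter fun q => par q = π) rep (fun q hq => ?_) (fun q hq q' hq' i => ?_) δ r2 e hδ he
      (fun q hq => ?_) hm
    · have := hrep q (Finset.mem_filter.1 hq).1
      refine ⟨this.2, ?_⟩
      have h2 := mem_fbx.1 (Finset.mem_filter.1 this.1).1
      have := dinf_tri 0 c (rep q)
      omega
    · have h1 := congrFun ((Finset.mem_filter.1 hq).2.trans (Finset.mem_filter.1 hq').2.symm) i
      simp only [hpar, decide_eq_decide] at h1
      omega
    · exact (Finset.mem_filter.1 (hrep q (Finset.mem_filter.1 hq).1).1).2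
  have hcard : qs.card ≤ n0 := by
    have h1 : qs.card = ∑ π : Fin d → Bool, (qs.filter fun q => par q = π).card :=
      Finset.card_eq_sum_card_fiberwise fun _ _ => Finset.mem_coe.2 (Finset.mem_univ _)
    have h2 : (qs.card : ℝ) * e ^ 2 ≤ 2 ^ d * (2 * r2 * C * (1 + 3 ^ d)) := by
      rw [h1]; push_cast
      rw [Finset.sum_mul]
      refine (Finset.sum_le_sum fun π _ => hcl π).trans ?_
      simp
    have h3 : (qs.card : ℝ) ≤ n0 := by
      refine le_trans ?_ hn0
      rw [le_div_iff₀ (by positivity)]; exact h2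
    exact_mod_cast h3
  have hA' : Cn ({z | dinf c z ≤ r ∧ h - e ≤ dt (lco d Q K z) ξ} ∪ {z | cub (m ^ 8) z ∈ qs}) a b := by
    refine hA.mono fun z hz => ?_
    by_cases hzb : e ≤ dt (lco d Q K z) δ
    · right
      exact Finset.mem_image_of_mem _ (Finset.mem_filter.2 ⟨mem_fbx.2 hz.1, hzb⟩)
    · left
      refine ⟨hz.1, ?_⟩
      have e1 : dt (lco d Q K z) δ = dt (lco d Q K z) ξ' - dt (lco d Q K z) ξ := by
        simp [dt, hδd, mul_sub, Finset.sum_sub_distrib]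
      have := hz.2
      linarith
  obtain ⟨E, hE1, hE2, hE3⟩ := reroute hv qs _ a b hA'
  refine ⟨E, hE1.trans (Nat.mul_le_mul_right _ hcard), fun z hz => ?_, hE3⟩
  obtain ⟨w, hw, hwz⟩ := Finset.mem_image.1 (hE2 z hz)
  have h1 := mem_fbx.1 (Finset.mem_filter.1 hw).1
  have h2 : dinf w z ≤ m ^ 8 := dinf_le.2 fun i => by
    have := cub_close (k := 0) hv (a := w) (b := z) (i := i) (by rw [hwz]; simp)
    push_cast at this ⊢; linarith
  have := dinf_tri c w z
  omega

end count

section windows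
variable {d : ℕ}

def WG (d Q K U W m1 : ℕ) (hl M : ℝ) (x : V d) : Set (MI d Q K → ℝ) :=
  {ξ | (∀ z, dinf x z ≤ W → -M ≤ dt (inrOnly (lco d Q K z)) ξ) ∧ ∀ a b, dinf x a ≤ U + 1 → dinf x b ≤ U + 1 →
    ∃ E : Finset (V d), E.card ≤ m1 ∧ (∀ z ∈ E, dinf x z ≤ W) ∧ Cn ({z | dinf x z ≤ W ∧ hl ≤ dt (lco d Q K z) ξ} ∪ E) a b}

def WI (d Q K W : ℕ) (x : V d) : MI d Q K → Prop
  | Sum.inl z => dinf x z ≤ W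
  | Sum.inr (Sum.inl (_, z)) => dinf x z ≤ W + K
  | Sum.inr (Sum.inr _) => False

open Classical in
lemma wg_dep (Q K U W m1 : ℕ) (hl M : ℝ) (x : V d) :
    DepOn (WG d Q K U W m1 hl M x)ᶜ (Finset.univ.filter (WI d Q K W x)) := by
  intro ξ ξ' hξ h
  have key : ∀ z, dinf x z ≤ W → ∀ i, lco d Q K z i * ξ i = lco d Q K z i * ξ' i := by
    intro z hz i
    by_cases hi : WI d Q K W x i
    · rw [hξ i (Finset.mem_filter.2 ⟨Finset.mem_univ _, hi⟩)]
    · have : lco d Q K z i = 0 := by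
        rcases i with w | ⟨k, w⟩ | w
        · simp only [lco]
          rw [if_neg]
          rintro rfl
          exact hi hz
        · refine lco_supp Q K z w k ?_
          by_contra hc
          have := dinf_tri x z w
          exact hi (show dinf x w ≤ W + K by omega)
        · rfl
      rw [this]; simp
  have k1 : ∀ z, dinf x z ≤ W → dt (lco d Q K z) ξ = dt (lco d Q K z) ξ' := fun z hz =>
    Finset.sum_congr rfl fun i _ => key z hz i
  have k2 : ∀ z, dinf x z ≤ W → dt (inrOnly (lco d Q K z)) ξ = dt (inrOnly (lco d Q K z)) ξ' := fun z hz =>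
    Finset.sum_congr rfl fun i _ => by
      rcases i with w | w
      · simp [inrOnly]
      · exact key z hz _
  have k3 : {z | dinf x z ≤ W ∧ hl ≤ dt (lco d Q K z) ξ} = {z | dinf x z ≤ W ∧ hl ≤ dt (lco d Q K z) ξ'} := by
    ext z
    simp only [mem_ofPred_eq]
    exact and_congr_right fun hz => by rw [k1 z hz]
  intro h'
  refine h ⟨fun z hz => by rw [k2 z hz]; exact h'.1 z hz, ?_⟩
  rw [k3]; exact h'.2

lemma wg_meas (Q K U W m1 : ℕ) (hl M : ℝ) (x : V d) : MeasurableSet (WG d Q K U W m1 hl M x) := by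
  have := meas_cfg (α := ↥(fbx x W) ⊕ ↥(fbx x W)) (Ω := MI d Q K → ℝ)
      (Sum.elim (fun z => dt (lco d Q K z)) (fun z => dt (inrOnly (lco d Q K z))))
      (by rintro (i | i) <;> exact dt_meas _) (Sum.elim (fun _ => hl) (fun _ => -M))
      (fun S => (∀ z, ∀ hz : dinf x z ≤ W, Sum.inr ⟨z, mem_fbx.2 hz⟩ ∈ S) ∧ ∀ a b, dinf x a ≤ U + 1 → dinf x b ≤ U + 1 →
        ∃ E : Finset (V d), E.card ≤ m1 ∧ (∀ z ∈ E, dinf x z ≤ W) ∧ Cn ({z | ∃ hz : dinf x z ≤ W, Sum.inl ⟨z, mem_fbx.2 hz⟩ ∈ S} ∪ E) a b)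
  simpa [WG] using this

lemma wins_prob {Q K U W m1 k sep r0 : ℕ} {hl M : ℝ} (q : ENNReal)
    (hq : ∀ x, dinf 0 x + W ≤ Q → stdG (MI d Q K) (WG d Q K U W m1 hl M x)ᶜ ≤ q) (hQ : r0 + k * sep + W ≤ Q) (hsep : 2 * (W + K) < sep) :
    stdG (MI d Q K) {ξ | ∃ y, dinf 0 y ≤ r0 ∧ ∃ xs : ℕ → V d, (∀ j, 1 ≤ j → j ≤ k → dinf y (xs j) = j * sep) ∧
      ∀ j, 1 ≤ j → j ≤ k → ξ ∉ WG d Q K U W m1 hl M (xs j)} ≤ (2 * r0 + 1) ^ d * ((2 * (k * sep) + 1) ^ d * q) ^ k := by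
  classical
  set F : V d → Finset (Fin k → V d) := fun y => (Fintype.piFinset fun _ : Fin k => fbx y (k * sep)).filter
    (fun f => ∀ j : Fin k, dinf y (f j) = (j + 1) * sep) with hF
  have hsub : {ξ | ∃ y, dinf 0 y ≤ r0 ∧ ∃ xs : ℕ → V d, (∀ j, 1 ≤ j → j ≤ k → dinf y (xs j) = j * sep) ∧
      ∀ j, 1 ≤ j → j ≤ k → ξ ∉ WG d Q K U W m1 hl M (xs j)} ⊆ ⋃ y ∈ fbx (0 : V d) r0, ⋃ f ∈ F y,
        {ξ | ∀ j ∈ (Finset.univ : Finset (Fin k)), ξ ∈ (WG d Q K U W m1 hl M (f j))ᶜ} := by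
    rintro ξ ⟨y, hy, xs, h1, h2⟩
    simp only [mem_iUnion]
    refine ⟨y, mem_fbx.2 hy, fun j => xs (j + 1), ?_, fun j _ => h2 _ (by omega) (by omega)⟩
    refine Finset.mem_filter.2 ⟨Fintype.mem_piFinset.2 fun j => mem_fbx.2 ?_, fun j => h1 _ (by omega) (by omega)⟩
    rw [h1 _ (by omega) (by omega)]
    exact Nat.mul_le_mul_right _ (by omega)
  refine (measure_mono hsub).trans ((measure_biUnion_finset_le _ _).trans ?_)
  have hy : ∀ y ∈ fbx (0 : V d) r0, stdG (MI d Q K) (⋃ f ∈ F y, {ξ | ∀ j ∈ (Finset.univ : Finset (Fin k)), ξ ∈ (WG d Q K U W m1 hl M (f j))ᶜ}) ≤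
      ((2 * (k * sep) + 1) ^ d * q) ^ k := by
    intro y hy
    rw [mem_fbx] at hy
    have hf : ∀ f ∈ F y, stdG (MI d Q K) {ξ | ∀ j ∈ (Finset.univ : Finset (Fin k)), ξ ∈ (WG d Q K U W m1 hl M (f j))ᶜ} ≤ q ^ k := by
      intro f hf
      have hf2 := (Finset.mem_filter.1 hf).2
      unfold stdG
      rw [indep_many (fun _ : MI d Q K => gaussianReal 0 1) (Finset.univ : Finset (Fin k)) (fun j => (WG d Q K U W m1 hl M (f j))ᶜ)
        (fun j => Finset.univ.filter (WI d Q K W (f j))) (fun j _ => (wg_meas Q K U W m1 hl M (f j)).compl)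
        (fun j _ => wg_dep Q K U W m1 hl M (f j)) ?_]
      · refine (Finset.prod_le_prod' fun j _ => hq (f j) ?_).trans (by simp)
        have h1 := dinf_tri 0 y (f j)
        rw [hf2 j] at h1
        have : (j + 1) * sep ≤ k * sep := Nat.mul_le_mul_right _ (by omega)
        omega
      · intro j _ j' _ hjj
        have hfar : 2 * (W + K) < dinf (f j) (f j') := by
          have h1 := hf2 j
          have h2 := hf2 j'
          have t1 := dinf_tri y (f j) (f j')
          have t2 := dinf_tri y (f j') (f j)
          rw [dinf_comm (f j') (f j)] at t2
          rcases lt_or_gt_of_ne (fun h => hjj (Fin.ext h) : (j : ℕ) ≠ j') with h | h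
          · have : (j + 1 + 1) * sep ≤ (j' + 1) * sep := Nat.mul_le_mul_right _ (by omega)
            rw [add_mul _ 1, one_mul] at this; omega
          · have : (j' + 1 + 1) * sep ≤ (j + 1) * sep := Nat.mul_le_mul_right _ (by omega)
            rw [add_mul _ 1, one_mul] at this; omega
        rw [Finset.disjoint_left]
        intro i hi hi'
        have a1 := (Finset.mem_filter.1 hi).2
        have a2 := (Finset.mem_filter.1 hi').2
        rcases i with w | ⟨_, w⟩ | w
        · simp only [WI] at a1 a2
          have := dinf_tri (f j) w (f j'); rw [dinf_comm (w : V d)] at this; omega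
        · simp only [WI] at a1 a2
          have := dinf_tri (f j) w (f j'); rw [dinf_comm (w : V d)] at this; omega
        · exact a1
    refine (measure_biUnion_finset_le _ _).trans ((Finset.sum_le_sum hf).trans ?_)
    rw [Finset.sum_const, nsmul_eq_mul, mul_pow]
    refine mul_le_mul_left ?_ _
    have : (F y).card ≤ ((2 * (k * sep) + 1) ^ d) ^ k := by
      refine (Finset.card_filter_le _ _).trans ?_
      rw [Fintype.card_piFinset]; simp [card_fbx]
    exact_mod_cast this
  refine (Finset.sum_le_sum hy).trans ?_
  rw [Finset.sum_const, nsmul_eq_mul, card_fbx]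
  push_cast; rfl

lemma wg_prob (hd : 3 ≤ d) {Q K U W n0 m : ℕ} {C : ℝ} (hC : GreenC d C) {h e r2 M : ℝ} (L : Set (V d)) (pl : ENNReal) (hpl : pl ≠ 0)
    (hpl1 : pl ≠ ⊤) (hL0 : ∀ y ∈ L, dinf 0 y ≤ U + 1) (hL : ∀ ρ, ρ ≤ U + 1 → ∃ y ∈ L, dinf 0 y = ρ)
    (hL2 : ∀ y ∈ L, ∀ σ s, (∀ i, s i = 1 ∨ s i = -1) → sperm σ s y ∈ L)
    (hA : ∀ c, dinf 0 c + (U + 1) ≤ Q → ∀ y ∈ L, pl ≤ stdG (MI d Q K) {ξ | Cn {z | dinf c z ≤ U + 1 ∧ h ≤ dt (lco d Q K z) ξ} c (c + y)})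
    (hm1 : 1 ≤ m) (he : 0 < e) (hM : 0 ≤ M) (hm : 2 * r2 * C ≤ e ^ 2 * m ^ 9) (hn0 : 2 ^ d * (2 * r2 * C * (1 + 3 ^ d)) / e ^ 2 ≤ n0)
    (hW : 3 * U + 3 + m ^ 8 ≤ W) (x : V d) (hx : dinf 0 x + W ≤ Q) :
    stdG (MI d Q K) (WG d Q K U W (d * (2 * (n0 * (d * m ^ 8 + 1)) + 2) + 1) (h - e) M x)ᶜ ≤
      (4 * U + 5) ^ d * (2 * U + 3) ^ d * (ENNReal.ofReal (Real.exp (-r2 / 4)) / pl) +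
      (2 * W + 1) ^ d * ENNReal.ofReal (Real.exp (-M ^ 2 / (2 * C))) := by
  classical
  set A : V d → V d → Set (MI d Q K → ℝ) := fun c y => {ξ | Cn {z | dinf c z ≤ U + 1 ∧ h ≤ dt (lco d Q K z) ξ} c (c + y)} with hAd
  set bd : V d → V d → Set (MI d Q K → ℝ) := fun c y => {ξ | ∀ a ∈ A c y, r2 ≤ ∑ i, (a i - ξ i) ^ 2} with hbd
  have mA : ∀ c y, MeasurableSet (A c y) := by
    intro c y
    have := meas_cfg (α := ↥(fbx c (U + 1))) (Ω := MI d Q K → ℝ) (fun z => dt (lco d Q K z)) (fun _ => dt_meas _) (fun _ => h)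
      (fun S => Cn {z | ∃ hz : dinf c z ≤ U + 1, ⟨z, mem_fbx.2 hz⟩ ∈ S} c (c + y))
    simpa [hAd] using this
  have hsub : (WG d Q K U W (d * (2 * (n0 * (d * m ^ 8 + 1)) + 2) + 1) (h - e) M x)ᶜ ⊆
      (⋃ c ∈ fbx x (2 * U + 2), ⋃ y ∈ (fbx (0 : V d) (U + 1)).filter (· ∈ L), bd c y) ∪
      ⋃ z ∈ fbx x W, {ξ | M ≤ dt (fun i => - inrOnly (lco d Q K z) i) ξ} := by
    intro ξ hξ
    by_contra hcon
    simp only [mem_union, mem_iUnion, not_or, not_exists] at hcon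
    obtain ⟨c1, c2⟩ := hcon
    refine hξ ⟨fun z hz => ?_, ?_⟩
    · have := c2 z (mem_fbx.2 hz)
      simp only [mem_ofPred_eq, not_le] at this
      have e1 : dt (fun i => - inrOnly (lco d Q K z) i) ξ = - dt (inrOnly (lco d Q K z)) ξ := by
        simp [dt]
      linarith
    · refine legs_connect (by omega) hL hL2 (fun c hc y hy => ?_) (by omega)
      have := c1 c (mem_fbx.2 hc) y (Finset.mem_filter.2 ⟨mem_fbx.2 (hL0 y hy), hy⟩)
      simp only [hbd, mem_ofPred_eq] at this
      push Not at this
      obtain ⟨ξ', h1, h2⟩ := this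
      have t1 := dinf_tri 0 x c
      obtain ⟨E, hE1, hE2, hE3⟩ := reroute_leg hd hC hm1 h2.le he hm (c := c) (r := U + 1) (by omega) h1 n0 hn0
      refine ⟨E, hE1, fun z hz => ?_, hE3.mono ?_⟩
      · have := hE2 z hz
        have := dinf_tri x c z
        omega
      · refine Set.union_subset_union_left _ fun z hz => ⟨?_, hz.2⟩
        have := hz.1
        have := dinf_tri x c z
        omega
  have hb : ∀ c ∈ fbx x (2 * U + 2), ∀ y ∈ (fbx (0 : V d) (U + 1)).filter (· ∈ L), stdG (MI d Q K) (bd c y) ≤ ENNReal.ofReal (Real.exp (-r2 / 4)) / pl := by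
    intro c hc y hy
    rw [mem_fbx] at hc
    have t1 := dinf_tri 0 x c
    have h1 := hA c (by omega) y (Finset.mem_filter.1 hy).2
    rw [ENNReal.le_div_iff_mul_le (.inl hpl) (.inl hpl1), mul_comm]
    exact (mul_le_mul_left h1 _).trans (iso_gauss (A c y) (mA c y) r2)
  have ht : ∀ z ∈ fbx x W, stdG (MI d Q K) {ξ | M ≤ dt (fun i => - inrOnly (lco d Q K z) i) ξ} ≤ ENNReal.ofReal (Real.exp (-M ^ 2 / (2 * C))) := by
    intro z hz
    rw [mem_fbx] at hz
    refine dt_tail _ C M hC.1 ?_ hM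
    have t1 := dinf_tri 0 x z
    have h1 := lco_dot hd Q K (x := z) (y := z) (by omega)
    have h2 := (Gloc_le d K z z).trans (hC.2 z z).1
    rw [← h1] at h2
    refine le_trans ?_ h2
    refine Finset.sum_le_sum fun i _ => ?_
    rcases i with w | w
    · simp [inrOnly]; exact mul_self_nonneg _
    · simp [inrOnly]
  refine (measure_mono hsub).trans ((measure_union_le _ _).trans (add_le_add ?_ ?_))
  · refine (measure_biUnion_finset_le _ _).trans ((Finset.sum_le_sum fun c hc => (measure_biUnion_finset_le _ _).trans (Finset.sum_le_sum (hb c hc))).trans ?_)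
    rw [Finset.sum_const, Finset.sum_const, nsmul_eq_mul, nsmul_eq_mul, card_fbx, ← mul_assoc]
    refine mul_le_mul_left (mul_le_mul' ?_ ?_) _
    · refine le_of_eq ?_; push_cast; ring
    · have : ((fbx (0 : V d) (U + 1)).filter (· ∈ L)).card ≤ (2 * U + 3) ^ d := by
        refine (Finset.card_filter_le _ _).trans ?_
        rw [card_fbx]; exact (congrArg (· ^ d) (by ring)).le
      exact_mod_cast this
  · refine (measure_biUnion_finset_le _ _).trans ((Finset.sum_le_sum ht).trans ?_)
    rw [Finset.sum_const, nsmul_eq_mul, card_fbx]; push_cast; rfl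

end windows

section legloc
variable {d : ℕ}

lemma dt_neg_left {ι : Type*} [Fintype ι] (a c : ι → ℝ) : dt (fun i => - a i) c = - dt a c := by
  simp [dt]

lemma yco_dot {Q K : ℕ} (B : V d → ↥(fbx (0 : V d) Q) → ℝ) (x y : V d) : dt (yco K B x) (yco K B y) = dt (B x) (B y) := by
  simp [dt, yco]

lemma y_tail {Q K : ℕ} (B : V d → ↥(fbx (0 : V d) Q) → ℝ)
    (hB : ∀ x ∈ fbx 0 Q, ∀ y ∈ fbx 0 Q, dt (B x) (B y) = GY d K x y) (s : Finset (V d)) (hs : ∀ x ∈ s, dinf 0 x ≤ Q)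
    {v δ : ℝ} (hv : 0 < v) (hY : ∀ x, GY d K x x ≤ v) (hδ : 0 ≤ δ) :
    stdG (MI d Q K) {ξ | ∃ z ∈ s, δ ≤ |dt (yco K B z) ξ|} ≤ s.card * (2 * ENNReal.ofReal (Real.exp (-δ ^ 2 / (2 * v)))) := by
  have hsub : {ξ : MI d Q K → ℝ | ∃ z ∈ s, δ ≤ |dt (yco K B z) ξ|} ⊆
      ⋃ z ∈ s, ({ξ | δ ≤ dt (yco K B z) ξ} ∪ {ξ | δ ≤ dt (fun i => - yco K B z i) ξ}) := by
    rintro ξ ⟨z, hz, h⟩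
    simp only [mem_iUnion, mem_union, mem_ofPred_eq, dt_neg_left]
    exact ⟨z, hz, le_abs.1 h⟩
  refine (measure_mono hsub).trans ((measure_biUnion_finset_le _ _).trans ?_)
  rw [← nsmul_eq_mul]
  refine Finset.sum_le_card_nsmul _ _ _ fun z hz => (measure_union_le _ _).trans ?_
  have hz' : z ∈ fbx (0 : V d) Q := mem_fbx.2 (hs z hz)
  have h1 : dt (yco K B z) (yco K B z) ≤ v := by rw [yco_dot, hB z hz' z hz']; exact hY z
  rw [two_mul]
  refine add_le_add (dt_tail _ v δ hv h1 hδ) (dt_tail _ v δ hv ?_ hδ)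
  rw [dt_neg_left, dt_comm, dt_neg_left, neg_neg]; exact h1

variable {Ω : Type*} [MeasurableSpace Ω] (P : Measure Ω) [IsProbabilityMeasure P] (φ : V d → Ω → ℝ)

lemma leg_local (hd : 3 ≤ d) (hφ : IsGFF P φ) {Q K U : ℕ} (B : V d → ↥(fbx (0 : V d) Q) → ℝ)
    (hB : ∀ x ∈ fbx 0 Q, ∀ y ∈ fbx 0 Q, dt (B x) (B y) = GY d K x y) (h δ : ℝ) (p1 q1 : ENNReal)
    (hY : ∀ c, dinf 0 c + (U + 1) ≤ Q → stdG (MI d Q K) {ξ | ∃ z ∈ fbx c (U + 1), δ ≤ |dt (yco K B z) ξ|} ≤ q1)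
    (y : V d) (hy : p1 ≤ P {ω | Cn (lvl φ h ω ∩ {z | dinf 0 z ≤ U + 1}) 0 y}) (c : V d) (hc : dinf 0 c + (U + 1) ≤ Q) :
    p1 - q1 ≤ stdG (MI d Q K) {ξ | Cn {z | dinf c z ≤ U + 1 ∧ h - δ ≤ dt (lco d Q K z) ξ} c (c + y)} := by
  have h1 := leg_move P φ hφ (sym_transl c) h (U + 1) 0 0 y
  simp only [zero_add] at h1
  have e : ∀ ω, lvl φ h ω ∩ {z | dinf c z ≤ U + 1} = {z | z ∈ fbx c (U + 1) ∧ h ≤ φ z ω} := by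
    intro ω; ext z; simp only [lvl, mem_inter_iff, mem_ofPred_eq, mem_fbx]; tauto
  have hs : ∀ z ∈ fbx c (U + 1), dinf 0 z ≤ Q := fun z hz => by
    have := dinf_tri 0 c z; have := mem_fbx.1 hz; omega
  have h2 := model_law hd P φ hφ Q K B hB (fbx c (U + 1)) hs h h (fun S _ => Cn S c (y + c))
  simp_rw [e] at h1
  rw [h2] at h1
  rw [tsub_le_iff_right]
  refine (hy.trans h1).trans (le_trans ?_ (add_le_add le_rfl (hY c hc)))
  refine (measure_mono ?_).trans (measure_union_le _ _)
  intro ξ hξ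
  by_cases hb : ∃ z ∈ fbx c (U + 1), δ ≤ |dt (yco K B z) ξ|
  · exact Or.inr hb
  · left
    push Not at hb
    simp only [mem_ofPred_eq] at hξ ⊢
    rw [add_comm c y]
    refine hξ.mono fun z hz => ?_
    simp only [mem_ofPred_eq] at hz ⊢
    refine ⟨mem_fbx.1 hz.1, ?_⟩
    have h3 := (abs_lt.1 (hb z hz.1)).2
    have h4 : dt (mco K B z) ξ = dt (lco d Q K z) ξ + dt (yco K B z) ξ := dt_add_left _ _ _
    linarith [hz.2]

lemma wg_prob' (hd : 3 ≤ d) (hφ : IsGFF P φ) {Q K U W n0 m R : ℕ} {C : ℝ} (hC : GreenC d C) {h0 e r2 M v : ℝ}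
    (B : V d → ↥(fbx (0 : V d) Q) → ℝ)
    (hB : ∀ x ∈ fbx 0 Q, ∀ y ∈ fbx 0 Q, dt (B x) (B y) = GY d K x y)
    (hv : 0 < v) (hY : ∀ x, GY d K x x ≤ v) (hR : 2 * U + 1 ≤ R)
    (hP : P {ω | ¬ ∃ a b, dinf 0 a ≤ U ∧ dinf 0 b = R ∧ Cn (lvl φ h0 ω) a b} ≤ 1 / 2)
    (hq1 : (2 * (U + 1 : ℕ) + 1 : ENNReal) ^ d * (2 * ENNReal.ofReal (Real.exp (-e ^ 2 / (2 * v)))) ≤ (8 * (2 * U + 3) ^ (2 * d) : ENNReal)⁻¹)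
    (hm1 : 1 ≤ m) (he : 0 < e) (hM : 0 ≤ M) (hm : 2 * r2 * C ≤ e ^ 2 * m ^ 9) (hn0 : 2 ^ d * (2 * r2 * C * (1 + 3 ^ d)) / e ^ 2 ≤ n0)
    (hW : 3 * U + 3 + m ^ 8 ≤ W) (x : V d) (hx : dinf 0 x + W ≤ Q) :
    stdG (MI d Q K) (WG d Q K U W (d * (2 * (n0 * (d * m ^ 8 + 1)) + 2) + 1) (h0 - e - e) M x)ᶜ ≤
      (4 * U + 5) ^ d * (2 * U + 3) ^ d * (ENNReal.ofReal (Real.exp (-r2 / 4)) * (8 * (2 * U + 3) ^ (2 * d))) +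
      (2 * W + 1) ^ d * ENNReal.ofReal (Real.exp (-M ^ 2 / (2 * C))) := by
  have hA0 : (2 * U + 3 : ENNReal) ^ (2 * d) ≠ 0 := by simp
  have hA1 : (2 * U + 3 : ENNReal) ^ (2 * d) ≠ ⊤ := by
    refine ENNReal.pow_ne_top ?_; exact_mod_cast ENNReal.natCast_ne_top (2 * U + 3)
  set p8 := (8 * (2 * U + 3) ^ (2 * d) : ENNReal)⁻¹ with hp8
  have hp8' : (4 * (2 * U + 3) ^ (2 * d) : ENNReal)⁻¹ = p8 + p8 := by
    rw [hp8, ← two_mul, show (8 * (2 * U + 3) ^ (2 * d) : ENNReal) = 2 * (4 * (2 * U + 3) ^ (2 * d)) by rw [← mul_assoc]; norm_num,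
      ENNReal.mul_inv (a := 2) (Or.inl (by norm_num)) (Or.inl (by norm_num)),
      ← mul_assoc, ENNReal.mul_inv_cancel (by norm_num) (by norm_num), one_mul]
  have hp0 : p8 ≠ 0 := by rw [hp8]; exact ENNReal.inv_ne_zero.2 (ENNReal.mul_ne_top (by norm_num) hA1)
  have hpt : p8 ≠ ⊤ := by rw [hp8]; exact ENNReal.inv_ne_top.2 (mul_ne_zero (by norm_num) hA0)
  have key := wg_prob hd hC (Q := Q) (K := K) (U := U) (h := h0 - e) (M := M)
    {y | dinf 0 y ≤ U + 1 ∧ (4 * (2 * U + 3) ^ (2 * d) : ENNReal)⁻¹ ≤ P {ω | Cn (lvl φ h0 ω ∩ {z | dinf 0 z ≤ U + 1}) 0 y}}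
    p8 hp0 hpt (fun y hy => hy.1) ?_ ?_ ?_ hm1 he hM hm hn0 hW x hx
  · rw [div_eq_mul_inv, hp8, inv_inv] at key; exact key
  · intro ρ hρ
    obtain ⟨y, hy, hy'⟩ := leg_exists P φ (by omega) hφ h0 U R hR hP ρ hρ
    exact ⟨y, ⟨by omega, hy'⟩, hy⟩
  · rintro y ⟨hy, hy'⟩ σ s hs
    have h0' : sperm σ s (0 : V d) = 0 := by ext i; simp [sperm]
    refine ⟨?_, ?_⟩
    · have := (sym_sperm σ s hs).di 0 y
      rw [h0'] at this; omega
    · have := leg_move P φ hφ (sym_sperm σ s hs) h0 (U + 1) 0 0 y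
      rw [h0'] at this
      exact hy'.trans this
  · rintro c hc y ⟨hy, hy'⟩
    refine le_trans ?_ (leg_local P φ hd hφ B hB h0 e _ p8 ?_ y hy' c hc)
    · rw [hp8', ENNReal.add_sub_cancel_right hpt]
    · intro c hc
      have := y_tail B hB (fbx c (U + 1)) (fun z hz => by have := dinf_tri 0 c z; have := mem_fbx.1 hz; omega) hv hY he.le
      rw [card_fbx] at this
      refine this.trans (le_trans (le_of_eq ?_) hq1)
      push_cast; ring
end legloc

section core
variable {d : ℕ} {Ω : Type*} [MeasurableSpace Ω] (P : Measure Ω) [IsProbabilityMeasure P] (φ : V d → Ω → ℝ)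

def Rad (U R : ℕ) (S : Set (V d)) (x : V d) : Prop := ∃ a b, dinf x a ≤ U ∧ dinf x b = R ∧ Cn S a b

lemma dens_prob (hφ : IsGFF P φ) {U R : ℕ} (hU : U ≤ R) (h : ℝ) (x : V d) :
    P {ω | ¬ Rad U R (lvl φ h ω) x} ≤ P {ω | ¬ Rad U R (lvl φ h ω) 0} := by
  have h1 := gff_sym P φ hφ (fun z => z + x) (sym_transl x).inj (sym_transl x).srw (fbx 0 R) h h (fun S _ => ¬ Rad U R S 0)
  have e : {ω | ¬ Rad U R (lvl φ h ω) 0} = {ω | ¬ Rad U R {z | z ∈ fbx (0 : V d) R ∧ h ≤ φ z ω} 0} := by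
    ext ω
    simp only [mem_ofPred_eq, not_iff_not]
    constructor
    · rintro ⟨a, b, ha, hb, hab⟩
      obtain ⟨c, hc, hc'⟩ := hab.cross (x := 0) (r := R) (by omega) (by omega)
      exact ⟨a, c, ha, hc, hc'.mono fun z hz => And.intro (mem_fbx.2 hz.2) hz.1⟩
    · rintro ⟨a, b, ha, hb, hab⟩
      exact ⟨a, b, ha, hb, hab.mono fun z hz => hz.2⟩
  rw [e, h1]
  refine measure_mono fun ω hω => ?_
  simp only [mem_ofPred_eq] at hω ⊢
  contrapose! hω
  obtain ⟨a, b, ha, hb, hab⟩ := hω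
  have hτ := sym_transl x
  refine ⟨a + x, b + x, ?_, ?_, ?_⟩
  · have := hτ.di 0 a; simp only [zero_add] at this; omega
  · have := hτ.di 0 b; simp only [zero_add] at this; omega
  · exact Cn.map (fun z => z + x) hτ.ad (fun z hz => hz.2) hab

lemma eev_sub (hd : 0 < d) {N U r0 R : ℕ} {h ε : ℝ} (hε : 0 < ε) (hUN : U ≤ N) (hr0 : r0 + U ≤ 4 * N) (hR : 8 * N ≤ R) (ω : Ω)
    (hD : ∀ x, dinf 0 x ≤ r0 → Rad U R (lvl φ h ω) x) (hE : ω ∉ EEv d φ N h (h - ε)) :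
    (∀ x, dinf 0 x ≤ r0 → ∃ a ∈ Anch {z | z ∈ fbx (0 : V d) (4 * N) ∧ h ≤ φ z ω} (4 * N), dinf x a ≤ U) ∧
    BTFail (4 * N) (2 * N) {z | z ∈ fbx (0 : V d) (4 * N) ∧ h ≤ φ z ω} {z | z ∈ fbx (0 : V d) (4 * N) ∧ h - ε ≤ φ z ω} := by
  constructor
  · intro x hx
    obtain ⟨a, b, ha, hb, hab⟩ := hD x hx
    have t1 := dinf_tri 0 x a
    have t2 := dinf_tri x 0 b
    rw [dinf_comm x 0] at t2
    obtain ⟨c, hc, hc'⟩ := hab.cross (x := 0) (r := 4 * N) (by omega) (by omega)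
    exact ⟨a, ⟨c, hc, hc'.mono fun z hz => And.intro (mem_fbx.2 hz.2) hz.1⟩, ha⟩
  · by_contra hB
    apply hE
    have c4 : (4 * (N : ℝ)) = ((4 * N : ℕ) : ℝ) := by push_cast; ring
    have c2 : (2 * (N : ℝ)) = ((2 * N : ℕ) : ℝ) := by push_cast; ring
    have c6 : (6 * (N : ℝ)) = ((6 * N : ℕ) : ℝ) := by push_cast; ring
    have hS : ∀ t, lvl φ t ω ∩ boxAt 0 ((4 * N : ℕ) : ℝ) = {z | z ∈ fbx (0 : V d) (4 * N) ∧ t ≤ φ z ω} := by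
      intro t; ext z; simp only [lvl, mem_inter_iff, mem_ofPred_eq, mem_fbx, boxAt_iff]; tauto
    unfold EEv EEvAt
    simp only [mem_ofPred_eq]
    rw [c4, c2, c6]
    refine ⟨?_, ?_⟩
    · rw [connIn_iff]
      obtain ⟨a, b, ha, hb, hab⟩ := hD 0 (by rw [dinf_self]; omega)
      obtain ⟨c, hc, hc'⟩ := hab.cross (x := 0) (r := 6 * N) (by omega) (by omega)
      exact ⟨a, boxAt_iff.2 (by omega), c, (bdryAt_iff hd).2 hc, hc'.mono inter_subset_left⟩
    · simp only [hS]
      set X := {z | z ∈ fbx (0 : V d) (4 * N) ∧ h ≤ φ z ω}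
      set Y := {z | z ∈ fbx (0 : V d) (4 * N) ∧ h - ε ≤ φ z ω}
      have hXY : X ⊆ Y := fun z hz => ⟨hz.1, by linarith [hz.2]⟩
      have hcomp : ∀ x y, y ∈ comp X x ↔ Cn X x y := by
        intro x y; simp only [comp, mem_ofPred_eq, connIn_iff]; simp
      rintro x hx y hy ⟨a, ha1, ha2⟩ ⟨a', ha1', ha2'⟩ ⟨b, hb1, hb2⟩ ⟨b', hb1', hb2'⟩
      rw [hcomp] at ha1 ha1' hb1 hb1'
      rw [boxAt_iff] at ha2 hb2
      rw [bdryAt_iff hd] at ha2' hb2'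
      have : Cn Y a b := by
        by_contra hc
        exact hB ⟨a, ⟨a', ha2', ha1.symm.trans ha1'⟩, b, ⟨b', hb2', hb1.symm.trans hb1'⟩, ha2, hb2, hc⟩
      rw [connIn_iff]
      exact ⟨x, rfl, y, rfl, ((ha1.mono hXY).trans this).trans (hb1.mono hXY).symm⟩

lemma inrOnly_mco {Q K : ℕ} (B : V d → ↥(fbx (0 : V d) Q) → ℝ) (z : V d) (ξ : MI d Q K → ℝ) :
    dt (inrOnly (mco K B z)) ξ = dt (inrOnly (lco d Q K z)) ξ + dt (yco K B z) ξ := by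
  rw [← dt_add_left]
  congr 1
  funext i
  rcases i with i | i <;> simp [inrOnly, mco, yco]

lemma core_bound (hd : 3 ≤ d) (hφ : IsGFF P φ) {N U W sep k m1 r0 T J R Q : ℕ} (hQ4 : Q = 4 * N)
    (B : V d → ↥(fbx (0 : V d) Q) → ℝ)
    (hB : ∀ x ∈ fbx 0 Q, ∀ y ∈ fbx 0 Q, dt (B x) (B y) = GY d U x y)
    {v δ h0 hl h ε M : ℝ} (hv : 0 < v) (hY : ∀ x, GY d U x x ≤ v) (hδ : 0 ≤ δ) (hε : 0 < ε)
    (hh : h ≤ h0) (hhl : h ≤ hl - δ)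
    (hUN : U ≤ N) (hR : 8 * N ≤ R) (hUW : U + 1 ≤ W) (hQ : r0 + k * sep + W ≤ Q) (hsep : 2 * (W + U) < sep)
    (hr : 2 * N + J * (T * (2 * (k * sep + W) + 1)) ≤ r0) (hJ : (2 * Q + 1) ^ d < 2 ^ J)
    (q : ENNReal) (hq : ∀ x, dinf 0 x + W ≤ Q → stdG (MI d Q U) (WG d Q U U W m1 hl M x)ᶜ ≤ q)
    (p : ENNReal) (hp1 : p ≤ 1)
    (hp : ∀ t : ℝ, -(M + δ) ≤ t → p * gaussianReal 0 1 (Iio ((h - t) / bc)) ≤ gaussianReal 0 1 (Ico ((h - ε - t) / bc) ((h - t) / bc))) :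
    P (EEv d φ N h (h - ε))ᶜ ≤ (2 * r0 + 1) ^ d * P {ω | ¬ Rad U R (lvl φ h0 ω) 0} +
      ((2 * (Q : ℕ) + 1) ^ d * (2 * ENNReal.ofReal (Real.exp (-δ ^ 2 / (2 * v)))) +
      (2 * r0 + 1) ^ d * ((2 * (k * sep) + 1) ^ d * q) ^ k + J * (2 * (Q : ℕ) + 1) ^ d * (1 - p ^ m1) ^ T) := by
  set F : Set (V d) → Set (V d) → Prop := fun X Y => (∀ x, dinf 0 x ≤ r0 → ∃ a ∈ Anch X Q, dinf x a ≤ U) ∧ BTFail Q (2 * N) X Y with hF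
  have s1 : (EEv d φ N h (h - ε))ᶜ ⊆ (⋃ x ∈ fbx (0 : V d) r0, {ω | ¬ Rad U R (lvl φ h ω) x}) ∪
      {ω | F {z | z ∈ fbx (0 : V d) Q ∧ h ≤ φ z ω} {z | z ∈ fbx (0 : V d) Q ∧ h - ε ≤ φ z ω}} := by
    intro ω hω
    by_cases hD : ∀ x, dinf 0 x ≤ r0 → Rad U R (lvl φ h ω) x
    · have := eev_sub φ (by omega) hε hUN (by omega) hR ω hD hω
      rw [← hQ4] at this
      exact Or.inr this
    · left
      push Not at hD
      obtain ⟨x, hx, hx'⟩ := hD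
      simp only [mem_iUnion]
      exact ⟨x, mem_fbx.2 hx, hx'⟩
  refine (measure_mono s1).trans ((measure_union_le _ _).trans (add_le_add ?_ ?_))
  · refine (measure_biUnion_finset_le _ _).trans ?_
    have e : ((2 * r0 + 1) ^ d : ENNReal) = ((fbx (0 : V d) r0).card : ENNReal) := by rw [card_fbx]; push_cast; ring
    rw [e, ← nsmul_eq_mul]
    refine Finset.sum_le_card_nsmul _ _ _ fun x hx => (dens_prob P φ hφ (by omega) h x).trans (measure_mono fun ω hω hc => hω ?_)
    obtain ⟨a, b, ha, hb, hab⟩ := hc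
    exact ⟨a, b, ha, hb, hab.mono fun z hz => le_trans hh hz⟩
  · rw [model_law hd P φ hφ Q U B hB (fbx 0 Q) (fun x hx => mem_fbx.1 hx) h (h - ε) F]
    have b1 := y_tail B hB (fbx 0 Q) (fun x hx => mem_fbx.1 hx) hv hY hδ
    have b2 := wins_prob (k := k) (sep := sep) (r0 := r0) q hq hQ hsep
    have b3 := bt_model (by omega : 2 ≤ d) (m := m1) (U := U) U B (by omega) hUW (by omega : r0 + k * sep ≤ Q) hr hJ h (h - ε) (M + δ) (by linarith) p hp1 hp
    rw [card_fbx] at b1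
    have b1' : stdG (MI d Q U) {ξ | ∃ z ∈ fbx (0 : V d) Q, δ ≤ |dt (yco U B z) ξ|} ≤
        (2 * (Q : ℕ) + 1) ^ d * (2 * ENNReal.ofReal (Real.exp (-δ ^ 2 / (2 * v)))) := by
      refine b1.trans (le_of_eq ?_); push_cast; ring
    refine le_trans ?_ (add_le_add (add_le_add b1' b2) b3)
    refine (measure_mono ?_).trans ((measure_union_le _ _).trans (add_le_add (measure_union_le _ _) le_rfl))
    rintro ξ ⟨hd1, hf⟩
    by_contra hcon
    simp only [mem_union, not_or] at hcon
    obtain ⟨⟨n1, n2⟩, n3⟩ := hcon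
    refine n3 ⟨⟨hd1, ?_⟩, hf⟩
    intro y hy xs hxs
    simp only [mem_ofPred_eq] at n1 n2
    push Not at n1 n2
    obtain ⟨j, j1, jk, hj⟩ := n2 y hy xs hxs
    refine ⟨j, j1, jk, fun a b ha hb => ?_⟩
    obtain ⟨g1, g2⟩ := hj
    obtain ⟨E, hE, hE2, hE3⟩ := g2 a b ha hb
    have hin : ∀ z, dinf (xs j) z ≤ W → z ∈ fbx (0 : V d) Q := by
      intro z hz
      have t1 := dinf_tri 0 y (xs j)
      have t2 := dinf_tri 0 (xs j) z
      have t3 := hxs j j1 jk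
      have : j * sep ≤ k * sep := Nat.mul_le_mul_right _ jk
      exact mem_fbx.2 (by omega)
    refine ⟨E, hE, fun z hz => ⟨⟨hin z (hE2 z hz), ?_⟩, hE2 z hz⟩, hE3.mono ?_⟩
    · rw [inrOnly_mco]
      have := (abs_lt.1 (n1 z (hin z (hE2 z hz)))).1
      have := g1 z (hE2 z hz)
      linarith
    · rintro z (hz | hz)
      · left
        refine ⟨hin z hz.1, ?_⟩
        have := (abs_lt.1 (n1 z (hin z hz.1))).1
        have h4 : dt (mco U B z) ξ = dt (lco d Q U z) ξ + dt (yco U B z) ξ := dt_add_left _ _ _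
        have := hz.2
        linarith
      · exact Or.inr hz
end core

section corereal
variable {d : ℕ} {Ω : Type*} [MeasurableSpace Ω] (P : Measure Ω) [IsProbabilityMeasure P] (φ : V d → Ω → ℝ)

lemma cast_lin (a n b d : ℕ) : ((a * n + b : ENNReal)) ^ d = ENNReal.ofReal ((a * n + b : ℝ) ^ d) := by
  rw [ENNReal.ofReal_pow (by positivity), ENNReal.ofReal_add (by positivity) (by positivity), ENNReal.ofReal_mul (by positivity)]
  simp

lemma core_real (hd : 3 ≤ d) (hφ : IsGFF P φ) {N U W sep k n0 m m1 T J R : ℕ} {C : ℝ} (hC : GreenC d C)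
    {v ε h0 h M r2 c T0 θ η : ℝ} (hv : 0 < v) (hY : ∀ x, GY d U x x ≤ v) (hε : 0 < ε) (hh : h ≤ h0 - ε)
    (hUN : U ≤ N) (hR : 8 * N + 1 ≤ R) (hsep : 2 * (W + U) < sep) (hUW : U + 1 ≤ W)
    (hQ : k * sep + W ≤ N) (hUR : 2 * U + 1 ≤ R)
    (hr : J * (T * (2 * (k * sep + W) + 1)) ≤ N) (hJ : (8 * N + 1) ^ d < 2 ^ J)
    (hη : 0 ≤ η) (hη2 : η ≤ 1 / 2) (hD : ENNReal.ofReal ((R : ℝ) ^ d) * P {ω | ¬ Rad U R (lvl φ h0 ω) 0} ≤ ENNReal.ofReal η)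
    (hq1 : (2 * U + 3 : ℝ) ^ d * (2 * Real.exp (-(ε / 4) ^ 2 / (2 * v))) * (8 * (2 * U + 3) ^ (2 * d)) ≤ 1)
    (hm1 : 1 ≤ m) (hM : 0 ≤ M) (hm : 2 * r2 * C ≤ (ε / 4) ^ 2 * m ^ 9)
    (hn0 : 2 ^ d * (2 * r2 * C * (1 + 3 ^ d)) / (ε / 4) ^ 2 ≤ n0) (hW : 3 * U + 3 + m ^ 8 ≤ W)
    (hm1' : m1 = d * (2 * (n0 * (d * m ^ 8 + 1)) + 2) + 1)
    (hc0 : 0 < c) (hc1 : c ≤ 1) (hc : ∀ T a : ℝ, 0 ≤ T → a ≤ T →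
      ENNReal.ofReal (c * Real.exp (-T ^ 2)) * gaussianReal 0 1 (Iio a) ≤ gaussianReal 0 1 (Ico (a - ε / bc) a))
    (hT0 : 0 ≤ T0) (hT1 : (h0 + M + ε / 2) / bc ≤ T0)
    (hθ : (2 * (k * sep : ℕ) + 1 : ℝ) ^ d * ((4 * U + 5) ^ d * (2 * U + 3) ^ d * (Real.exp (-r2 / 4) * (8 * (2 * U + 3) ^ (2 * d))) +
      (2 * W + 1) ^ d * Real.exp (-M ^ 2 / (2 * C))) ≤ θ) (hθ2 : (8 * N + 1 : ℝ) ^ d * θ ^ k ≤ η)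
    (hy : (8 * N + 1 : ℝ) ^ d * (2 * Real.exp (-(ε / 2) ^ 2 / (2 * v))) ≤ η)
    (hT : J * (8 * N + 1 : ℝ) ^ d * Real.exp (-(T * (c * Real.exp (-T0 ^ 2)) ^ m1)) ≤ η) :
    P (EEv d φ N h (h - ε))ᶜ ≤ ENNReal.ofReal (4 * η) := by
  obtain ⟨B, hB⟩ := GY_factor d hd U (fbx (0 : V d) (4 * N))
  have hR0 : (1 : ℝ) ≤ (R : ℝ) ^ d := one_le_pow₀ (by exact_mod_cast (by omega : 1 ≤ R))
  have hPR : P {ω | ¬ Rad U R (lvl φ h0 ω) 0} ≤ 1 / 2 := by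
    calc P {ω | ¬ Rad U R (lvl φ h0 ω) 0} = 1 * P {ω | ¬ Rad U R (lvl φ h0 ω) 0} := (one_mul _).symm
      _ ≤ ENNReal.ofReal ((R : ℝ) ^ d) * P {ω | ¬ Rad U R (lvl φ h0 ω) 0} := by
        gcongr; rw [← ENNReal.ofReal_one]; exact ENNReal.ofReal_le_ofReal hR0
      _ ≤ ENNReal.ofReal (1 / 2) := hD.trans (ENNReal.ofReal_le_ofReal hη2)
      _ = 1 / 2 := by rw [ENNReal.ofReal_div_of_pos (by norm_num)]; simp
  set qr : ℝ := (4 * U + 5) ^ d * (2 * U + 3) ^ d * (Real.exp (-r2 / 4) * (8 * (2 * U + 3) ^ (2 * d))) +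
      (2 * W + 1) ^ d * Real.exp (-M ^ 2 / (2 * C)) with hqr
  have qr0 : 0 ≤ qr := by positivity
  have c3 : ∀ j, (2 * U + 3 : ENNReal) ^ j = ENNReal.ofReal ((2 * U + 3 : ℝ) ^ j) := fun j => by exact_mod_cast cast_lin 2 U 3 j
  have c5 : ∀ j, (4 * U + 5 : ENNReal) ^ j = ENNReal.ofReal ((4 * U + 5 : ℝ) ^ j) := fun j => by exact_mod_cast cast_lin 4 U 5 j
  have c1 : ∀ n j : ℕ, (2 * n + 1 : ENNReal) ^ j = ENNReal.ofReal ((2 * n + 1 : ℝ) ^ j) := fun n j => by simpa using cast_lin 2 n 1 j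
  have c8 : (8 : ENNReal) = ENNReal.ofReal 8 := by simp
  have c2 : (2 : ENNReal) = ENNReal.ofReal 2 := by simp
  have hq : ∀ x : V d, dinf 0 x + W ≤ 4 * N → stdG (MI d (4 * N) U) (WG d (4 * N) U U W m1 (h0 - ε / 4 - ε / 4) M x)ᶜ ≤ ENNReal.ofReal qr := by
    intro x hx
    rw [hm1']
    refine (wg_prob' P φ hd hφ hC B hB hv hY hUR hPR ?_ hm1 (by positivity) hM hm hn0 hW x hx).trans (le_of_eq ?_)
    · rw [ENNReal.le_inv_iff_mul_le, c1, c3, c8, c2, ← ENNReal.ofReal_mul (by positivity), ← ENNReal.ofReal_mul (by positivity),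
        ← ENNReal.ofReal_mul (by positivity), ← ENNReal.ofReal_mul (by positivity), ENNReal.ofReal_le_one]
      refine le_trans (le_of_eq ?_) hq1
      push_cast; ring
    · rw [hqr, ENNReal.ofReal_add (by positivity) (by positivity), c5, c3, c3, c1, c8, ← ENNReal.ofReal_mul (by positivity),
        ← ENNReal.ofReal_mul (by positivity), ← ENNReal.ofReal_mul (by positivity), ← ENNReal.ofReal_mul (by positivity), ← ENNReal.ofReal_mul (by positivity)]
  set pr := c * Real.exp (-T0 ^ 2) with hpr
  have pr0 : 0 < pr := by positivity
  have pr1 : pr ≤ 1 := by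
    have : Real.exp (-T0 ^ 2) ≤ 1 := Real.exp_le_one_iff.2 (by nlinarith [sq_nonneg T0])
    have := Real.exp_pos (-T0 ^ 2)
    rw [hpr]; nlinarith
  have key := core_bound P φ hd hφ (N := N) (R := R) (J := J) (T := T) (r0 := 3 * N) (k := k) rfl B hB hv hY (by positivity : 0 ≤ ε / 2) hε
    (by linarith : h ≤ h0) (by linarith : h ≤ (h0 - ε / 4 - ε / 4) - ε / 2) hUN (by omega) hUW (by omega) hsep (by omega)
    (by rw [show 2 * (4 * N) + 1 = 8 * N + 1 by ring]; exact hJ) _ hq (ENNReal.ofReal pr) (by rw [ENNReal.ofReal_le_one]; exact pr1) ?_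
  swap
  · intro t ht
    have := hc T0 ((h - t) / bc) hT0 (le_trans ?_ hT1)
    · rw [show (h - ε - t) / bc = (h - t) / bc - ε / bc by ring]; exact this
    · exact div_le_div_of_nonneg_right (by linarith) bc_pos.le
  refine key.trans ?_
  have e0 : ∀ j : ℕ, ((2 * (4 * N : ℕ) + 1 : ENNReal)) ^ j = ENNReal.ofReal ((8 * N + 1 : ℝ) ^ j) := fun j => by
    rw [c1]; congr 2; push_cast; ring
  have e1 : (2 * (3 * N : ℕ) + 1 : ENNReal) ^ d ≤ ENNReal.ofReal ((8 * N + 1 : ℝ) ^ d) := by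
    rw [c1]; refine ENNReal.ofReal_le_ofReal (pow_le_pow_left₀ (by positivity) ?_ _); push_cast; linarith [(Nat.cast_nonneg N : (0 : ℝ) ≤ N)]
  have e2 : ENNReal.ofReal ((8 * N + 1 : ℝ) ^ d) ≤ ENNReal.ofReal ((R : ℝ) ^ d) :=
    ENNReal.ofReal_le_ofReal (pow_le_pow_left₀ (by positivity) (by exact_mod_cast hR) _)
  have a1 : (2 * (3 * N : ℕ) + 1 : ENNReal) ^ d * P {ω | ¬ Rad U R (lvl φ h0 ω) 0} ≤ ENNReal.ofReal η :=
    le_trans (by gcongr; exact e1.trans e2) hD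
  have a2 : (2 * (4 * N : ℕ) + 1 : ENNReal) ^ d * (2 * ENNReal.ofReal (Real.exp (-(ε / 2) ^ 2 / (2 * v)))) ≤ ENNReal.ofReal η := by
    rw [e0, c2, ← ENNReal.ofReal_mul (by positivity), ← ENNReal.ofReal_mul (by positivity)]
    exact ENNReal.ofReal_le_ofReal hy
  have a3 : (2 * (3 * N : ℕ) + 1 : ENNReal) ^ d * ((2 * (k * sep : ENNReal) + 1) ^ d * ENNReal.ofReal qr) ^ k ≤ ENNReal.ofReal η := by
    refine le_trans ?_ (ENNReal.ofReal_le_ofReal hθ2)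
    have h2 : (2 * (k * sep : ENNReal) + 1) ^ d * ENNReal.ofReal qr ≤ ENNReal.ofReal θ := by
      have := c1 (k * sep) d
      push_cast at this
      rw [this, ← ENNReal.ofReal_mul (by positivity)]
      refine ENNReal.ofReal_le_ofReal (le_trans (le_of_eq ?_) hθ)
      push_cast; rfl
    have h3 : 0 ≤ θ := le_trans (by positivity) hθ
    rw [ENNReal.ofReal_mul (by positivity), ENNReal.ofReal_pow h3]
    gcongr
  have a4 : (J : ENNReal) * (2 * (4 * N : ℕ) + 1) ^ d * (1 - ENNReal.ofReal pr ^ m1) ^ T ≤ ENNReal.ofReal η := by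
    refine le_trans ?_ (ENNReal.ofReal_le_ofReal hT)
    have h4 : (1 - ENNReal.ofReal pr ^ m1) ^ T ≤ ENNReal.ofReal (Real.exp (-(T * pr ^ m1))) := by
      rw [← ENNReal.ofReal_pow pr0.le, ← ENNReal.ofReal_one, ← ENNReal.ofReal_sub _ (by positivity),
        ← ENNReal.ofReal_pow (by linarith [pow_le_one₀ pr0.le pr1 (n := m1)])]
      refine ENNReal.ofReal_le_ofReal ?_
      rw [show -((T : ℝ) * pr ^ m1) = T * (-pr ^ m1) by ring, Real.exp_nat_mul]
      refine pow_le_pow_left₀ (by linarith [pow_le_one₀ pr0.le pr1 (n := m1)]) ?_ _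
      have := Real.add_one_le_exp (-pr ^ m1); linarith
    rw [e0, ENNReal.ofReal_mul (p := J * (8 * N + 1 : ℝ) ^ d) (by positivity), ENNReal.ofReal_mul (p := (J : ℝ)) (by positivity), ENNReal.ofReal_natCast]
    gcongr
  calc _ ≤ ENNReal.ofReal η + (ENNReal.ofReal η + ENNReal.ofReal η + ENNReal.ofReal η) := by
        refine add_le_add a1 (add_le_add (add_le_add a2 ?_) a4)
        simpa using a3
    _ = ENNReal.ofReal (4 * η) := by
        rw [← ENNReal.ofReal_add hη hη, ← ENNReal.ofReal_add (by positivity) hη, ← ENNReal.ofReal_add hη (by positivity)]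
        congr 1; ring
end corereal

section num
lemma evp (a b : ℝ) (hb : 0 < b) {k j : ℕ} (h : k < j) : ∀ᶠ s : ℝ in atTop, a * s ^ k ≤ b * s ^ j := by
  have h1 : ∀ᶠ s : ℝ in atTop, a / b ≤ s := eventually_ge_atTop _
  filter_upwards [h1, eventually_ge_atTop 1] with s hs hs1
  obtain ⟨i, rfl⟩ : ∃ i, j = k + 1 + i := ⟨j - (k + 1), by omega⟩
  rw [div_le_iff₀ hb] at hs
  have h2 : (1 : ℝ) ≤ s ^ i := one_le_pow₀ hs1
  have h3 : (0 : ℝ) < s ^ k := by positivity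
  calc a * s ^ k ≤ (s * b) * s ^ k := by gcongr
    _ = b * (s ^ (k + 1) * 1) := by ring
    _ ≤ b * (s ^ (k + 1) * s ^ i) := by gcongr
    _ = b * s ^ (k + 1 + i) := by ring

lemma eve (a b : ℝ) (hb : 0 < b) (k : ℕ) {j : ℕ} (hj : 1 ≤ j) : ∀ᶠ s : ℝ in atTop, a * s ^ k ≤ Real.exp (b * s ^ j) := by
  have h1 := (isLittleO_pow_exp_pos_mul_atTop k hb).def (c := (|a| + 1)⁻¹) (by positivity)
  filter_upwards [h1, eventually_ge_atTop 1] with s hs hs1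
  rw [Real.norm_of_nonneg (by positivity), Real.norm_of_nonneg (Real.exp_pos _).le, ← div_eq_inv_mul, le_div_iff₀ (by positivity)] at hs
  have h3 : (0 : ℝ) < s ^ k := by positivity
  have h4 : s ≤ s ^ j := le_self_pow₀ hs1 (by omega)
  have h5 : Real.exp (b * s) ≤ Real.exp (b * s ^ j) := Real.exp_le_exp.2 (by gcongr)
  nlinarith [le_abs_self a]

lemma num_theta (d : ℕ) {s x U k : ℝ} (hs : 1 ≤ s) (hx : x = Real.exp (s ^ 25)) (hU1 : 1 ≤ U) (hU : U ≤ x) (hk1 : 1 ≤ k)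
    (hk : k ≤ (d + 2) * s ^ 50)
    (hF : ((61 * (d + 2)) ^ d * (8 * 9 ^ d * 5 ^ d * 5 ^ (2 * d) + 21 ^ d)) * s ^ (50 * d) ≤ x) :
    (2 * (k * (30 * U)) + 1 : ℝ) ^ d * ((4 * U + 5) ^ d * (2 * U + 3) ^ d * (Real.exp (-(4 * (5 * d + 2 : ℕ) * s ^ 25) / 4) * (8 * (2 * U + 3) ^ (2 * d))) +
      (2 * (10 * U) + 1) ^ d * Real.exp (-((5 * d + 2 : ℕ) * s ^ 25))) ≤ Real.exp (-s ^ 25) := by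
  set E := Real.exp (-((5 * d + 2 : ℕ) * s ^ 25)) with hE
  have hE0 : 0 < E := Real.exp_pos _
  have hEx : x ^ (5 * d + 2) * E = 1 := by
    rw [hx, hE, ← Real.exp_nat_mul, ← Real.exp_add, add_neg_cancel, Real.exp_zero]
  have e1 : Real.exp (-(4 * (5 * d + 2 : ℕ) * s ^ 25) / 4) = E := by rw [hE]; congr 1; ring
  rw [e1]
  have hx1 : 1 ≤ x := hU1.trans hU
  have b1 : (2 * (k * (30 * U)) + 1 : ℝ) ≤ 61 * (d + 2) * s ^ 50 * x := by
    have : 1 ≤ k * U := by nlinarith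
    have : k * U ≤ ((d + 2) * s ^ 50) * x := by gcongr
    nlinarith
  have b2 : (2 * U + 3 : ℝ) ≤ 5 * x := by linarith
  have b3 : (4 * U + 5 : ℝ) ≤ 9 * x := by linarith
  have b4 : (2 * (10 * U) + 1 : ℝ) ≤ 21 * x := by linarith
  have b5 : x ^ d ≤ x ^ (4 * d) := pow_le_pow_right₀ hx1 (by omega)
  have c1 : (2 * (k * (30 * U)) + 1 : ℝ) ^ d ≤ (61 * (d + 2) * s ^ 50 * x) ^ d := pow_le_pow_left₀ (by positivity) b1 _
  have c2 : (4 * U + 5) ^ d * (2 * U + 3) ^ d * (E * (8 * (2 * U + 3) ^ (2 * d))) ≤ (9 * x) ^ d * (5 * x) ^ d * (E * (8 * (5 * x) ^ (2 * d))) := by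
    gcongr
  have c3 : (2 * (10 * U) + 1) ^ d * E ≤ 21 ^ d * x ^ (4 * d) * E := by
    have : (2 * (10 * U) + 1) ^ d ≤ (21 * x) ^ d := pow_le_pow_left₀ (by positivity) b4 _
    rw [mul_pow] at this
    have h21 : (21 : ℝ) ^ d * x ^ d ≤ 21 ^ d * x ^ (4 * d) := by gcongr
    have := this.trans h21
    gcongr
  have hxi : Real.exp (-s ^ 25) = x ^ (5 * d + 1) * E := by
    have h2 : Real.exp (-s ^ 25) * x = 1 := by rw [hx, ← Real.exp_add]; simp
    have h3 : x ^ (5 * d + 1) * E * x = 1 := by rw [← hEx]; ring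
    have : x ≠ 0 := by positivity
    exact mul_right_cancel₀ this (h2.trans h3.symm)
  rw [hxi]
  calc _ ≤ (61 * (d + 2) * s ^ 50 * x) ^ d * ((9 * x) ^ d * (5 * x) ^ d * (E * (8 * (5 * x) ^ (2 * d))) + 21 ^ d * x ^ (4 * d) * E) := by
        gcongr
    _ = (((61 * (d + 2)) ^ d * (8 * 9 ^ d * 5 ^ d * 5 ^ (2 * d) + 21 ^ d)) * s ^ (50 * d)) * (x ^ (5 * d) * E) := by
        simp only [mul_pow, ← pow_mul]; ring
    _ ≤ x * (x ^ (5 * d) * E) := by gcongr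
    _ = x ^ (5 * d + 1) * E := by ring

lemma num_y (d : ℕ) {y b η z Nn : ℝ} (hN0 : 0 ≤ Nn) (hN : 8 * Nn + 1 ≤ Real.exp y) (hz : (d + 1) * y ≤ z)
    (hη : 2 * Real.exp (-y) ≤ η) (hb : b ≤ -z) : (8 * Nn + 1) ^ d * (2 * Real.exp b) ≤ η := by
  calc (8 * Nn + 1) ^ d * (2 * Real.exp b) ≤ (Real.exp y) ^ d * (2 * Real.exp (-((d + 1) * y))) := by
        gcongr; linarith
    _ = 2 * Real.exp (-y) := by
        rw [← Real.exp_nat_mul, mul_left_comm, ← Real.exp_add]; congr 2; ring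
    _ ≤ η := hη

lemma num_T (d : ℕ) {y η Nn J T p : ℝ} (m1 : ℕ) {s c5 c6 : ℝ} (hs : 1 ≤ s) (hy : y = s ^ 75) (hN0 : 0 ≤ Nn) (hN : 8 * Nn + 1 ≤ Real.exp y)
    (hJ0 : 0 ≤ J) (hJ : J ≤ (2 * d + 1) * s ^ 75) (hT : Real.exp (y / 2) / 2 ≤ T) (hc5 : 0 ≤ c5) (hp : Real.exp (-(c5 * s ^ 25)) ≤ p)
    (hm : (m1 : ℝ) ≤ c6 * s ^ 49) (f1 : c5 * c6 * s ^ 74 ≤ (1 / 4) * s ^ 75) (f2 : (2 * d + 1) * s ^ 75 ≤ Real.exp (1 * s ^ 75))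
    (f3 : 2 * (d + 2) * s ^ 75 ≤ Real.exp ((1 / 4) * s ^ 75)) (hη : 2 * Real.exp (-y) ≤ η) :
    J * (8 * Nn + 1) ^ d * Real.exp (-(T * p ^ m1)) ≤ η := by
  have h1 : Real.exp (-(1 / 4 * y)) ≤ p ^ m1 := by
    refine le_trans ?_ (pow_le_pow_left₀ (Real.exp_pos _).le hp m1)
    rw [← Real.exp_nat_mul]
    refine Real.exp_le_exp.2 ?_
    have : (m1 : ℝ) * (c5 * s ^ 25) ≤ (c6 * s ^ 49) * (c5 * s ^ 25) := by gcongr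
    rw [hy]; nlinarith
  have h2 : Real.exp (y / 4) / 2 ≤ T * p ^ m1 := by
    calc Real.exp (y / 4) / 2 = Real.exp (y / 2) / 2 * Real.exp (-(1 / 4 * y)) := by
          rw [div_mul_eq_mul_div, ← Real.exp_add]; congr 2; ring
      _ ≤ T * p ^ m1 := mul_le_mul hT h1 (Real.exp_pos _).le (le_trans (by positivity) hT)
  have h3 : (d + 2) * y ≤ T * p ^ m1 := by
    refine le_trans ?_ h2
    rw [show (1 / 4) * s ^ 75 = y / 4 by rw [hy]; ring] at f3
    rw [hy] at f3 ⊢; linarith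
  rw [one_mul, ← hy] at f2
  rw [← hy] at hJ
  calc J * (8 * Nn + 1) ^ d * Real.exp (-(T * p ^ m1)) ≤ Real.exp y * (Real.exp y) ^ d * Real.exp (-((d + 2) * y)) := by
        gcongr; exact hJ.trans f2
    _ = Real.exp (-y) := by
        rw [← Real.exp_nat_mul, ← Real.exp_add, ← Real.exp_add]; congr 1; ring
    _ ≤ η := by linarith [Real.exp_pos (-y)]

lemma num_q1 (d : ℕ) {s x U b z : ℝ} (hx : x = Real.exp (s ^ 25)) (hU1 : 1 ≤ U) (hU : U ≤ x)
    (f : 16 * 5 ^ (3 * d) ≤ x) (hz : (3 * d + 1) * s ^ 25 ≤ z) (hb : b ≤ -z) :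
    (2 * U + 3 : ℝ) ^ d * (2 * Real.exp b) * (8 * (2 * U + 3) ^ (2 * d)) ≤ 1 := by
  have b2 : (2 * U + 3 : ℝ) ≤ 5 * x := by linarith
  have hx0 : 0 < x := by linarith
  calc (2 * U + 3 : ℝ) ^ d * (2 * Real.exp b) * (8 * (2 * U + 3) ^ (2 * d)) ≤
      (5 * x) ^ d * (2 * Real.exp (-((3 * d + 1 : ℕ) * s ^ 25))) * (8 * (5 * x) ^ (2 * d)) := by
        gcongr; push_cast; linarith
    _ = (16 * 5 ^ (3 * d)) * x ^ (3 * d) * Real.exp (-((3 * d + 1 : ℕ) * s ^ 25)) := by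
        simp only [mul_pow]; ring
    _ ≤ x * x ^ (3 * d) * Real.exp (-((3 * d + 1 : ℕ) * s ^ 25)) := by gcongr
    _ = x ^ (3 * d + 1) * Real.exp (-((3 * d + 1 : ℕ) * s ^ 25)) := by ring
    _ = 1 := by rw [hx, ← Real.exp_nat_mul, ← Real.exp_add, add_neg_cancel, Real.exp_zero]
end num

section mainev
variable {d : ℕ} {Ω : Type*} [MeasurableSpace Ω] (P : Measure Ω) [IsProbabilityMeasure P] (φ : V d → Ω → ℝ)

def sfn (n : ℕ) : ℝ := (Real.log ((n : ℝ) + 1)) ^ ((1 : ℝ) / 75)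

lemma sfn_tendsto : Tendsto sfn atTop atTop := by
  unfold sfn
  refine (tendsto_rpow_atTop (by norm_num)).comp (Real.tendsto_log_atTop.comp ?_)
  exact tendsto_atTop_add_const_right _ _ tendsto_natCast_atTop_atTop

lemma sfn_pow (n : ℕ) : sfn n ^ 75 = Real.log ((n : ℝ) + 1) := by
  have h0 : 0 ≤ Real.log ((n : ℝ) + 1) := Real.log_nonneg (by linarith [(Nat.cast_nonneg n : (0 : ℝ) ≤ n)])
  unfold sfn
  rw [← Real.rpow_natCast, ← Real.rpow_mul h0]; norm_num

lemma sfn_ufn (n : ℕ) : ufn ((n : ℝ) + 1) = Real.exp (sfn n ^ 25) := by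
  have h0 : 0 ≤ Real.log ((n : ℝ) + 1) := Real.log_nonneg (by linarith [(Nat.cast_nonneg n : (0 : ℝ) ≤ n)])
  unfold sfn ufn
  rw [← Real.rpow_natCast, ← Real.rpow_mul h0]; norm_num

lemma sfn_exp (n : ℕ) : (n : ℝ) + 1 = Real.exp (sfn n ^ 75) := by
  rw [sfn_pow, Real.exp_log (by positivity)]

lemma floor_half {x : ℝ} (hx : 1 ≤ x) : 1 ≤ ⌊x⌋₊ ∧ (⌊x⌋₊ : ℝ) ≤ x ∧ x / 2 ≤ ⌊x⌋₊ := by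
  have h1 : 1 ≤ ⌊x⌋₊ := Nat.one_le_floor_iff x |>.2 hx
  have h2 := Nat.lt_floor_add_one x
  have h3 : (1 : ℝ) ≤ ⌊x⌋₊ := by exact_mod_cast h1
  exact ⟨h1, Nat.floor_le (by linarith), by linarith⟩

lemma aux_a {k U K x : ℝ} (hk : 1 ≤ k) (hU : 1 ≤ U) (hK : k ≤ K) (hx : U ≤ x) :
    2 * (k * (30 * U) + 10 * U) + 1 ≤ 81 * (K * x) := by
  have a1 : (1 : ℝ) ≤ k * U := by nlinarith
  have a2 : (U : ℝ) ≤ k * U := by nlinarith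
  have : k * U ≤ K * x := mul_le_mul hK hx (by linarith) (by linarith)
  linarith

lemma aux_b {z J : ℝ} (hz : 0 < z) (hJ : 2 * z < J) : z < J * Real.log 2 := by
  have := Real.log_two_gt_d9
  nlinarith

lemma aux_c {c g M w c5 K : ℝ} (hc0 : 0 < c) (hlc : Real.log c ≤ 0) (hw : 1 ≤ w) (hM : 4 * M ^ 2 = K * w)
    (hc5 : c5 = 4 * g ^ 2 + K - Real.log c) : Real.exp (-(c5 * w)) ≤ c * Real.exp (-(2 * (g + M) ^ 2)) := by
  have e : c * Real.exp (-(2 * (g + M) ^ 2)) = Real.exp (Real.log c + -(2 * (g + M) ^ 2)) := by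
    rw [Real.exp_add, Real.exp_log hc0]
  rw [e]
  refine Real.exp_le_exp.2 ?_
  have h2 : 2 * (g + M) ^ 2 ≤ 4 * g ^ 2 + 4 * M ^ 2 := by nlinarith [sq_nonneg (g - M)]
  have h3 : (4 * g ^ 2 - Real.log c) * 1 ≤ (4 * g ^ 2 - Real.log c) * w :=
    mul_le_mul_of_nonneg_left hw (by nlinarith [sq_nonneg g])
  rw [hc5]; linarith

set_option maxHeartbeats 4000000 in
lemma main_ev (hd : 3 ≤ d) (hφ : IsGFF P φ) {C C' : ℝ} (hC : GreenC d C) (hC' : 0 < C')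
    (hG : ∀ K t : ℕ, 1 ≤ t → t ^ 2 ≤ 2 * K → ∀ x y, GY d K x y ≤ C' / t) {ε h0 c η : ℝ} (hε : 0 < ε) (hη : 0 < η) (hη2 : η ≤ 1 / 2)
    (hc0 : 0 < c) (hc1 : c ≤ 1) (hc : ∀ T a : ℝ, 0 ≤ T → a ≤ T →
      ENNReal.ofReal (c * Real.exp (-T ^ 2)) * gaussianReal 0 1 (Iio a) ≤ gaussianReal 0 1 (Ico (a - ε / bc) a)) :
    ∀ᶠ n : ℕ in atTop, ENNReal.ofReal (((n : ℝ) + 1) ^ d) * P {ω | ¬ Rad ⌊ufn ((n : ℝ) + 1)⌋₊ (n + 1) (lvl φ h0 ω) 0} ≤ ENNReal.ofReal η →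
      ∀ h ≤ h0 - ε, P (EEv d φ (n / 10) h (h - ε))ᶜ ≤ ENNReal.ofReal (4 * η) := by
  have hCp := hC.1
  obtain ⟨A, hA⟩ : ∃ A : ℕ, A = 5 * d + 2 := ⟨_, rfl⟩
  obtain ⟨c2, hc2⟩ : ∃ c2 : ℝ, c2 = 2 ^ d * (2 * (4 * A) * C * (1 + 3 ^ d)) / (ε / 4) ^ 2 := ⟨_, rfl⟩
  have hc20 : 0 ≤ c2 := by rw [hc2]; positivity
  obtain ⟨c5, hc5⟩ : ∃ c5 : ℝ, c5 = 4 * (|h0| + ε / 2) ^ 2 + 8 * C * A - Real.log c := ⟨_, rfl⟩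
  have hlc : Real.log c ≤ 0 := Real.log_nonpos hc0.le hc1
  have hc50 : 0 ≤ c5 := by
    have : 0 ≤ 4 * (|h0| + ε / 2) ^ 2 + 8 * C * A := by positivity
    linarith
  obtain ⟨c6, hc6⟩ : ∃ c6 : ℝ, c6 = d * (2 * ((c2 + 1) * (d * 256 + 1)) + 2) + 1 := ⟨_, rfl⟩
  have q4 : (0 : ℝ) < 1 / 4 := by norm_num
  have q2 : (0 : ℝ) < 1 / 2 := by norm_num
  have ev := sfn_tendsto.eventually ((eventually_ge_atTop (1 : ℝ)).and <|
    (eve ((61 * (d + 2)) ^ d * (8 * 9 ^ d * 5 ^ d * 5 ^ (2 * d) + 21 ^ d)) 1 one_pos (50 * d) (j := 25) (by norm_num)).and <|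
    (eve ((d + 1) * (4 * C' / (ε / 2) ^ 2)) (1 / 2) q2 75 (j := 25) (by norm_num)).and <|
    (eve ((3 * d + 1) * (4 * C' / (ε / 4) ^ 2)) (1 / 2) q2 25 (j := 25) (by norm_num)).and <|
    (eve (16 * 5 ^ (3 * d)) 1 one_pos 0 (j := 25) (by norm_num)).and <|
    (evp (c5 * c6) (1 / 4) q4 (by norm_num : 74 < 75)).and <|
    (eve (2 * d + 1) 1 one_pos 75 (j := 75) (by norm_num)).and <|
    (eve (2 * (d + 2)) (1 / 4) q4 75 (j := 75) (by norm_num)).and <|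
    (eve (2 / η) 1 one_pos 0 (j := 75) (by norm_num)).and <|
    (evp 1 (1 / 4) q4 (by norm_num : 25 < 75)).and <|
    (eve (20 * ((2 * d + 1) * (81 * (d + 2)))) (1 / 4) q4 125 (j := 75) (by norm_num)).and <|
    (eve 256 1 one_pos 24 (j := 25) (by norm_num)).and <|
    (evp (2 * (4 * A) * C) ((ε / 4) ^ 2) (by positivity) (by norm_num : 25 < 27)))
  filter_upwards [ev, eventually_ge_atTop 20] with n hn hn20 hD h hh
  obtain ⟨s1, g1, g2, g3, g4, g5, g6, g7, g8, g9, g10, g11, g12⟩ := hn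
  have hRe := sfn_exp n
  rw [sfn_ufn] at hD
  obtain ⟨s, hs⟩ : ∃ s, s = sfn n := ⟨_, rfl⟩
  simp only [← hs] at hD hRe s1 g1 g2 g3 g4 g5 g6 g7 g8 g9 g10 g11 g12
  simp only [one_mul, pow_zero, mul_one] at g1 g4 g6 g8 g9 g11
  have s0 : 0 < s := by linarith
  have sp : ∀ j : ℕ, 1 ≤ s ^ j := fun j => one_le_pow₀ s1
  obtain ⟨x, hx⟩ : ∃ x, x = Real.exp (s ^ 25) := ⟨_, rfl⟩
  rw [← hx] at hD g1 g4 g11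
  have hx1 : 1 ≤ x := by rw [hx]; exact Real.one_le_exp (by positivity)
  obtain ⟨U1, Ux, xU⟩ := floor_half hx1
  obtain ⟨U, hU⟩ : ∃ U, U = ⌊x⌋₊ := ⟨_, rfl⟩
  rw [← hU] at hD U1 Ux xU
  have U1' : (1 : ℝ) ≤ U := by exact_mod_cast U1
  -- the auxiliary scale t
  have ht := floor_half (x := Real.exp (1 / 2 * s ^ 25)) (Real.one_le_exp (by positivity))
  obtain ⟨t, htd⟩ : ∃ t, t = ⌊Real.exp (1 / 2 * s ^ 25)⌋₊ := ⟨_, rfl⟩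
  rw [← htd] at ht
  obtain ⟨t1, t2, t3⟩ := ht
  have t1' : (1 : ℝ) ≤ t := by exact_mod_cast t1
  have tU : t ^ 2 ≤ 2 * U := by
    have h1 : (t : ℝ) ^ 2 ≤ x := by
      calc (t : ℝ) ^ 2 ≤ Real.exp (1 / 2 * s ^ 25) ^ 2 := by gcongr
        _ = x := by rw [hx, ← Real.exp_nat_mul]; congr 1; push_cast; ring
    have : (t : ℝ) ^ 2 ≤ 2 * U := by linarith
    exact_mod_cast this
  -- N
  obtain ⟨N, hN⟩ : ∃ N, N = n / 10 := ⟨_, rfl⟩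
  rw [← hN]
  have N1 : 10 * N ≤ n := by omega
  have N2 : n + 1 ≤ 20 * N := by omega
  have N2' : Real.exp (s ^ 75) / 20 ≤ N := by
    have : (n : ℝ) + 1 ≤ 20 * N := by exact_mod_cast N2
    rw [hRe] at this; linarith
  have N3 : (8 * N + 1 : ℝ) ≤ Real.exp (s ^ 75) := by
    rw [← hRe]; exact_mod_cast (by omega : 8 * N + 1 ≤ n + 1)
  -- k, J, T, m, n0
  obtain ⟨k, hk⟩ : ∃ k, k = ⌈(d + 1 : ℝ) * s ^ 50⌉₊ := ⟨_, rfl⟩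
  have k1 : (d + 1 : ℝ) * s ^ 50 ≤ k := by rw [hk]; exact Nat.le_ceil _
  have k2 : (k : ℝ) ≤ (d + 2) * s ^ 50 := by
    have := (Nat.ceil_lt_add_one (by positivity : 0 ≤ (d + 1 : ℝ) * s ^ 50)).le
    rw [← hk] at this
    linarith [sp 50]
  have k0 : (1 : ℝ) ≤ k := by
    have : (0 : ℝ) ≤ d * s ^ 50 := by positivity
    linarith [sp 50]
  have k0' : 1 ≤ k := by exact_mod_cast k0
  obtain ⟨J, hJ⟩ : ∃ J, J = ⌊2 * d * s ^ 75⌋₊ + 1 := ⟨_, rfl⟩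
  have J1 : 2 * d * s ^ 75 < J := by rw [hJ]; push_cast; exact Nat.lt_floor_add_one _
  have J2 : (J : ℝ) ≤ (2 * d + 1) * s ^ 75 := by
    rw [hJ]; push_cast
    have := Nat.floor_le (by positivity : (0 : ℝ) ≤ 2 * d * s ^ 75)
    linarith [sp 75]
  have hT := floor_half (x := Real.exp (s ^ 75 / 2)) (Real.one_le_exp (by positivity))
  obtain ⟨T, hTd⟩ : ∃ T, T = ⌊Real.exp (s ^ 75 / 2)⌋₊ := ⟨_, rfl⟩
  rw [← hTd] at hT
  obtain ⟨T1, T2, T3⟩ := hT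
  obtain ⟨m, hm⟩ : ∃ m, m = ⌈s ^ 3⌉₊ := ⟨_, rfl⟩
  have m1 : s ^ 3 ≤ m := by rw [hm]; exact Nat.le_ceil _
  have m2 : (m : ℝ) ≤ 2 * s ^ 3 := by
    have := (Nat.ceil_lt_add_one (by positivity : 0 ≤ s ^ 3)).le
    rw [← hm] at this
    linarith [sp 3]
  have m8 : (m : ℝ) ^ 8 ≤ 256 * s ^ 24 := by
    calc (m : ℝ) ^ 8 ≤ (2 * s ^ 3) ^ 8 := by gcongr
      _ = 256 * s ^ 24 := by ring
  have m9 : s ^ 27 ≤ (m : ℝ) ^ 9 := by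
    calc s ^ 27 = (s ^ 3) ^ 9 := by ring
      _ ≤ (m : ℝ) ^ 9 := by gcongr
  obtain ⟨n0, hn0⟩ : ∃ n0, n0 = ⌈c2 * s ^ 25⌉₊ := ⟨_, rfl⟩
  have n1 : c2 * s ^ 25 ≤ n0 := by rw [hn0]; exact Nat.le_ceil _
  have n2 : (n0 : ℝ) ≤ (c2 + 1) * s ^ 25 := by
    have := (Nat.ceil_lt_add_one (by positivity : 0 ≤ c2 * s ^ 25)).le
    rw [← hn0] at this
    linarith [sp 25]
  obtain ⟨M, hM⟩ : ∃ M, M = Real.sqrt (2 * C * A * s ^ 25) := ⟨_, rfl⟩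
  have M0 : 0 ≤ M := by rw [hM]; positivity
  have M2 : M ^ 2 = 2 * C * A * s ^ 25 := by rw [hM, Real.sq_sqrt (by positivity)]
  have hE : 2 * Real.exp (-s ^ 75) ≤ η := by
    rw [Real.exp_neg, ← div_eq_mul_inv, div_le_iff₀ (Real.exp_pos _)]
    rw [div_le_iff₀ hη] at g8; linarith
  -- main radius estimate
  have hr : J * (T * (2 * (k * (30 * U) + 10 * U) + 1)) ≤ N := by
    have h1 : (2 * (k * (30 * U) + 10 * U) + 1 : ℝ) ≤ 81 * (d + 2) * s ^ 50 * x := by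
      have := aux_a k0 U1' k2 Ux
      linarith only [this]
    have h2 : x ≤ Real.exp (1 / 4 * s ^ 75) := by rw [hx]; exact Real.exp_le_exp.2 g9
    have h3 : (J : ℝ) * (T * (2 * (k * (30 * U) + 10 * U) + 1)) ≤ N := by
      refine le_trans ?_ N2'
      calc (J : ℝ) * (T * (2 * (k * (30 * U) + 10 * U) + 1)) ≤
          ((2 * d + 1) * s ^ 75) * (Real.exp (s ^ 75 / 2) * (81 * (d + 2) * s ^ 50 * Real.exp (1 / 4 * s ^ 75))) := by
            refine mul_le_mul J2 (mul_le_mul T2 (h1.trans (by gcongr)) (by positivity) (by positivity)) (by positivity) (by positivity)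
        _ = (20 * ((2 * d + 1) * (81 * (d + 2))) * s ^ 125) * (Real.exp (s ^ 75 / 2) * Real.exp (1 / 4 * s ^ 75)) / 20 := by ring
        _ ≤ Real.exp (1 / 4 * s ^ 75) * (Real.exp (s ^ 75 / 2) * Real.exp (1 / 4 * s ^ 75)) / 20 := by gcongr
        _ = Real.exp (s ^ 75) / 20 := by rw [← Real.exp_add, ← Real.exp_add]; congr 2; ring
    exact_mod_cast h3
  have hLW : k * (30 * U) + 10 * U ≤ N := by
    have hJ1 : 1 ≤ J := by omega
    calc k * (30 * U) + 10 * U ≤ 1 * (1 * (2 * (k * (30 * U) + 10 * U) + 1)) := by omega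
      _ ≤ J * (T * (2 * (k * (30 * U) + 10 * U) + 1)) := by gcongr
      _ ≤ N := hr
  have hUN : U ≤ N := by
    have : 0 ≤ k * (30 * U) := Nat.zero_le _
    omega
  have vE : ∀ a : ℝ, -a ^ 2 / (2 * (C' / t)) = -(a ^ 2 * t / (2 * C')) := by
    intro a; field_simp
  have tE : ∀ a b : ℝ, 0 < a → b * (4 * C' / a ^ 2) ≤ Real.exp (1 / 2 * s ^ 25) → b ≤ a ^ 2 * t / (2 * C') := by
    intro a b ha h
    rw [le_div_iff₀ (by positivity)]
    have h2 : b * (4 * C' / a ^ 2) ≤ 2 * t := by linarith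
    have h3 : b * (4 * C' / a ^ 2) * a ^ 2 ≤ 2 * t * a ^ 2 := by gcongr
    have h4 : b * (4 * C' / a ^ 2) * a ^ 2 = b * (4 * C') := by field_simp
    linarith
  refine core_real P φ hd hφ (N := N) (U := U) (W := 10 * U) (sep := 30 * U) (k := k) (n0 := n0) (m := m) (T := T) (J := J) (R := n + 1)
    (C := C) (v := C' / t) (M := M) (r2 := 4 * A * s ^ 25) (c := c) (T0 := (|h0| + ε / 2 + M) / bc) (θ := Real.exp (-s ^ 25)) (η := η) hC
    (by positivity) (fun z => hG U t t1 tU z z) hε hh hUN (by omega) (by omega) (by omega) hLW (by omega) hr ?_ hη.le hη2 ?_ ?_ ?_ M0 ?_ ?_ ?_ rfl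
    hc0 hc1 hc ?_ ?_ ?_ ?_ ?_ ?_
  · -- hJ
    have h1 : ((8 * N + 1 : ℝ)) ^ d < 2 ^ J := by
      calc ((8 * N + 1 : ℝ)) ^ d ≤ Real.exp (s ^ 75) ^ d := by gcongr
        _ = Real.exp (d * s ^ 75) := by rw [← Real.exp_nat_mul]
        _ < Real.exp (J * Real.log 2) := by
            refine Real.exp_lt_exp.2 ?_
            have := Real.log_two_gt_d9
            have h0 : (0 : ℝ) < d * s ^ 75 := by
              have : 0 < d := by omega
              positivity
            exact aux_b h0 (by linarith only [J1])
        _ = 2 ^ J := by rw [Real.exp_nat_mul, Real.exp_log (by norm_num)]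
    exact_mod_cast h1
  · push_cast; exact hD
  · rw [vE]
    refine num_q1 d hx U1' Ux g4 (tE (ε / 4) _ (by positivity) ?_) le_rfl
    refine le_trans (le_of_eq ?_) g3; ring
  · have : (0 : ℝ) < m := by linarith [sp 3]
    exact_mod_cast this
  · calc 2 * (4 * A * s ^ 25) * C = 2 * (4 * A) * C * s ^ 25 := by ring
      _ ≤ (ε / 4) ^ 2 * s ^ 27 := g12
      _ ≤ _ := by gcongr
  · refine le_trans (le_of_eq ?_) n1
    rw [hc2]; ring
  · have h1 : (3 * U + 3 + m ^ 8 : ℝ) ≤ 10 * U := by linarith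
    exact_mod_cast h1
  · have := bc_pos; positivity
  · refine div_le_div_of_nonneg_right ?_ bc_pos.le
    linarith [le_abs_self h0]
  · have := num_theta d s1 hx U1' Ux k0 k2 g1
    rw [show -M ^ 2 / (2 * C) = -((5 * d + 2 : ℕ) * s ^ 25) by rw [M2, ← hA]; field_simp]
    rw [← hA] at this ⊢
    push_cast at this ⊢
    exact this
  · calc (8 * N + 1 : ℝ) ^ d * Real.exp (-s ^ 25) ^ k ≤ Real.exp (s ^ 75) ^ d * Real.exp (-((d + 1) * s ^ 75)) := by
          rw [← Real.exp_nat_mul (-s ^ 25)]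
          gcongr
          have : (d + 1 : ℝ) * s ^ 50 * s ^ 25 ≤ k * s ^ 25 := by gcongr
          linarith only [this, show (d + 1 : ℝ) * s ^ 50 * s ^ 25 = (d + 1) * s ^ 75 by ring]
      _ = Real.exp (-s ^ 75) := by rw [← Real.exp_nat_mul, ← Real.exp_add]; congr 1; ring
      _ ≤ η := by linarith [Real.exp_pos (-s ^ 75)]
  · rw [vE]
    refine num_y d (by positivity) N3 (tE (ε / 2) _ (by positivity) ?_) hE le_rfl
    refine le_trans (le_of_eq ?_) g2; ring
  · refine num_T d (c5 := c5) (c6 := c6) _ s1 rfl (by positivity) N3 (by positivity) J2 T3 hc50 ?_ ?_ g5 (by simpa using g6) g7 hE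
    · have h1 : ((|h0| + ε / 2 + M) / bc) ^ 2 = 2 * (|h0| + ε / 2 + M) ^ 2 := by
        rw [div_pow, sq bc, bc_sq]; ring
      rw [h1]
      exact aux_c hc0 hlc (sp 25) (by rw [M2]; ring) hc5
    · push_cast
      have h1 : (d * m ^ 8 + 1 : ℝ) ≤ (d * 256 + 1) * s ^ 24 := by
        have : (d : ℝ) * m ^ 8 ≤ d * (256 * s ^ 24) := by gcongr
        linarith [sp 24]
      have h2 : (n0 * (d * m ^ 8 + 1) : ℝ) ≤ (c2 + 1) * (d * 256 + 1) * s ^ 49 := by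
        calc (n0 * (d * m ^ 8 + 1) : ℝ) ≤ ((c2 + 1) * s ^ 25) * ((d * 256 + 1) * s ^ 24) := by gcongr
          _ = _ := by ring
      have h3 : (d * (2 * (n0 * (d * m ^ 8 + 1)) + 2) : ℝ) ≤ d * ((2 * ((c2 + 1) * (d * 256 + 1)) + 2) * s ^ 49) := by
        gcongr; linarith [sp 49]
      rw [hc6]; linarith [sp 49]
end mainev

section finalasm
variable {d : ℕ}

lemma conn_rad (hd : 0 < d) (S : Set (V d)) (n : ℕ) :
    ConnIn S (box d (ufn ((n : ℝ) + 1))) (bdry d ((n : ℝ) + 1)) ↔ Rad ⌊ufn ((n : ℝ) + 1)⌋₊ (n + 1) S 0 := by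
  have hu : 0 ≤ ufn ((n : ℝ) + 1) := (Real.exp_pos _).le
  have h1 : ∀ y : V d, y ∈ box d (ufn ((n : ℝ) + 1)) ↔ dinf 0 y ≤ ⌊ufn ((n : ℝ) + 1)⌋₊ := by
    intro y
    rw [← boxAt_iff]
    unfold box boxAt
    simp only [mem_ofPred_eq]
    refine forall_congr' fun i => ?_
    have e : |((y i : ℤ) : ℝ) - (((0 : V d) i : ℤ) : ℝ)| = ((y i).natAbs : ℝ) := by
      rw [Nat.cast_natAbs]; simp
    rw [e, Nat.cast_le, Nat.le_floor_iff hu]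
  have h2 : ∀ y : V d, y ∈ bdry d ((n : ℝ) + 1) ↔ dinf 0 y = n + 1 := by
    intro y
    rw [← bdryAt_iff hd]
    unfold bdry
    push_cast
    rfl
  rw [connIn_iff]
  unfold Rad
  constructor
  · rintro ⟨a, ha, b, hb, h⟩
    exact ⟨a, b, (h1 a).1 ha, (h2 b).1 hb, h⟩
  · rintro ⟨a, b, ha, hb, h⟩
    exact ⟨a, (h1 a).2 ha, b, (h2 b).2 hb, h⟩

instance stdG_open (ι : Type*) [Fintype ι] : (stdG ι).IsOpenPosMeasure := by
  haveI : (gaussianReal 0 1).IsOpenPosMeasure :=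
    (gaussianReal_absolutelyContinuous' 0 one_ne_zero).isOpenPosMeasure
  unfold stdG; infer_instance

lemma dt_cont {ι : Type*} [Fintype ι] (c : ι → ℝ) : Continuous (dt c) := by
  unfold dt; fun_prop

lemma rad_pos (hd : 3 ≤ d) {Ω : Type*} [MeasurableSpace Ω] (P : Measure Ω) [IsProbabilityMeasure P] (φ : V d → Ω → ℝ)
    (hφ : IsGFF P φ) (U R : ℕ) (h : ℝ) : 0 < P {ω | ¬ Rad U R (lvl φ h ω) 0} := by
  obtain ⟨B, hB⟩ := GY_factor d hd 0 (fbx (0 : V d) U)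
  have hl := model_law hd P φ hφ U 0 B hB (fbx 0 U) (fun x hx => mem_fbx.1 hx) h h (fun S _ => S = ∅)
  refine lt_of_lt_of_le ?_ (measure_mono (μ := P) (s := {ω | {z | z ∈ fbx (0 : V d) U ∧ h ≤ φ z ω} = ∅}) ?_)
  · rw [hl]
    have e : {ξ : MI d U 0 → ℝ | {z | z ∈ fbx (0 : V d) U ∧ h ≤ dt (mco 0 B z) ξ} = ∅} =
        ⋂ z ∈ fbx (0 : V d) U, {ξ | dt (mco 0 B z) ξ < h} := by
      ext ξ
      simp only [mem_ofPred_eq, mem_iInter, Set.eq_empty_iff_forall_notMem, not_and, not_le]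
    rw [e]
    refine IsOpen.measure_pos _ ?_ ?_
    · exact isOpen_biInter_finset fun z _ => isOpen_lt (dt_cont _) continuous_const
    · refine ⟨Sum.elim (fun _ => (h - 1) / bc) (fun _ => 0), ?_⟩
      simp only [mem_iInter, mem_ofPred_eq]
      intro z hz
      rw [dt_split 0 B z hz]
      have : dt (inrOnly (mco 0 B z)) (Sum.elim (fun _ => (h - 1) / bc) (fun _ => 0)) = 0 := by
        unfold dt
        refine Finset.sum_eq_zero fun i _ => ?_
        rcases i with i | i <;> simp [inrOnly]
      rw [this, Sum.elim_inl, mul_div_cancel₀ _ bc_pos.ne']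
      linarith
  · intro ω hω
    rintro ⟨a, b, ha, hb, hc⟩
    have : a ∈ {z | z ∈ fbx (0 : V d) U ∧ h ≤ φ z ω} := ⟨mem_fbx.2 ha, hc.1⟩
    rw [mem_ofPred_eq] at hω
    rw [hω] at this
    exact this

lemma inf_seq (f : ℕ → ENNReal) (hf : ∀ n, 0 < f n) (h : ⨅ n, f n = 0) (n0 : ℕ) : ∀ η, 0 < η → ∃ n, n0 ≤ n ∧ f n < η := by
  induction n0 with
  | zero =>
    intro η hη
    rw [← h] at hη
    obtain ⟨n, hn⟩ := iInf_lt_iff.1 hη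
    exact ⟨n, Nat.zero_le _, hn⟩
  | succ k ih =>
    intro η hη
    obtain ⟨n, hn, h2⟩ := ih (min η (f k)) (lt_min hη (hf k))
    refine ⟨n, ?_, h2.trans_le (min_le_left _ _)⟩
    rcases hn.eq_or_lt with e | e
    · subst e; exact absurd (h2.trans_le (min_le_right _ _)) (lt_irrefl _)
    · exact e

lemma pick_h (T : Set ℝ) (hne : T.Nonempty) (ε : ℝ) (hε : 0 < ε) : ∃ h0 ∈ T, sSup T - 2 * ε ≤ h0 - ε := by
  by_cases hb : BddAbove T
  · obtain ⟨h0, h, h'⟩ := exists_lt_of_lt_csSup hne (show sSup T - ε < sSup T by linarith)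
    exact ⟨h0, h, by linarith⟩
  · rw [Real.sSup_of_not_bddAbove hb]
    obtain ⟨h0, h, h'⟩ := not_bddAbove_iff.1 hb (-ε)
    exact ⟨h0, h, by linarith⟩

theorem final_thm (hd : 3 ≤ d) {Ω : Type*} [MeasurableSpace Ω]
    (P : Measure Ω) [IsProbabilityMeasure P] (φ : V d → Ω → ℝ) (hφ : IsGFF P φ)
    (hne : (tildeSet d P φ).Nonempty) (ε : ℝ) (hε : 0 < ε) :
    Filter.limsup
        (fun N : ℕ => ⨅ (h : ℝ) (_ : h ≤ hTilde d P φ - 2 * ε), P (EEv d φ N h (h - ε)))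
        atTop = 1 := by
  obtain ⟨C, hC⟩ := green_far' d hd
  obtain ⟨C', hC', hG⟩ := GY_small d hd
  obtain ⟨c, hc0, hc1, hc⟩ := gauss_ratio (ε / bc) (div_pos hε bc_pos)
  obtain ⟨h0, hT, hh0⟩ := pick_h _ hne ε hε
  apply le_antisymm
  · refine limsup_le_of_le (h := Eventually.of_forall fun N => ?_)
    exact iInf₂_le_of_le (hTilde d P φ - 2 * ε) le_rfl prob_le_one
  · have key : ∀ η : ℝ, 0 < η → η ≤ 1 / 2 → 1 - ENNReal.ofReal (4 * η) ≤ Filter.limsup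
        (fun N : ℕ => ⨅ (h : ℝ) (_ : h ≤ hTilde d P φ - 2 * ε), P (EEv d φ N h (h - ε))) atTop := by
      intro η hη hη2
      have ev := main_ev (h0 := h0) P φ hd hφ hC hC' hG hε hη hη2 hc0 hc1 hc
      obtain ⟨n1, hn1⟩ := eventually_atTop.1 ev
      refine le_limsup_of_frequently_le (frequently_atTop.2 fun N0 => ?_)
      have hT' : (⨅ R : ℕ, ENNReal.ofReal (((R : ℝ) + 1) ^ d) *
        P {ω | ¬ ConnIn (lvl φ h0 ω) (box d (ufn ((R : ℝ) + 1))) (bdry d ((R : ℝ) + 1))}) = 0 := hT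
      simp_rw [conn_rad (by omega : 0 < d)] at hT'
      obtain ⟨n, hn, hlt⟩ := inf_seq _ (fun n => ENNReal.mul_pos (ENNReal.ofReal_pos.2 (by positivity)).ne' (rad_pos hd P φ hφ _ _ h0).ne')
        hT' (max n1 (10 * N0)) (ENNReal.ofReal η) (ENNReal.ofReal_pos.2 hη)
      refine ⟨n / 10, by have := (le_max_right n1 (10 * N0)).trans hn; omega, ?_⟩
      refine le_iInf₂ fun h hh => ?_
      have hE := hn1 n ((le_max_left _ _).trans hn) hlt.le h (hh.trans hh0)
      rw [tsub_le_iff_right]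
      refine le_trans ?_ (add_le_add le_rfl hE)
      refine le_trans ?_ (measure_union_le _ _)
      rw [union_compl_self, measure_univ]
    refine ENNReal.le_of_forall_pos_le_add fun δ hδ _ => ?_
    have hδ' : (0 : ℝ) < δ := hδ
    have k := key (min (δ / 4) (1 / 2)) (by positivity) (min_le_right _ _)
    rw [tsub_le_iff_right] at k
    refine k.trans (add_le_add le_rfl ?_)
    refine (ENNReal.ofReal_le_ofReal (show 4 * min ((δ : ℝ) / 4) (1 / 2) ≤ δ by linarith [min_le_left ((δ : ℝ) / 4) (1 / 2)])).trans ?_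
    rw [ENNReal.ofReal_coe_nnreal]

end finalasm


/-- Proposition 4.1: `limsup_N inf_{h ≤ h̃ - 2ε} P[ℰ(N, h, h - ε)] = 1`. -/
theorem connection_to_local_uniqueness (d : ℕ) (hd : 3 ≤ d) {Ω : Type*} [MeasurableSpace Ω]
    (P : Measure Ω) [IsProbabilityMeasure P] (φ : V d → Ω → ℝ) (hφ : IsGFF P φ)
    (hne : (tildeSet d P φ).Nonempty) (ε : ℝ) (hε : 0 < ε) :
    Filter.limsup
        (fun N : ℕ => ⨅ (h : ℝ) (_ : h ≤ hTilde d P φ - 2 * ε), P (EEv d φ N h (h - ε)))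
        atTop = 1 := by
  exact final_thm hd P φ hφ hne ε hε

end
end GFFperc
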